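/- Let n ≥ 1 and let p > 1 satisfy (n−2)p < n. Then the equation ∂ₜu = Δu + u^p possesses no positive classical solution u : ℝⁿ×ℝ → ℝ. -/

import Mathlib

open scoped BigOperators

/-- The Laplacian of `f : ℝⁿ → ℝ` at `x`, as the sum of the second partial
derivatives in the coordinate directions. -/
noncomputable def lap {n : ℕ} (f : EuclideanSpace ℝ (Fin n) → ℝ)
    (x : EuclideanSpace ℝ (Fin n)) : ℝ :=
  ∑ i : Fin n,
    fderiv ℝ (fun y => fderiv ℝ f y (EuclideanSpace.single i 1)) x
      (EuclideanSpace.single i 1)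

section

open MeasureTheory Set Filter Topology

/-- Euclidean `n`-space. -/
abbrev Eucl (n : ℕ) := EuclideanSpace ℝ (Fin n)

section Lap

variable {n : ℕ}

lemma contDiff_fderiv_apply_const {F : Type*} [NormedAddCommGroup F] [NormedSpace ℝ F]
    {f : F → ℝ} {m k : WithTop ℕ∞} (hf : ContDiff ℝ k f) (hmk : m + 1 ≤ k) (w : F) :
    ContDiff ℝ m (fun y => fderiv ℝ f y w) :=
  (hf.fderiv_right hmk).clm_apply contDiff_const

lemma continuous_lap {f : Eucl n → ℝ} (hf : ContDiff ℝ 2 f) : Continuous (lap f) := by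
  unfold lap
  refine continuous_finsetSum _ fun i _ => ?_
  have h1 : ContDiff ℝ 1 (fun y => fderiv ℝ f y (EuclideanSpace.single i 1)) :=
    contDiff_fderiv_apply_const hf (by norm_num) _
  exact (contDiff_fderiv_apply_const h1 (m := 0) (by norm_num) _).continuous

lemma hasCompactSupport_fderiv_apply {F : Type*} [NormedAddCommGroup F] [NormedSpace ℝ F]
    {f : F → ℝ} (hf : HasCompactSupport f) (w : F) :
    HasCompactSupport (fun y => fderiv ℝ f y w) :=
  hf.fderiv_apply ℝ w

lemma integral_fderiv_mul_comm {F : Type*} [NormedAddCommGroup F] [NormedSpace ℝ F]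
    [FiniteDimensional ℝ F] [MeasurableSpace F] [BorelSpace F] (μ : Measure F)
    [μ.IsAddHaarMeasure] {f g : F → ℝ} (hf : ContDiff ℝ 1 f) (hg : ContDiff ℝ 1 g)
    (hc : HasCompactSupport g) (w : F) :
    ∫ x, f x * fderiv ℝ g x w ∂μ = - ∫ x, fderiv ℝ f x w * g x ∂μ := by
  have cf := (contDiff_fderiv_apply_const hf (m := 0) (by norm_num) w).continuous
  have cg := (contDiff_fderiv_apply_const hg (m := 0) (by norm_num) w).continuous
  refine integral_mul_fderiv_eq_neg_fderiv_mul_of_integrable ?_ ?_ ?_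
    (fun x _ => (hf.differentiable (by norm_num)).differentiableAt)
    (fun x _ => (hg.differentiable (by norm_num)).differentiableAt)
  · exact (cf.mul hg.continuous).integrable_of_hasCompactSupport hc.mul_left
  · exact (hf.continuous.mul cg).integrable_of_hasCompactSupport
      (hasCompactSupport_fderiv_apply hc w).mul_left
  · exact (hf.continuous.mul hg.continuous).integrable_of_hasCompactSupport hc.mul_left

lemma integral_lap_mul {f g : Eucl n → ℝ} (hf : ContDiff ℝ 2 f) (hg : ContDiff ℝ 2 g)
    (hc : HasCompactSupport g) : ∫ x, lap f x * g x = ∫ x, f x * lap g x := by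
  have df (i : Fin n) : ContDiff ℝ 1 (fun y => fderiv ℝ f y (EuclideanSpace.single i 1)) :=
    contDiff_fderiv_apply_const hf (by norm_num) _
  have dg (i : Fin n) : ContDiff ℝ 1 (fun y => fderiv ℝ g y (EuclideanSpace.single i 1)) :=
    contDiff_fderiv_apply_const hg (by norm_num) _
  have ddf (i : Fin n) := (contDiff_fderiv_apply_const (df i) (m := 0) (by norm_num)
    (EuclideanSpace.single i 1)).continuous
  have ddg (i : Fin n) := (contDiff_fderiv_apply_const (dg i) (m := 0) (by norm_num)
    (EuclideanSpace.single i 1)).continuous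
  have cg (i : Fin n) := hasCompactSupport_fderiv_apply hc (EuclideanSpace.single i 1)
  unfold lap
  simp only [Finset.sum_mul, Finset.mul_sum]
  rw [integral_finsetSum, integral_finsetSum]
  · refine Finset.sum_congr rfl fun i _ => ?_
    have A := integral_fderiv_mul_comm volume (hf.of_le (by norm_num)) (dg i) (cg i)
      (EuclideanSpace.single i 1)
    have B := integral_fderiv_mul_comm volume (df i) (hg.of_le (by norm_num)) hc
      (EuclideanSpace.single i 1)
    linarith
  · intro i _
    exact (hf.continuous.mul (ddg i)).integrable_of_hasCompactSupport
      (hasCompactSupport_fderiv_apply (cg i) _).mul_left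
  · intro i _
    exact ((ddf i).mul hg.continuous).integrable_of_hasCompactSupport hc.mul_left

/-- First and second derivatives of a radial function. -/
lemma fderiv_radial {h : ℝ → ℝ} (hh : Differentiable ℝ h) (x y : Eucl n) (w : Eucl n) :
    fderiv ℝ (fun z => h (‖z - x‖ ^ 2)) y w = deriv h (‖y - x‖ ^ 2) * (2 * inner ℝ (y - x) w) := by
  have h1 : HasFDerivAt (fun z : Eucl n => ‖z - x‖ ^ 2) _ y :=
    ((hasFDerivAt_id y).sub_const x).norm_sq
  have h2 := ((hh (‖y - x‖ ^ 2)).hasDerivAt.comp_hasFDerivAt y h1).fderiv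
  have : (fun z : Eucl n => h (‖z - x‖ ^ 2)) = h ∘ fun z : Eucl n => ‖z - x‖ ^ 2 := rfl
  rw [this, h2]
  simp [inner_sub_left]

lemma lap_radial {h : ℝ → ℝ} (hh : ContDiff ℝ 2 h) (x y : Eucl n) :
    lap (fun z => h (‖z - x‖ ^ 2)) y
      = 4 * ‖y - x‖ ^ 2 * deriv (deriv h) (‖y - x‖ ^ 2) + 2 * n * deriv h (‖y - x‖ ^ 2) := by
  have h1 : Differentiable ℝ h := hh.differentiable (by norm_num)
  have h2 : ContDiff ℝ 1 (deriv h) := hh.deriv'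
  have h3 : Differentiable ℝ (deriv h) := h2.differentiable (by norm_num)
  unfold lap
  simp_rw [fderiv_radial h1]
  have key (i : Fin n) : fderiv ℝ (fun z : Eucl n => deriv h (‖z - x‖ ^ 2) *
      (2 * inner ℝ (z - x) (EuclideanSpace.single i (1:ℝ)))) y (EuclideanSpace.single i 1)
      = 4 * (y i - x i) ^ 2 * deriv (deriv h) (‖y - x‖ ^ 2) + 2 * deriv h (‖y - x‖ ^ 2) := by
    have e1 : (fun z : Eucl n => deriv h (‖z - x‖ ^ 2) *
      (2 * inner ℝ (z - x) (EuclideanSpace.single i (1:ℝ)))) =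
      fun z : Eucl n => deriv h (‖z - x‖ ^ 2) * (2 * (z i - x i)) := by
      ext z; simp [EuclideanSpace.inner_single_right]
    have d1 : DifferentiableAt ℝ (fun z : Eucl n => deriv h (‖z - x‖ ^ 2)) y := by
      have : ContDiff ℝ 1 (fun z : Eucl n => deriv h (‖z - x‖ ^ 2)) :=
        h2.comp ((contDiff_id.sub contDiff_const).norm_sq ℝ)
      exact (this.differentiable (by norm_num)).differentiableAt
    have d2 : HasFDerivAt (fun z : Eucl n => 2 * (z i - x i))
        ((2:ℝ) • (EuclideanSpace.proj i : Eucl n →L[ℝ] ℝ)) y :=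
      (((EuclideanSpace.proj i : Eucl n →L[ℝ] ℝ).hasFDerivAt).sub_const (x i)).const_mul 2
    rw [e1, fderiv_fun_mul d1 d2.differentiableAt, d2.fderiv]
    simp only [add_apply, smul_apply]
    rw [fderiv_radial h3]
    simp [EuclideanSpace.inner_single_right]
    ring
  rw [Finset.sum_congr rfl fun i _ => key i, Finset.sum_add_distrib, ← Finset.sum_mul,
    ← Finset.mul_sum, EuclideanSpace.norm_sq_eq]
  simp
  ring

end Lap

lemma le_of_forall_right_slope {f : ℝ → ℝ} {a b : ℝ} (hab : a ≤ b)
    (hf : ContinuousOn f (Icc a b))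
    (h : ∀ t ∈ Ioo a b, ∀ ε > 0, ∀ᶠ s in 𝓝[>] t, f t - ε * (s - t) ≤ f s) : f a ≤ f b := by
  rcases hab.eq_or_lt with rfl | hlt
  · exact le_rfl
  have key : ∀ a' ∈ Ioo a b, f a' ≤ f b := by
    intro a' ha'
    refine le_of_forall_pos_le_add fun δ hδ => ?_
    set ε := δ / (b - a') with hε
    have hb : 0 < b - a' := by linarith [ha'.2]
    have hεp : 0 < ε := by positivity
    have hcont : ContinuousOn (fun s => f s + ε * s) (Icc a' b) :=
      (hf.mono (Icc_subset_Icc_left ha'.1.le)).add (by fun_prop)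
    have hcl : IsClosed ({s | f a' + ε * a' ≤ f s + ε * s} ∩ Icc a' b) := by
      rw [inter_comm]
      exact hcont.preimage_isClosed_of_isClosed isClosed_Icc isClosed_Ici
    have := hcl.mem_of_ge_of_forall_exists_gt (by simp) ha'.2.le ?_
    · have h3 : f a' + ε * a' ≤ f b + ε * b := this
      have : ε * (b - a') = δ := by rw [hε]; field_simp
      linarith
    · rintro x ⟨hx, hx1, hx2⟩
      have e1 := h x ⟨ha'.1.trans_le hx1, hx2⟩ ε hεp
      have e2 : ∀ᶠ s in 𝓝[>] x, s ∈ Ioc x b := Ioc_mem_nhdsGT hx2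
      obtain ⟨s, hs1, hs2⟩ := (e1.and e2).exists
      refine ⟨s, ?_, hs2⟩
      have hx : f a' + ε * a' ≤ f x + ε * x := hx
      change f a' + ε * a' ≤ f s + ε * s
      linarith
  have hc : Tendsto f (𝓝[>] a) (𝓝 (f a)) := by
    have := hf a (left_mem_Icc.2 hab)
    exact (this.mono_left (nhdsWithin_le_of_mem (Icc_mem_nhdsGT hlt)))
  refine le_of_tendsto hc ?_
  filter_upwards [Ioo_mem_nhdsGT hlt] with s hs using key s hs

section Weak

variable {n : ℕ}

lemma continuousOn_integral_of_bdd {h : Eucl n → ℝ → ℝ} {J : Set ℝ} {x0 : Eucl n} {r C : ℝ}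
    (hm : ∀ s ∈ J, AEStronglyMeasurable (fun y => h y s) volume)
    (hb : ∀ s ∈ J, ∀ y ∈ Metric.closedBall x0 r, ‖h y s‖ ≤ C)
    (h0 : ∀ s ∈ J, ∀ y ∉ Metric.closedBall x0 r, h y s = 0)
    (hc : ∀ y, ContinuousOn (h y) J) : ContinuousOn (fun s => ∫ y, h y s) J := by
  intro s hs
  refine continuousWithinAt_of_dominated (bound := (Metric.closedBall x0 r).indicator fun _ => C)
    ?_ ?_ ?_ ?_
  · filter_upwards [self_mem_nhdsWithin] with t ht using hm t ht
  · filter_upwards [self_mem_nhdsWithin] with t ht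
    refine Eventually.of_forall fun y => ?_
    by_cases hy : y ∈ Metric.closedBall x0 r
    · simpa [indicator_of_mem hy] using hb t ht y hy
    · simp [indicator_of_notMem hy, h0 t ht y hy]
  · refine (integrable_indicator_iff Metric.isClosed_closedBall.measurableSet).2 ?_
    exact integrableOn_const (by exact (isCompact_closedBall x0 r).measure_lt_top.ne)
  · exact Eventually.of_forall fun y => hc y s hs

/-- A nonnegative space-time test function on `[a, b]`, supported in `x` well inside
`ball x0 R`, together with its time derivative and its Laplacian. -/
structure IsTest (x0 : Eucl n) (R a b : ℝ) (ψ ψt ψL : Eucl n → ℝ → ℝ) : Prop where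
  nonneg : ∀ y, ∀ s ∈ Icc a b, 0 ≤ ψ y s
  supp : ∃ R' < R, ∀ y ∉ Metric.closedBall x0 R', ∀ s ∈ Icc a b,
    ψ y s = 0 ∧ ψt y s = 0 ∧ ψL y s = 0
  contDiff : ∀ s ∈ Icc a b, ContDiff ℝ 2 fun y => ψ y s
  lap_eq : ∀ s ∈ Icc a b, ∀ y, lap (fun z => ψ z s) y = ψL y s
  hasDerivAt : ∀ s ∈ Icc a b, ∀ y, HasDerivAt (ψ y) (ψt y s) s
  cont : ContinuousOn (fun q : Eucl n × ℝ => ψ q.1 q.2) (univ ×ˢ Icc a b)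
  cont_t : ContinuousOn (fun q : Eucl n × ℝ => ψt q.1 q.2) (univ ×ˢ Icc a b)
  cont_L : ContinuousOn (fun q : Eucl n × ℝ => ψL q.1 q.2) (univ ×ˢ Icc a b)

/-- The inequality `∂ₜ v ≥ Δ v + g` on `ball x0 R × J`, tested against nonnegative functions. -/
def WeakOn (v g : Eucl n → ℝ → ℝ) (x0 : Eucl n) (R : ℝ) (J : Set ℝ) : Prop :=
  ∀ a b, a ≤ b → Icc a b ⊆ J → ∀ ψ ψt ψL, IsTest x0 R a b ψ ψt ψL →
    (∫ s in a..b, ∫ y, (v y s * (ψt y s + ψL y s) + g y s * ψ y s)) ≤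
      (∫ y, v y b * ψ y b) - ∫ y, v y a * ψ y a

lemma WeakOn.mono {v g : Eucl n → ℝ → ℝ} {x0 : Eucl n} {R : ℝ} {J J' : Set ℝ}
    (h : WeakOn v g x0 R J) (hJ : J' ⊆ J) : WeakOn v g x0 R J' :=
  fun a b hab hI => h a b hab (hI.trans hJ)

lemma IsTest.mono {x0 : Eucl n} {R a b a' b' : ℝ} {ψ ψt ψL : Eucl n → ℝ → ℝ}
    (h : IsTest x0 R a b ψ ψt ψL) (hI : Icc a' b' ⊆ Icc a b) : IsTest x0 R a' b' ψ ψt ψL where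
  nonneg y s hs := h.nonneg y s (hI hs)
  supp := by
    obtain ⟨R', hR, h1⟩ := h.supp
    exact ⟨R', hR, fun y hy s hs => h1 y hy s (hI hs)⟩
  contDiff s hs := h.contDiff s (hI hs)
  lap_eq s hs := h.lap_eq s (hI hs)
  hasDerivAt s hs := h.hasDerivAt s (hI hs)
  cont := h.cont.mono (prod_mono_right hI)
  cont_t := h.cont_t.mono (prod_mono_right hI)
  cont_L := h.cont_L.mono (prod_mono_right hI)

lemma continuousOn_slices {f : Eucl n → ℝ → ℝ} {J : Set ℝ}
    (h : ContinuousOn (fun q : Eucl n × ℝ => f q.1 q.2) (univ ×ˢ J)) :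
    (∀ y, ContinuousOn (f y) J) ∧ ∀ s ∈ J, Continuous fun y => f y s := by
  constructor
  · intro y
    exact h.comp (f := fun s => (y, s)) (by fun_prop) fun s hs => ⟨mem_univ _, hs⟩
  · intro s hs
    rw [← continuousOn_univ]
    exact h.comp (f := fun y => (y, s)) (by fun_prop) fun y _ => ⟨mem_univ _, hs⟩

lemma IsTest.bdd {x0 : Eucl n} {R a b : ℝ} {ψ ψt ψL : Eucl n → ℝ → ℝ}
    (h : IsTest x0 R a b ψ ψt ψL) : ∃ C, 0 ≤ C ∧ ∀ y ∈ Metric.closedBall x0 R, ∀ s ∈ Icc a b,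
      |ψ y s| ≤ C ∧ |ψt y s| ≤ C ∧ |ψL y s| ≤ C := by
  have hK : IsCompact (Metric.closedBall x0 R ×ˢ Icc a b) :=
    (isCompact_closedBall x0 R).prod isCompact_Icc
  have hs : Metric.closedBall x0 R ×ˢ Icc a b ⊆ univ ×ˢ Icc a b := prod_mono_left (subset_univ _)
  obtain ⟨C1, h1⟩ := hK.exists_bound_of_continuousOn (h.cont.mono hs)
  obtain ⟨C2, h2⟩ := hK.exists_bound_of_continuousOn (h.cont_t.mono hs)
  obtain ⟨C3, h3⟩ := hK.exists_bound_of_continuousOn (h.cont_L.mono hs)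
  refine ⟨max 0 (max C1 (max C2 C3)), le_max_left _ _, fun y hy s hs => ⟨?_, ?_, ?_⟩⟩
  · exact (h1 (y, s) ⟨hy, hs⟩).trans (by simp)
  · exact (h2 (y, s) ⟨hy, hs⟩).trans (by simp)
  · exact (h3 (y, s) ⟨hy, hs⟩).trans (by simp)

/-- Regularity and boundedness of a pair `(v, g)` on a cylinder. -/
structure SepBdd (v g : Eucl n → ℝ → ℝ) (x0 : Eucl n) (R α β M A : ℝ) : Prop where
  contDiff_x : ∀ t, ContDiff ℝ 2 fun y => v y t
  contDiff_t : ∀ y, ContDiff ℝ 1 (v y)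
  cont_gx : ∀ t, Continuous fun y => g y t
  cont_gt : ∀ y, Continuous (g y)
  nonneg : ∀ y ∈ Metric.ball x0 R, ∀ t ∈ Icc α β, 0 ≤ v y t
  le : ∀ y ∈ Metric.ball x0 R, ∀ t ∈ Icc α β, v y t ≤ M
  abs_le : ∀ y ∈ Metric.ball x0 R, ∀ t ∈ Icc α β, |g y t| ≤ A

variable {v g : Eucl n → ℝ → ℝ} {x0 : Eucl n} {R α β M A : ℝ}

lemma SepBdd.continuousOn_mass (h : SepBdd v g x0 R α β M A) {a b : ℝ} (hI : Icc a b ⊆ Icc α β)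
    {ψ ψt ψL : Eucl n → ℝ → ℝ} (hψ : IsTest x0 R a b ψ ψt ψL) :
    ContinuousOn (fun s => ∫ y, v y s * ψ y s) (Icc a b) := by
  obtain ⟨R', hR', hs⟩ := hψ.supp
  obtain ⟨C, hC0, hC⟩ := hψ.bdd
  have hc := continuousOn_slices hψ.cont
  refine continuousOn_integral_of_bdd (x0 := x0) (r := R') (C := M * C) ?_ ?_ ?_ ?_
  · intro s hs
    exact ((h.contDiff_x s).continuous.mul (hc.2 s hs)).aestronglyMeasurable
  · intro s hs y hy
    have hyb : y ∈ Metric.ball x0 R := Metric.closedBall_subset_ball hR' hy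
    have h0 := h.nonneg y hyb s (hI hs)
    rw [norm_mul, Real.norm_of_nonneg h0]
    exact mul_le_mul (h.le y hyb s (hI hs)) (hC y (Metric.ball_subset_closedBall hyb) s hs).1
      (norm_nonneg _) (h0.trans (h.le y hyb s (hI hs)))
  · intro s hs1 y hy
    rw [(hs y hy s hs1).1, mul_zero]
  · intro y
    exact (h.contDiff_t y).continuous.continuousOn.mul (hc.1 y)

lemma SepBdd.continuousOn_source (h : SepBdd v g x0 R α β M A) {a b : ℝ}
    (hI : Icc a b ⊆ Icc α β)
    {ψ ψt ψL : Eucl n → ℝ → ℝ} (hψ : IsTest x0 R a b ψ ψt ψL) :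
    ContinuousOn (fun s => ∫ y, (v y s * (ψt y s + ψL y s) + g y s * ψ y s)) (Icc a b) := by
  obtain ⟨R', hR', hs⟩ := hψ.supp
  obtain ⟨C, hC0, hC⟩ := hψ.bdd
  have hc := continuousOn_slices hψ.cont
  have hct := continuousOn_slices hψ.cont_t
  have hcL := continuousOn_slices hψ.cont_L
  refine continuousOn_integral_of_bdd (x0 := x0) (r := R') (C := M * (C + C) + A * C) ?_ ?_ ?_ ?_
  · intro s hs
    exact (((h.contDiff_x s).continuous.mul ((hct.2 s hs).add (hcL.2 s hs))).add
      ((h.cont_gx s).mul (hc.2 s hs))).aestronglyMeasurable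
  · intro s hs y hy
    have hyb : y ∈ Metric.ball x0 R := Metric.closedBall_subset_ball hR' hy
    have h0 := h.nonneg y hyb s (hI hs)
    obtain ⟨c1, c2, c3⟩ := hC y (Metric.ball_subset_closedBall hyb) s hs
    refine (norm_add_le _ _).trans (add_le_add ?_ ?_)
    · rw [norm_mul, Real.norm_of_nonneg h0]
      exact mul_le_mul (h.le y hyb s (hI hs)) ((norm_add_le _ _).trans (add_le_add c2 c3))
        (norm_nonneg _) (h0.trans (h.le y hyb s (hI hs)))
    · rw [norm_mul]
      exact mul_le_mul (h.abs_le y hyb s (hI hs)) c1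
        (norm_nonneg _) ((abs_nonneg _).trans (h.abs_le y hyb s (hI hs)))
  · intro s hs1 y hy
    obtain ⟨e1, e2, e3⟩ := hs y hy s hs1
    rw [e1, e2, e3]; ring
  · intro y
    exact ((h.contDiff_t y).continuous.continuousOn.mul ((hct.1 y).add (hcL.1 y))).add
      ((h.cont_gt y).continuousOn.mul (hc.1 y))

/-- Weak inequalities follow from a one-sided infinitesimal condition inside the interval. -/
lemma SepBdd.weakOn_of_slope (h : SepBdd v g x0 R α β M A) {J : Set ℝ} (hJ : J ⊆ Icc α β)
    (H : ∀ a b, Icc a b ⊆ J → ∀ ψ ψt ψL, IsTest x0 R a b ψ ψt ψL → ∀ t ∈ Ioo a b, ∀ ε > 0,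
      ∀ᶠ s in 𝓝[>] t, (∫ y, v y t * ψ y t) +
        (∫ r in t..s, ∫ y, (v y r * (ψt y r + ψL y r) + g y r * ψ y r)) - ε * (s - t)
        ≤ ∫ y, v y s * ψ y s) : WeakOn v g x0 R J := by
  intro a b hab hI ψ ψt ψL hψ
  have c1 := h.continuousOn_mass (hI.trans hJ) hψ
  have c2 := h.continuousOn_source (hI.trans hJ) hψ
  set k : ℝ → ℝ := fun s => ∫ y, (v y s * (ψt y s + ψL y s) + g y s * ψ y s) with hk
  have ik : ∀ s ∈ Icc a b, ∀ t ∈ Icc a b, IntervalIntegrable k volume s t := by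
    intro s hs t ht
    exact (c2.mono (by
      have := (convex_Icc a b).ordConnected
      exact this.uIcc_subset hs ht)).intervalIntegrable
  have := le_of_forall_right_slope (f := fun s => (∫ y, v y s * ψ y s) - ∫ r in a..s, k r) hab
    ?_ ?_
  · simp only [intervalIntegral.integral_same] at this
    linarith
  · refine c1.sub ?_
    have := intervalIntegral.continuousOn_primitive_interval (f := k) (a := a) (b := b)
      (μ := volume) (by rw [uIcc_of_le hab]; exact c2.integrableOn_Icc)
    rwa [uIcc_of_le hab] at this
  · intro t ht ε hε
    filter_upwards [H a b hI ψ ψt ψL hψ t ht ε hε, Ioo_mem_nhdsGT ht.2] with s hs hs2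
    have ht' : t ∈ Icc a b := Ioo_subset_Icc_self ht
    have hs' : s ∈ Icc a b := ⟨ht.1.le.trans hs2.1.le, hs2.2.le⟩
    have := intervalIntegral.integral_add_adjacent_intervals
      (ik a (left_mem_Icc.2 hab) t ht') (ik t ht' s hs')
    rw [← this]
    linarith

lemma WeakOn.slope {J : Set ℝ} {t δ : ℝ} (hδ : 0 < δ)
    (h : WeakOn v g x0 R (J ∩ Ioo (t - δ) (t + δ))) {a b : ℝ} (hI : Icc a b ⊆ J)
    {ψ ψt ψL : Eucl n → ℝ → ℝ} (hψ : IsTest x0 R a b ψ ψt ψL) (ht : t ∈ Ioo a b)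
    {ε : ℝ} (hε : 0 < ε) : ∀ᶠ s in 𝓝[>] t, (∫ y, v y t * ψ y t) +
        (∫ r in t..s, ∫ y, (v y r * (ψt y r + ψL y r) + g y r * ψ y r)) - ε * (s - t)
        ≤ ∫ y, v y s * ψ y s := by
  filter_upwards [Ioo_mem_nhdsGT ht.2,
    Ioo_mem_nhdsGT (show t < t + δ by linarith)] with s hs hs2
  have hsub : Icc t s ⊆ Icc a b := Icc_subset_Icc ht.1.le hs.2.le
  have := h t s hs.1.le (fun r hr => ⟨hI (hsub hr), by linarith [hr.1], by linarith [hr.2, hs2.2]⟩)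
    ψ ψt ψL (hψ.mono hsub)
  have : 0 ≤ ε * (s - t) := mul_nonneg hε.le (by linarith [hs.1])
  linarith

end Weak

lemma hasDerivAt_max_zero_pow (k : ℕ) (x : ℝ) :
    HasDerivAt (fun x : ℝ => (max x 0) ^ (k + 2)) ((k + 2) * (max x 0) ^ (k + 1)) x := by
  rcases lt_trichotomy x 0 with hx | rfl | hx
  · have : (fun x : ℝ => (max x 0) ^ (k + 2)) =ᶠ[𝓝 x] fun _ => 0 := by
      filter_upwards [Iio_mem_nhds hx] with y hy
      rw [max_eq_right (le_of_lt hy)]; simp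
    rw [max_eq_right hx.le]
    simpa using (hasDerivAt_const x (0:ℝ)).congr_of_eventuallyEq this
  · have : (fun y : ℝ => (max y 0) ^ (k + 2) - (max (0:ℝ) 0) ^ (k + 2) - (y - 0) • (0:ℝ))
        =o[𝓝 0] fun y => y - 0 := by
      have h1 : (fun y : ℝ => (max y 0) ^ (k + 2)) =O[𝓝 0] fun y : ℝ => y ^ (k + 2) := by
        refine Asymptotics.IsBigO.of_bound 1 (Eventually.of_forall fun y => ?_)
        rw [norm_pow, norm_pow, one_mul]
        refine pow_le_pow_left₀ (norm_nonneg _) ?_ _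
        rw [Real.norm_of_nonneg (le_max_right _ _), Real.norm_eq_abs]
        exact max_le (le_abs_self _) (abs_nonneg _)
      have h2 : (fun y : ℝ => y ^ (k + 2)) =o[𝓝 0] fun y => y :=
        Asymptotics.isLittleO_pow_id (by omega)
      simpa using h1.trans_isLittleO h2
    simpa [hasDerivAt_iff_isLittleO] using this
  · have : (fun x : ℝ => (max x 0) ^ (k + 2)) =ᶠ[𝓝 x] fun x => x ^ (k + 2) := by
      filter_upwards [Ioi_mem_nhds hx] with y hy
      rw [max_eq_left (le_of_lt hy)]
    rw [max_eq_left hx.le]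
    simpa using (hasDerivAt_pow (k + 2) x).congr_of_eventuallyEq this

/-- A convex truncation of the identity which vanishes on `(0, c]`. -/
noncomputable def trunc (c P : ℝ) : ℝ := (max (P - c) 0) ^ 3 / P ^ 2

/-- The first derivative of `trunc c`. -/
noncomputable def trunc' (c P : ℝ) : ℝ :=
  3 * (max (P - c) 0) ^ 2 / P ^ 2 - 2 * (max (P - c) 0) ^ 3 / P ^ 3

/-- The second derivative of `trunc c`. -/
noncomputable def trunc'' (c P : ℝ) : ℝ :=
  6 * max (P - c) 0 * (P - max (P - c) 0) ^ 2 / P ^ 4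

lemma hasDerivAt_trunc (c : ℝ) {P : ℝ} (hP : 0 < P) :
    HasDerivAt (trunc c) (trunc' c P) P := by
  have h1 := (hasDerivAt_max_zero_pow 1 (P - c)).comp_sub_const P c
  have h2 := (hasDerivAt_pow 2 P)
  refine (h1.div h2 (by positivity)).congr_deriv ?_
  unfold trunc'
  field_simp
  push_cast
  ring

lemma hasDerivAt_trunc' (c : ℝ) {P : ℝ} (hP : 0 < P) :
    HasDerivAt (trunc' c) (trunc'' c P) P := by
  have h1 := (hasDerivAt_max_zero_pow 1 (P - c)).comp_sub_const P c
  have h2 := (hasDerivAt_max_zero_pow 0 (P - c)).comp_sub_const P c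
  have h3 := ((h2.const_mul 3).div (hasDerivAt_pow 2 P) (by positivity)).sub
    ((h1.const_mul 2).div (hasDerivAt_pow 3 P) (by positivity))
  refine h3.congr_deriv ?_
  unfold trunc''
  field_simp
  push_cast
  ring

lemma trunc''_nonneg (c P : ℝ) : 0 ≤ trunc'' c P := by
  unfold trunc''
  have : 0 ≤ max (P - c) 0 := le_max_right _ _
  positivity

lemma trunc_nonneg (c P : ℝ) : 0 ≤ trunc c P := by
  unfold trunc
  have : 0 ≤ max (P - c) 0 := le_max_right _ _
  positivity

lemma trunc_le {c P : ℝ} (hc : 0 ≤ c) (hP : 0 < P) : trunc c P ≤ P := by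
  unfold trunc
  rw [div_le_iff₀ (by positivity)]
  have h1 : max (P - c) 0 ≤ P := max_le (by linarith) hP.le
  calc max (P - c) 0 ^ 3 ≤ P ^ 3 := pow_le_pow_left₀ (le_max_right _ _) h1 3
    _ = P * P ^ 2 := by ring

lemma sub_le_trunc {c P : ℝ} (hc : 0 ≤ c) (hP : 0 < P) : P - 3 * c ≤ trunc c P := by
  rcases le_total P c with h | h
  · exact le_trans (by linarith) (trunc_nonneg c P)
  · unfold trunc
    rw [max_eq_left (by linarith), le_div_iff₀ (by positivity)]
    nlinarith [mul_nonneg (mul_nonneg hc hc) (sub_nonneg.2 h), mul_nonneg (mul_nonneg hc hc) hP.le]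

lemma trunc_ge_quarter {c P : ℝ} (hc : 0 < c) (hP : 2 * c ≤ P) : c / 4 ≤ trunc c P := by
  unfold trunc
  have hP0 : 0 < P := by linarith
  rw [max_eq_left (by linarith), le_div_iff₀ (by positivity)]
  have h1 : P / 2 ≤ P - c := by linarith
  have h2 : (P / 2) ^ 2 ≤ (P - c) ^ 2 := pow_le_pow_left₀ (by positivity) h1 2
  have h3 : c ≤ P - c := by linarith
  calc c / 4 * P ^ 2 = c * (P / 2) ^ 2 := by ring
    _ ≤ (P - c) * (P - c) ^ 2 := mul_le_mul h3 h2 (by positivity) (by linarith)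
    _ = (P - c) ^ 3 := by ring

lemma trunc_eq_zero {c P : ℝ} (h : P ≤ c) :
    trunc c P = 0 ∧ trunc' c P = 0 ∧ trunc'' c P = 0 := by
  have : max (P - c) 0 = 0 := max_eq_right (by linarith)
  refine ⟨?_, ?_, ?_⟩ <;> simp [trunc, trunc', trunc'', this]

lemma contDiff_two_of_hasDerivAt {h h1 h2 : ℝ → ℝ} (e1 : ∀ r, HasDerivAt h (h1 r) r)
    (e2 : ∀ r, HasDerivAt h1 (h2 r) r) (hc : Continuous h2) :
    ContDiff ℝ 2 h ∧ deriv h = h1 ∧ deriv (deriv h) = h2 := by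
  have d1 : deriv h = h1 := funext fun r => (e1 r).deriv
  have d2 : deriv h1 = h2 := funext fun r => (e2 r).deriv
  refine ⟨?_, d1, by rw [d1, d2]⟩
  have : ContDiff ℝ (1 + 1) h := by
    rw [contDiff_succ_iff_deriv]
    refine ⟨fun r => (e1 r).differentiableAt, by simp, ?_⟩
    rw [d1, contDiff_one_iff_deriv, d2]
    exact ⟨fun r => (e2 r).differentiableAt, hc⟩
  simpa [one_add_one_eq_two] using this

/-- The heat kernel in dimension `n`, at time `σ` and squared distance `r`. -/
noncomputable def heatK (n : ℕ) (σ r : ℝ) : ℝ :=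
  (4 * Real.pi * σ) ^ (-((n : ℝ) / 2)) * Real.exp (-(r / (4 * σ)))

section Heat

variable {n : ℕ}

lemma heatK_pos (n : ℕ) {σ : ℝ} (hσ : 0 < σ) (r : ℝ) : 0 < heatK n σ r := by
  unfold heatK
  have := Real.pi_pos
  positivity

lemma hasDerivAt_heatK_r (n : ℕ) (σ r : ℝ) :
    HasDerivAt (fun r => heatK n σ r) (-(heatK n σ r / (4 * σ))) r := by
  unfold heatK
  have h := ((((hasDerivAt_id r).div_const (4 * σ)).neg).exp).const_mul
    ((4 * Real.pi * σ) ^ (-((n : ℝ) / 2)))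
  refine h.congr_deriv ?_
  simp only [id, Pi.neg_apply]
  ring

lemma hasDerivAt_heatK_σ (n : ℕ) {σ : ℝ} (hσ : 0 < σ) (r : ℝ) :
    HasDerivAt (fun σ => heatK n σ r)
      (heatK n σ r * (r / (4 * σ ^ 2) - n / (2 * σ))) σ := by
  have hπ := Real.pi_pos
  unfold heatK
  have h1 : HasDerivAt (fun σ : ℝ => (4 * Real.pi * σ) ^ (-((n : ℝ) / 2)))
      ((4 * Real.pi) * (-((n : ℝ) / 2)) * (4 * Real.pi * σ) ^ (-((n : ℝ) / 2) - 1)) σ := by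
    have := ((hasDerivAt_id σ).const_mul (4 * Real.pi)).rpow_const (p := -((n : ℝ) / 2))
      (Or.inl (by simp only [id]; positivity))
    simpa using this
  have h2 : HasDerivAt (fun σ : ℝ => Real.exp (-(r / (4 * σ))))
      (Real.exp (-(r / (4 * σ))) * (r / (4 * σ ^ 2))) σ := by
    have h3 : HasDerivAt (fun σ : ℝ => -(r / (4 * σ))) (r / (4 * σ ^ 2)) σ := by
      have := ((hasDerivAt_const σ r).div ((hasDerivAt_id σ).const_mul 4)
        (by simp only [id]; positivity)).neg
      refine this.congr_deriv ?_
      simp only [id]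
      field_simp
      ring
    exact h3.exp
  refine (h1.mul h2).congr_deriv ?_
  rw [Real.rpow_sub_one (by positivity)]
  field_simp
  ring

lemma integral_heatK (n : ℕ) {σ : ℝ} (hσ : 0 < σ) (x : Eucl n) :
    Integrable (fun y : Eucl n => heatK n σ (‖y - x‖ ^ 2)) ∧
      ∫ y : Eucl n, heatK n σ (‖y - x‖ ^ 2) = 1 := by
  have hπ := Real.pi_pos
  have hb : 0 < 1 / (4 * σ) := by positivity
  have e : (fun y : Eucl n => heatK n σ (‖y‖ ^ 2)) =
      fun y => (4 * Real.pi * σ) ^ (-((n : ℝ) / 2)) * Real.exp (-(1 / (4 * σ)) * ‖y‖ ^ 2) := by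
    ext y; unfold heatK; congr 2; ring
  have I := GaussianFourier.integral_rexp_neg_mul_sq_norm (V := Eucl n) hb
  have val : ∫ y : Eucl n, heatK n σ (‖y‖ ^ 2) = 1 := by
    rw [e, integral_const_mul, I, finrank_euclideanSpace_fin]
    have : Real.pi / (1 / (4 * σ)) = 4 * Real.pi * σ := by field_simp
    rw [this, ← Real.rpow_add (by positivity)]
    simp
  have h0 : Integrable (fun y : Eucl n => heatK n σ (‖y‖ ^ 2)) := by
    by_contra hc
    rw [integral_undef hc] at val
    norm_num at val
  constructor
  · exact h0.comp_sub_right x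
  · rw [← val]
    exact integral_sub_right_eq_self (fun y : Eucl n => heatK n σ (‖y‖ ^ 2)) x

lemma sq_mul_heatK_le (n : ℕ) {σ : ℝ} (hσ : 0 < σ) (r : ℝ) :
    r * heatK n σ r ≤ 8 * 2 ^ ((n : ℝ) / 2) * σ * heatK n (2 * σ) r := by
  have hπ := Real.pi_pos
  unfold heatK
  have e1 : (4 * Real.pi * (2 * σ)) ^ (-((n : ℝ) / 2)) =
      (2 ^ ((n : ℝ) / 2))⁻¹ * (4 * Real.pi * σ) ^ (-((n : ℝ) / 2)) := by
    rw [← Real.rpow_neg (by norm_num), ← Real.mul_rpow (by norm_num) (by positivity)]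
    congr 1; ring
  have e2 : Real.exp (-(r / (4 * σ))) =
      Real.exp (-(r / (4 * (2 * σ)))) * Real.exp (-(r / (4 * (2 * σ)))) := by
    rw [← Real.exp_add]; congr 1; field_simp; ring
  have e3 : r * Real.exp (-(r / (4 * (2 * σ)))) ≤ 8 * σ := by
    have h := Real.add_one_le_exp (r / (4 * (2 * σ)))
    rw [Real.exp_neg, ← div_eq_mul_inv, div_le_iff₀ (Real.exp_pos _)]
    have : r = 8 * σ * (r / (4 * (2 * σ))) := by field_simp; ring
    calc r = 8 * σ * (r / (4 * (2 * σ))) := this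
      _ ≤ _ := by gcongr; linarith
  rw [e1, e2]
  have hA : 0 < (4 * Real.pi * σ) ^ (-((n : ℝ) / 2)) := by positivity
  have hB : 0 < Real.exp (-(r / (4 * (2 * σ)))) := Real.exp_pos _
  have hC : (0:ℝ) < 2 ^ ((n : ℝ) / 2) := by positivity
  set A := (4 * Real.pi * σ) ^ (-((n : ℝ) / 2))
  set B := Real.exp (-(r / (4 * (2 * σ))))
  set C := (2:ℝ) ^ ((n : ℝ) / 2)
  calc r * (A * (B * B)) = (r * B) * (A * B) := by ring
    _ ≤ (8 * σ) * (A * B) := by gcongr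
    _ = 8 * C * σ * (C⁻¹ * A * B) := by field_simp

lemma integral_sq_mul_heatK (n : ℕ) {σ : ℝ} (hσ : 0 < σ) (x : Eucl n) :
    Integrable (fun y : Eucl n => ‖y - x‖ ^ 2 * heatK n σ (‖y - x‖ ^ 2)) ∧
      ∫ y : Eucl n, ‖y - x‖ ^ 2 * heatK n σ (‖y - x‖ ^ 2) ≤ 8 * 2 ^ ((n : ℝ) / 2) * σ := by
  obtain ⟨i1, i2⟩ := integral_heatK n (σ := 2 * σ) (by positivity) x
  have hI : Integrable (fun y : Eucl n => ‖y - x‖ ^ 2 * heatK n σ (‖y - x‖ ^ 2)) := by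
    refine (i1.const_mul (8 * 2 ^ ((n : ℝ) / 2) * σ)).mono' ?_ (Eventually.of_forall fun y => ?_)
    · unfold heatK
      exact (by fun_prop : Continuous fun y : Eucl n => ‖y - x‖ ^ 2 *
        ((4 * Real.pi * σ) ^ (-((n : ℝ) / 2)) *
          Real.exp (-(‖y - x‖ ^ 2 / (4 * σ))))).aestronglyMeasurable
    · have := heatK_pos n hσ (‖y - x‖ ^ 2)
      rw [Real.norm_of_nonneg (by positivity)]
      exact sq_mul_heatK_le n hσ _
  refine ⟨hI, ?_⟩
  calc ∫ y : Eucl n, ‖y - x‖ ^ 2 * heatK n σ (‖y - x‖ ^ 2)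
      ≤ ∫ y : Eucl n, 8 * 2 ^ ((n : ℝ) / 2) * σ * heatK n (2 * σ) (‖y - x‖ ^ 2) :=
        integral_mono hI (i1.const_mul _) fun y => sq_mul_heatK_le n hσ _
    _ = _ := by rw [integral_const_mul, i2, mul_one]

lemma exists_heatK_le (n : ℕ) : ∃ K > 0, ∀ σ > 0, ∀ r > 0,
    heatK n σ r ≤ K * σ * r ^ (-((n : ℝ) / 2 + 1)) := by
  have hπ := Real.pi_pos
  set a : ℝ := (n : ℝ) / 2 + 1 with ha
  have ha0 : 0 < a := by positivity
  refine ⟨(4 * Real.pi) ^ (-((n : ℝ) / 2)) * (4 * a) ^ a, by positivity, fun σ hσ r hr => ?_⟩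
  unfold heatK
  have h1 : Real.exp (-(r / (4 * σ))) ≤ (4 * a) ^ a * σ ^ a * r ^ (-a) := by
    have h2 : r / (4 * σ) / a ≤ Real.exp (r / (4 * σ) / a) := by
      linarith [Real.add_one_le_exp (r / (4 * σ) / a)]
    have h3 : (r / (4 * σ) / a) ^ a ≤ Real.exp (r / (4 * σ)) := by
      calc (r / (4 * σ) / a) ^ a ≤ Real.exp (r / (4 * σ) / a) ^ a :=
            Real.rpow_le_rpow (by positivity) h2 ha0.le
        _ = Real.exp (r / (4 * σ)) := by
            rw [← Real.exp_mul]; congr 1; field_simp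
    rw [Real.exp_neg]
    calc (Real.exp (r / (4 * σ)))⁻¹ ≤ ((r / (4 * σ) / a) ^ a)⁻¹ :=
          inv_anti₀ (by positivity) h3
      _ = (4 * a) ^ a * σ ^ a * r ^ (-a) := by
          rw [Real.rpow_neg hr.le, ← Real.mul_rpow (by positivity) hσ.le,
            ← Real.inv_rpow (by positivity), ← Real.inv_rpow (by positivity),
            ← Real.mul_rpow (by positivity) (by positivity)]
          congr 1; field_simp
  have h4 : (4 * Real.pi * σ) ^ (-((n : ℝ) / 2)) =
      (4 * Real.pi) ^ (-((n : ℝ) / 2)) * σ ^ (-((n : ℝ) / 2)) :=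
    Real.mul_rpow (by positivity) hσ.le
  have h5 : σ ^ (-((n : ℝ) / 2)) * σ ^ a = σ := by
    rw [← Real.rpow_add hσ, ha]; simp
  rw [h4]
  calc (4 * Real.pi) ^ (-((n : ℝ) / 2)) * σ ^ (-((n : ℝ) / 2)) * Real.exp (-(r / (4 * σ)))
      ≤ (4 * Real.pi) ^ (-((n : ℝ) / 2)) * σ ^ (-((n : ℝ) / 2)) *
        ((4 * a) ^ a * σ ^ a * r ^ (-a)) := by gcongr
    _ = (4 * Real.pi) ^ (-((n : ℝ) / 2)) * (4 * a) ^ a *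
        (σ ^ (-((n : ℝ) / 2)) * σ ^ a) * r ^ (-a) := by ring
    _ = _ := by rw [h5]

lemma heatK_anti (n : ℕ) {σ r r' : ℝ} (hσ : 0 < σ) (h : r ≤ r') :
    heatK n σ r' ≤ heatK n σ r := by
  have hπ := Real.pi_pos
  unfold heatK
  gcongr

/-- The backward heat kernel centred at `(x, T)`, truncated at height `c`. -/
noncomputable def kerTest (c T : ℝ) (x y : Eucl n) (s : ℝ) : ℝ :=
  trunc c (heatK n (T - s) (‖y - x‖ ^ 2))

/-- The time derivative of `kerTest`. -/
noncomputable def kerTestT (c T : ℝ) (x y : Eucl n) (s : ℝ) : ℝ :=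
  -(trunc' c (heatK n (T - s) (‖y - x‖ ^ 2)) * (heatK n (T - s) (‖y - x‖ ^ 2) *
    (‖y - x‖ ^ 2 / (4 * (T - s) ^ 2) - n / (2 * (T - s)))))

/-- The Laplacian of `kerTest`. -/
noncomputable def kerTestL (c T : ℝ) (x y : Eucl n) (s : ℝ) : ℝ :=
  4 * ‖y - x‖ ^ 2 * (trunc'' c (heatK n (T - s) (‖y - x‖ ^ 2)) *
      (heatK n (T - s) (‖y - x‖ ^ 2) / (4 * (T - s))) ^ 2 +
    trunc' c (heatK n (T - s) (‖y - x‖ ^ 2)) *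
      (heatK n (T - s) (‖y - x‖ ^ 2) / (4 * (T - s)) / (4 * (T - s)))) +
  2 * n * (trunc' c (heatK n (T - s) (‖y - x‖ ^ 2)) *
    -(heatK n (T - s) (‖y - x‖ ^ 2) / (4 * (T - s))))

lemma kerTest_subsolution (c : ℝ) {T s : ℝ} (hs : s < T) (x y : Eucl n) :
    0 ≤ kerTestT c T x y s + kerTestL c T x y s := by
  have hσ : 0 < T - s := by linarith
  have hP := heatK_pos n hσ (‖y - x‖ ^ 2)
  have h2 := trunc''_nonneg c (heatK n (T - s) (‖y - x‖ ^ 2))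
  unfold kerTestT kerTestL
  set P := heatK n (T - s) (‖y - x‖ ^ 2)
  have : -(trunc' c P * (P * (‖y - x‖ ^ 2 / (4 * (T - s) ^ 2) - n / (2 * (T - s))))) +
      (4 * ‖y - x‖ ^ 2 * (trunc'' c P * (P / (4 * (T - s))) ^ 2 +
      trunc' c P * (P / (4 * (T - s)) / (4 * (T - s)))) +
      2 * n * (trunc' c P * -(P / (4 * (T - s)))))
      = 4 * ‖y - x‖ ^ 2 * (trunc'' c P * (P / (4 * (T - s))) ^ 2) := by
    field_simp
    ring
  rw [this]
  positivity

lemma kerTest_radial (c : ℝ) {T s : ℝ} (hs : s < T) (x : Eucl n) :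
    ContDiff ℝ 2 (fun y => kerTest c T x y s) ∧
      ∀ y, lap (fun z => kerTest c T x z s) y = kerTestL c T x y s := by
  have hσ : 0 < T - s := by linarith
  set h : ℝ → ℝ := fun r => trunc c (heatK n (T - s) r)
  set h1 : ℝ → ℝ := fun r => trunc' c (heatK n (T - s) r) * -(heatK n (T - s) r / (4 * (T - s)))
  set h2 : ℝ → ℝ := fun r => trunc'' c (heatK n (T - s) r) *
      (heatK n (T - s) r / (4 * (T - s))) ^ 2 +
    trunc' c (heatK n (T - s) r) * (heatK n (T - s) r / (4 * (T - s)) / (4 * (T - s)))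
  have e1 : ∀ r, HasDerivAt h (h1 r) r := fun r =>
    (hasDerivAt_trunc c (heatK_pos n hσ r)).comp r (hasDerivAt_heatK_r n (T - s) r)
  have e2 : ∀ r, HasDerivAt h1 (h2 r) r := fun r => by
    have a1 := (hasDerivAt_trunc' c (heatK_pos n hσ r)).comp r (hasDerivAt_heatK_r n (T - s) r)
    have a2 := ((hasDerivAt_heatK_r n (T - s) r).div_const (4 * (T - s))).neg
    refine (a1.mul a2).congr_deriv ?_
    simp only [h2, Function.comp, Pi.neg_apply]
    ring
  have cK : Continuous fun r => heatK n (T - s) r := by unfold heatK; fun_prop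
  have c2 : Continuous h2 := by
    have b1 : Continuous fun r => trunc' c (heatK n (T - s) r) := by
      refine continuous_iff_continuousAt.2 fun r => ?_
      exact (hasDerivAt_trunc' c (heatK_pos n hσ r)).continuousAt.comp cK.continuousAt
    have b2 : Continuous fun r => trunc'' c (heatK n (T - s) r) := by
      unfold trunc''
      refine Continuous.div (by fun_prop) (by fun_prop) fun r => ?_
      exact (pow_pos (heatK_pos n hσ r) 4).ne'
    simp only [h2]
    fun_prop
  obtain ⟨d, d1, d2⟩ := contDiff_two_of_hasDerivAt e1 e2 c2
  refine ⟨d.comp ((contDiff_id.sub contDiff_const).norm_sq ℝ), fun y => ?_⟩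
  have := lap_radial d x y
  rw [d2, d1] at this
  exact this

lemma isTest_kerTest {c T a b R R' : ℝ} (x : Eucl n) (hb : b < T) (hR : R' < R)
    (hc : ∀ s ∈ Icc a b, ∀ y ∉ Metric.closedBall x R', heatK n (T - s) (‖y - x‖ ^ 2) ≤ c) :
    IsTest x R a b (kerTest c T x) (kerTestT c T x) (kerTestL c T x) := by
  have hσ : ∀ s ∈ Icc a b, 0 < T - s := fun s hs => by linarith [hs.2]
  have hπ := Real.pi_pos
  have cK : ContinuousOn (fun q : Eucl n × ℝ => heatK n (T - q.2) (‖q.1 - x‖ ^ 2))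
      (univ ×ˢ Icc a b) := by
    unfold heatK
    refine ContinuousOn.mul ?_ ?_
    · refine ContinuousOn.rpow_const (by fun_prop) fun q hq => Or.inl ?_
      have := hσ q.2 hq.2
      positivity
    · refine Real.continuous_exp.comp_continuousOn (ContinuousOn.neg ?_)
      refine ContinuousOn.div (by fun_prop) (by fun_prop) fun q hq => ?_
      have := hσ q.2 hq.2
      positivity
  have pK : ∀ q ∈ (univ ×ˢ Icc a b : Set (Eucl n × ℝ)),
      0 < heatK n (T - q.2) (‖q.1 - x‖ ^ 2) := fun q hq => heatK_pos n (hσ q.2 hq.2) _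
  have cσ : ContinuousOn (fun q : Eucl n × ℝ => T - q.2) (univ ×ˢ Icc a b) := by fun_prop
  have nσ : ∀ q ∈ (univ ×ˢ Icc a b : Set (Eucl n × ℝ)), T - q.2 ≠ 0 :=
    fun q hq => (hσ q.2 hq.2).ne'
  have c0 : ContinuousOn (fun q : Eucl n × ℝ => trunc c (heatK n (T - q.2) (‖q.1 - x‖ ^ 2)))
      (univ ×ˢ Icc a b) := fun q hq =>
    ContinuousAt.comp_continuousWithinAt (g := trunc c)
      (hasDerivAt_trunc c (pK q hq)).continuousAt (cK q hq)
  have c1 : ContinuousOn (fun q : Eucl n × ℝ => trunc' c (heatK n (T - q.2) (‖q.1 - x‖ ^ 2)))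
      (univ ×ˢ Icc a b) := fun q hq =>
    ContinuousAt.comp_continuousWithinAt (g := trunc' c)
      (hasDerivAt_trunc' c (pK q hq)).continuousAt (cK q hq)
  have c2 : ContinuousOn (fun q : Eucl n × ℝ => trunc'' c (heatK n (T - q.2) (‖q.1 - x‖ ^ 2)))
      (univ ×ˢ Icc a b) := by
    unfold trunc''
    refine ContinuousOn.div (by fun_prop) (by fun_prop) fun q hq => (pow_pos (pK q hq) 4).ne'
  have cn : ContinuousOn (fun q : Eucl n × ℝ => ‖q.1 - x‖ ^ 2) (univ ×ˢ Icc a b) := by fun_prop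
  have cd : ContinuousOn (fun q : Eucl n × ℝ => heatK n (T - q.2) (‖q.1 - x‖ ^ 2) /
      (4 * (T - q.2))) (univ ×ˢ Icc a b) :=
    cK.div (by fun_prop) fun q hq => mul_ne_zero (by norm_num) (nσ q hq)
  constructor
  · exact fun y s hs => trunc_nonneg _ _
  · refine ⟨R', hR, fun y hy s hs => ?_⟩
    obtain ⟨z0, z1, z2⟩ := trunc_eq_zero (hc s hs y hy)
    refine ⟨z0, ?_, ?_⟩
    · simp [kerTestT, z1]
    · simp [kerTestL, z1, z2]
  · exact fun s hs => (kerTest_radial c (by linarith [hs.2]) x).1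
  · exact fun s hs => (kerTest_radial c (by linarith [hs.2]) x).2
  · intro s hs y
    have h1 := (hasDerivAt_heatK_σ n (hσ s hs) (‖y - x‖ ^ 2)).comp s
      ((hasDerivAt_id s).const_sub T)
    have h2 := (hasDerivAt_trunc c (heatK_pos n (hσ s hs) (‖y - x‖ ^ 2))).comp s h1
    refine h2.congr_deriv ?_
    unfold kerTestT
    ring
  · exact c0
  · unfold kerTestT
    refine (c1.mul (cK.mul (ContinuousOn.sub ?_ ?_))).neg
    · exact cn.div (by fun_prop) fun q hq => mul_ne_zero (by norm_num) (pow_ne_zero 2 (nσ q hq))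
    · exact ContinuousOn.div (by fun_prop) (by fun_prop) fun q hq =>
        mul_ne_zero (by norm_num) (nσ q hq)
  · unfold kerTestL
    have cdd := cd.div (g := fun q : Eucl n × ℝ => 4 * (T - q.2)) (by fun_prop)
      fun q hq => mul_ne_zero (by norm_num) (nσ q hq)
    exact ((continuousOn_const.mul cn).mul ((c2.mul (cd.pow 2)).add (c1.mul cdd))).add
      (continuousOn_const.mul (c1.mul cd.neg))

end Heat

section Kernel

variable {n : ℕ} {v g : Eucl n → ℝ → ℝ} {x0 x : Eucl n} {R R1 α β M A : ℝ}

lemma IsTest.recenter {a b : ℝ} {ψ ψt ψL : Eucl n → ℝ → ℝ} (h : IsTest x R1 a b ψ ψt ψL)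
    (hx : dist x x0 + R1 ≤ R) : IsTest x0 R a b ψ ψt ψL where
  nonneg := h.nonneg
  supp := by
    obtain ⟨R', hR, h1⟩ := h.supp
    refine ⟨R' + dist x x0, by linarith, fun y hy s hs => h1 y (fun hy' => hy ?_) s hs⟩
    exact Metric.mem_closedBall.2 ((dist_triangle y x x0).trans
      (add_le_add_left (Metric.mem_closedBall.1 hy') _))
  contDiff := h.contDiff
  lap_eq := h.lap_eq
  hasDerivAt := h.hasDerivAt
  cont := h.cont
  cont_t := h.cont_t
  cont_L := h.cont_L

lemma WeakOn.recenter {J : Set ℝ} (h : WeakOn v g x0 R J) (hx : dist x x0 + R1 ≤ R) :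
    WeakOn v g x R1 J :=
  fun a b hab hI _ _ _ hψ => h a b hab hI _ _ _ (hψ.recenter hx)

lemma SepBdd.recenter (h : SepBdd v g x0 R α β M A) (hx : dist x x0 + R1 ≤ R) :
    SepBdd v g x R1 α β M A := by
  have hs : Metric.ball x R1 ⊆ Metric.ball x0 R := Metric.ball_subset_ball' (by linarith)
  exact ⟨h.contDiff_x, h.contDiff_t, h.cont_gx, h.cont_gt, fun y hy => h.nonneg y (hs hy),
    fun y hy => h.le y (hs hy), fun y hy => h.abs_le y (hs hy)⟩

/-- The truncated heat kernel at time `σ`. -/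
noncomputable def tker (c σ : ℝ) (z : Eucl n) : ℝ := trunc c (heatK n σ (‖z‖ ^ 2))

lemma tker_nonneg (c σ : ℝ) (z : Eucl n) : 0 ≤ tker c σ z := trunc_nonneg _ _

lemma tker_le {c σ : ℝ} (hc : 0 ≤ c) (hσ : 0 < σ) (z : Eucl n) :
    tker c σ z ≤ heatK n σ (‖z‖ ^ 2) := trunc_le hc (heatK_pos n hσ _)

lemma continuous_tker (c : ℝ) {σ : ℝ} (hσ : 0 < σ) : Continuous (tker (n := n) c σ) := by
  unfold tker trunc heatK
  have := Real.pi_pos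
  refine Continuous.div (by fun_prop) (by fun_prop) fun z => by positivity

lemma integrable_tker {c σ : ℝ} (hc : 0 ≤ c) (hσ : 0 < σ) :
    Integrable (tker (n := n) c σ) := by
  have h := (integral_heatK n hσ 0).1
  simp only [sub_zero] at h
  refine h.mono' (continuous_tker c hσ).aestronglyMeasurable (Eventually.of_forall fun z => ?_)
  rw [Real.norm_of_nonneg (tker_nonneg c σ z)]
  exact tker_le hc hσ z

lemma integral_tker_le {c σ : ℝ} (hc : 0 ≤ c) (hσ : 0 < σ) :
    ∫ z, tker (n := n) c σ z ≤ 1 := by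
  have h := integral_heatK n hσ 0
  simp only [sub_zero] at h
  rw [← h.2]
  exact integral_mono (integrable_tker hc hσ) h.1 fun z => tker_le hc hσ z

/-- The mass lost by truncating the heat kernel. -/
lemma one_sub_le_integral_tker {c σ r : ℝ} (hc : 0 ≤ c) (hσ : 0 < σ) (hr : 0 < r) :
    1 - 3 * c * volume.real (Metric.closedBall (0 : Eucl n) r)
      - 8 * 2 ^ ((n : ℝ) / 2) * σ / r ^ 2 ≤ ∫ z, tker (n := n) c σ z := by
  have h := integral_heatK n hσ 0
  have h2 := integral_sq_mul_heatK n hσ 0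
  simp only [sub_zero] at h h2
  have hI : Integrable ((Metric.closedBall (0 : Eucl n) r).indicator fun _ => 3 * c) :=
    (integrable_indicator_iff Metric.isClosed_closedBall.measurableSet).2
      (integrableOn_const (isCompact_closedBall (0 : Eucl n) r).measure_lt_top.ne)
  have key : ∀ z : Eucl n, heatK n σ (‖z‖ ^ 2) ≤ tker c σ z +
      ((Metric.closedBall (0 : Eucl n) r).indicator (fun _ => 3 * c) z +
        (‖z‖ ^ 2 * heatK n σ (‖z‖ ^ 2)) / r ^ 2) := by
    intro z
    have hP := heatK_pos n hσ (‖z‖ ^ 2)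
    by_cases hz : z ∈ Metric.closedBall (0 : Eucl n) r
    · rw [indicator_of_mem hz]
      have := sub_le_trunc hc hP
      have : 0 ≤ (‖z‖ ^ 2 * heatK n σ (‖z‖ ^ 2)) / r ^ 2 := by positivity
      unfold tker
      linarith
    · rw [indicator_of_notMem hz]
      have h1 : r < ‖z‖ := by simpa using hz
      have h3 : heatK n σ (‖z‖ ^ 2) ≤ (‖z‖ ^ 2 * heatK n σ (‖z‖ ^ 2)) / r ^ 2 := by
        rw [le_div_iff₀ (by positivity), mul_comm]
        gcongr
      linarith [tker_nonneg c σ z]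
  have hJ : Integrable fun z : Eucl n => (Metric.closedBall (0 : Eucl n) r).indicator
      (fun _ => 3 * c) z + (‖z‖ ^ 2 * heatK n σ (‖z‖ ^ 2)) / r ^ 2 :=
    hI.add (h2.1.div_const (r ^ 2))
  have := integral_mono h.1 ((integrable_tker hc hσ).add hJ) key
  simp only [Pi.add_apply] at this
  rw [h.2, integral_add (integrable_tker hc hσ) hJ, integral_add hI (h2.1.div_const (r ^ 2)), integral_div,
    integral_indicator Metric.isClosed_closedBall.measurableSet, setIntegral_const] at this
  have h4 : (∫ y : Eucl n, ‖y‖ ^ 2 * heatK n σ (‖y‖ ^ 2)) / r ^ 2 ≤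
      8 * 2 ^ ((n : ℝ) / 2) * σ / r ^ 2 := by
    gcongr; exact h2.2
  rw [smul_eq_mul] at this
  linarith

lemma tker_eq_zero_of_notMem {c σ R' : ℝ}
    (hc : ∀ z : Eucl n, z ∉ Metric.closedBall (0 : Eucl n) R' → heatK n σ (‖z‖ ^ 2) ≤ c)
    {z : Eucl n} (hz : z ∉ Metric.closedBall (0 : Eucl n) R') : tker c σ z = 0 :=
  (trunc_eq_zero (hc z hz)).1

lemma hasCompactSupport_tker {c σ R' : ℝ}
    (hc : ∀ z : Eucl n, z ∉ Metric.closedBall (0 : Eucl n) R' → heatK n σ (‖z‖ ^ 2) ≤ c) :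
    HasCompactSupport (tker (n := n) c σ) :=
  HasCompactSupport.intro (isCompact_closedBall 0 R') fun _ hz => tker_eq_zero_of_notMem hc hz

/-- Monotonicity of the mass seen by the truncated backward heat kernel. -/
lemma SepBdd.tker_mono (h : SepBdd v g x R α β M A) {a b R' c ε : ℝ} (hab : a ≤ b)
    (hI : Icc a b ⊆ Icc α β) (hW : WeakOn v g x R (Icc a b)) (hR0 : 0 ≤ R') (hR : R' < R)
    (hc0 : 0 ≤ c) (hε : 0 < ε)
    (hc : ∀ σ ∈ Icc ε (b - a + ε), ∀ z : Eucl n, z ∉ Metric.closedBall (0 : Eucl n) R' →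
      heatK n σ (‖z‖ ^ 2) ≤ c) :
    (∫ y, v y a * tker c (b - a + ε) (y - x)) - A * (b - a)
      ≤ ∫ y, v y b * tker c ε (y - x) := by
  have hT := isTest_kerTest (c := c) (T := b + ε) (a := a) (b := b) x (by linarith) hR
    (fun s hs y hy => hc _ ⟨by linarith [hs.2], by linarith [hs.1]⟩ (y - x)
      (by simpa [dist_eq_norm] using hy))
  have h1 := hW a b hab le_rfl _ _ _ hT
  have e1 : b + ε - b = ε := by ring
  have e2 : b + ε - a = b - a + ε := by ring
  have k1 : ∀ y, kerTest c (b + ε) x y b = tker c ε (y - x) := fun y => by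
    unfold kerTest tker; rw [e1]
  have k2 : ∀ y, kerTest c (b + ε) x y a = tker c (b - a + ε) (y - x) := fun y => by
    unfold kerTest tker; rw [e2]
  simp only [k1, k2] at h1
  have hA : 0 ≤ A := (abs_nonneg _).trans (h.abs_le x
    (Metric.mem_ball_self (hR0.trans_lt hR)) a (hI (left_mem_Icc.2 hab)))
  have lower : ∀ s ∈ Icc a b, -A ≤ ∫ y, (v y s * (kerTestT c (b + ε) x y s +
      kerTestL c (b + ε) x y s) + g y s * kerTest c (b + ε) x y s) := by
    intro s hs
    have hσ : 0 < b + ε - s := by linarith [hs.2]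
    have k3 : ∀ y, kerTest c (b + ε) x y s = tker c (b + ε - s) (y - x) := fun y => rfl
    have int1 : Integrable fun y => -(A * kerTest c (b + ε) x y s) := by
      simp only [k3]
      exact (((integrable_tker hc0 hσ).comp_sub_right x).const_mul A).neg
    have hct := (continuousOn_slices hT.cont_t).2 s hs
    have hcL := (continuousOn_slices hT.cont_L).2 s hs
    have hcc := (continuousOn_slices hT.cont).2 s hs
    obtain ⟨R'', hR'', hs0⟩ := hT.supp
    have int2 : Integrable fun y => v y s * (kerTestT c (b + ε) x y s +
      kerTestL c (b + ε) x y s) + g y s * kerTest c (b + ε) x y s := by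
      refine Continuous.integrable_of_hasCompactSupport (((h.contDiff_x s).continuous.mul
        (hct.add hcL)).add ((h.cont_gx s).mul hcc)) ?_
      refine HasCompactSupport.intro (isCompact_closedBall x R'') fun y hy => ?_
      obtain ⟨z1, z2, z3⟩ := hs0 y hy s hs
      rw [z1, z2, z3]; ring
    calc -A ≤ -(A * ∫ y, tker c (b + ε - s) (y - x)) := by
          rw [integral_sub_right_eq_self (fun y => tker c (b + ε - s) y) x]
          have := integral_tker_le (n := n) hc0 hσ
          nlinarith
      _ = ∫ y, -(A * kerTest c (b + ε) x y s) := by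
          simp only [k3]
          rw [integral_neg, integral_const_mul]
      _ ≤ _ := by
          refine integral_mono int1 int2 fun y => ?_
          by_cases hy : y ∈ Metric.closedBall x R''
          · have hyb := Metric.closedBall_subset_ball hR'' hy
            have m1 := mul_nonneg (h.nonneg y hyb s (hI hs))
              (kerTest_subsolution c (show s < b + ε by linarith [hs.2]) x y)
            have m2 := hT.nonneg y s hs
            have m3 := mul_le_mul_of_nonneg_right
              (neg_le_of_abs_le (h.abs_le y hyb s (hI hs))) m2
            simp only
            linarith
          · obtain ⟨z1, z2, z3⟩ := hs0 y hy s hs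
            simp only [z1, z2, z3]
            simp
  have c2 := h.continuousOn_source hI hT
  have h2 : ∫ s in a..b, -A ≤ ∫ s in a..b, ∫ y, (v y s * (kerTestT c (b + ε) x y s +
      kerTestL c (b + ε) x y s) + g y s * kerTest c (b + ε) x y s) := by
    refine intervalIntegral.integral_mono_on hab (by simp) ?_ lower
    rw [← uIcc_of_le hab] at c2
    exact c2.intervalIntegrable
  rw [intervalIntegral.integral_const, smul_eq_mul] at h2
  linarith

lemma le_of_forall_integral_tker (h : SepBdd v g x R α β M A) {b R' c τ L : ℝ}
    (hb : b ∈ Icc α β) (hR0 : 0 ≤ R') (hR : R' < R) (hc0 : 0 ≤ c) (hτ : 0 < τ)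
    (hc : ∀ σ ∈ Ioc 0 τ, ∀ z : Eucl n, z ∉ Metric.closedBall (0 : Eucl n) R' →
      heatK n σ (‖z‖ ^ 2) ≤ c)
    (hL : ∀ ε ∈ Ioc 0 τ, L ≤ ∫ y, v y b * tker c ε (y - x)) : L ≤ v x b := by
  refine le_of_forall_pos_le_add fun η hη => ?_
  have hxR : x ∈ Metric.ball x R := Metric.mem_ball_self (hR0.trans_lt hR)
  have hM : 0 ≤ M := (h.nonneg x hxR b hb).trans (h.le x hxR b hb)
  have hcont : Continuous fun y => v y b := (h.contDiff_x b).continuous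
  obtain ⟨r, hr, hr2⟩ := Metric.continuous_iff.1 hcont x η hη
  have bound : ∀ ε ∈ Ioc 0 τ, L ≤ v x b + η + M / r ^ 2 * (8 * 2 ^ ((n : ℝ) / 2) * ε) := by
    intro ε hε
    obtain ⟨i1, i2⟩ := integral_heatK n hε.1 x
    obtain ⟨j1, j2⟩ := integral_sq_mul_heatK n hε.1 x
    have hvx := h.nonneg x hxR b hb
    have cs := hasCompactSupport_tker (hc ε hε)
    have int1 : Integrable fun y => v y b * tker c ε (y - x) := by
      refine Continuous.integrable_of_hasCompactSupport (hcont.mul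
        ((continuous_tker c hε.1).comp (continuous_sub_right x))) ?_
      exact (cs.comp_homeomorph (Homeomorph.subRight x)).mul_left
    have int2 : Integrable fun y => (v x b + η) * heatK n ε (‖y - x‖ ^ 2) +
        M / r ^ 2 * (‖y - x‖ ^ 2 * heatK n ε (‖y - x‖ ^ 2)) :=
      (i1.const_mul _).add (j1.const_mul _)
    calc L ≤ ∫ y, v y b * tker c ε (y - x) := hL ε hε
      _ ≤ ∫ y, ((v x b + η) * heatK n ε (‖y - x‖ ^ 2) +
          M / r ^ 2 * (‖y - x‖ ^ 2 * heatK n ε (‖y - x‖ ^ 2))) := by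
          refine integral_mono int1 int2 fun y => ?_
          have hP := heatK_pos n hε.1 (‖y - x‖ ^ 2)
          have hk := tker_le (n := n) hc0 hε.1 (y - x)
          have hk0 := tker_nonneg (n := n) c ε (y - x)
          simp only
          by_cases hy : y ∈ Metric.closedBall x R'
          · have hyb := Metric.closedBall_subset_ball hR hy
            by_cases hyr : dist y x < r
            · have := hr2 y hyr
              rw [Real.dist_eq, abs_lt] at this
              calc v y b * tker c ε (y - x) ≤ (v x b + η) * heatK n ε (‖y - x‖ ^ 2) :=
                    mul_le_mul (by linarith) hk hk0 (by linarith)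
                _ ≤ _ := le_add_of_nonneg_right (by positivity)
            · have hyr : r ≤ ‖y - x‖ := by rw [← dist_eq_norm]; exact not_lt.1 hyr
              have : M ≤ M / r ^ 2 * ‖y - x‖ ^ 2 := by
                rw [div_mul_eq_mul_div, le_div_iff₀ (by positivity)]
                gcongr
              calc v y b * tker c ε (y - x) ≤ M * heatK n ε (‖y - x‖ ^ 2) :=
                    mul_le_mul (h.le y hyb b hb) hk hk0 hM
                _ ≤ M / r ^ 2 * ‖y - x‖ ^ 2 * heatK n ε (‖y - x‖ ^ 2) := by gcongr
                _ = M / r ^ 2 * (‖y - x‖ ^ 2 * heatK n ε (‖y - x‖ ^ 2)) := by ring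
                _ ≤ _ := le_add_of_nonneg_left (by positivity)
          · have : tker c ε (y - x) = 0 :=
              tker_eq_zero_of_notMem (hc ε hε) (by simpa [dist_eq_norm] using hy)
            rw [this, mul_zero]
            positivity
      _ ≤ _ := by
          rw [integral_add (i1.const_mul _) (j1.const_mul _), integral_const_mul,
            integral_const_mul, i2, mul_one]
          gcongr
  have hlim : Tendsto (fun ε : ℝ => v x b + η + M / r ^ 2 * (8 * 2 ^ ((n : ℝ) / 2) * ε))
      (𝓝[>] 0) (𝓝 (v x b + η + M / r ^ 2 * (8 * 2 ^ ((n : ℝ) / 2) * 0))) :=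
    ((by fun_prop : Continuous fun ε : ℝ => v x b + η +
      M / r ^ 2 * (8 * 2 ^ ((n : ℝ) / 2) * ε)).tendsto 0).mono_left nhdsWithin_le_nhds
  have := ge_of_tendsto hlim (by filter_upwards [Ioc_mem_nhdsGT hτ] with ε hε using bound ε hε)
  simpa using this

/-- Pointwise lower bounds from averages at an earlier time. -/
lemma SepBdd.kernel_lower (h : SepBdd v g x R α β M A) {a b R' c L : ℝ} (hab : a < b)
    (hI : Icc a b ⊆ Icc α β) (hW : WeakOn v g x R (Icc a b)) (hR0 : 0 ≤ R') (hR : R' < R)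
    (hc0 : 0 ≤ c)
    (hc : ∀ σ ∈ Ioc 0 (2 * (b - a)), ∀ z : Eucl n, z ∉ Metric.closedBall (0 : Eucl n) R' →
      heatK n σ (‖z‖ ^ 2) ≤ c)
    (hL : ∀ ε ∈ Ioc 0 (b - a), L ≤ ∫ y, v y a * tker c (b - a + ε) (y - x)) :
    L - A * (b - a) ≤ v x b := by
  have hτ : 0 < b - a := by linarith
  refine le_of_forall_integral_tker h (hI (right_mem_Icc.2 hab.le)) hR0 hR hc0 hτ
    (fun σ hσ => hc σ ⟨hσ.1, by linarith [hσ.2]⟩) fun ε hε => ?_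
  refine le_trans ?_ (h.tker_mono hab.le hI hW hR0 hR hc0 hε.1 fun σ hσ =>
    hc σ ⟨hε.1.trans_le hσ.1, by linarith [hσ.2, hε.2]⟩)
  linarith [hL ε hε]

/-- Across an interval on which the weak inequality holds, semiconvexity at the initial time
prevents a fast decrease. -/
lemma exists_gap_bound (n : ℕ) {r M A N : ℝ} (hr : 0 < r) (hN : 0 ≤ N) :
    ∃ N', ∀ (v g : Eucl n → ℝ → ℝ) (x : Eucl n) (R α β a b : ℝ), SepBdd v g x R α β M A →
      r < R → a < b → Icc a b ⊆ Icc α β → WeakOn v g x R (Icc a b) →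
      (∀ z, ‖z‖ ≤ r → -(N * ‖z‖ ^ 2) ≤ v (x + z) a + v (x - z) a - 2 * v x a) →
      v x a - N' * (b - a) ≤ v x b := by
  obtain ⟨K, hK, hK2⟩ := exists_heatK_le n
  set Kr := K * (r ^ 2) ^ (-((n : ℝ) / 2 + 1)) with hKr
  have hKr0 : 0 < Kr := by positivity
  set V := volume.real (Metric.closedBall (0 : Eucl n) r) with hV
  have hV0 : 0 ≤ V := measureReal_nonneg
  set C := 8 * (2:ℝ) ^ ((n : ℝ) / 2) with hC
  have hC0 : 0 < C := by positivity
  refine ⟨A + M * (6 * Kr * V + C * 2 / r ^ 2) + N * C, ?_⟩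
  intro v g x R α β a b h hrR hab hI hW hs
  have hτ : 0 < b - a := by linarith
  have hxR : x ∈ Metric.ball x R := Metric.mem_ball_self (hr.trans hrR)
  have ha : a ∈ Icc α β := hI (left_mem_Icc.2 hab.le)
  have hvx := h.nonneg x hxR a ha
  have hvM := h.le x hxR a ha
  have hc : ∀ σ ∈ Ioc 0 (2 * (b - a)), ∀ z : Eucl n, z ∉ Metric.closedBall (0 : Eucl n) r →
      heatK n σ (‖z‖ ^ 2) ≤ 2 * Kr * (b - a) := by
    intro σ hσ z hz
    have hz : r < ‖z‖ := by simpa using hz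
    calc heatK n σ (‖z‖ ^ 2) ≤ heatK n σ (r ^ 2) := heatK_anti n hσ.1 (by gcongr)
      _ ≤ K * σ * (r ^ 2) ^ (-((n : ℝ) / 2 + 1)) := hK2 σ hσ.1 _ (by positivity)
      _ = Kr * σ := by rw [hKr]; ring
      _ ≤ Kr * (2 * (b - a)) := by gcongr; exact hσ.2
      _ = 2 * Kr * (b - a) := by ring
  have hc0 : 0 ≤ 2 * Kr * (b - a) := by positivity
  have main := h.kernel_lower (L := v x a - (M * (6 * Kr * V + C * 2 / r ^ 2) + N * C) * (b - a))
    hab hI hW hr.le hrR hc0 hc ?_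
  · linarith
  intro ε hε
  have hσ : 0 < b - a + ε := by linarith [hε.1]
  have hσ2 : b - a + ε ≤ 2 * (b - a) := by linarith [hε.2]
  set c := 2 * Kr * (b - a) with hcdef
  set σ := b - a + ε with hσdef
  have hzero : ∀ z : Eucl n, z ∉ Metric.closedBall (0 : Eucl n) r → tker c σ z = 0 :=
    fun z hz => tker_eq_zero_of_notMem (hc σ ⟨hσ, hσ2⟩) hz
  have cs := hasCompactSupport_tker (hc σ ⟨hσ, hσ2⟩)
  have hcont : Continuous fun y => v y a := (h.contDiff_x a).continuous
  have ct := continuous_tker (n := n) c hσ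
  have i1 : Integrable fun z => v (x + z) a * tker c σ z :=
    ((hcont.comp (continuous_const_add x)).mul ct).integrable_of_hasCompactSupport cs.mul_left
  have i2 : Integrable fun z => v (x - z) a * tker c σ z :=
    ((hcont.comp (continuous_const.sub continuous_id)).mul
      ct).integrable_of_hasCompactSupport cs.mul_left
  have e1 : ∫ y, v y a * tker c σ (y - x) = ∫ z, v (x + z) a * tker c σ z := by
    rw [← integral_add_left_eq_self (fun y => v y a * tker c σ (y - x)) x]
    simp
  have e2 : ∫ z, v (x + z) a * tker c σ z = ∫ z, v (x - z) a * tker c σ z := by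
    rw [← integral_neg_eq_self (fun z => v (x + z) a * tker c σ z)]
    simp [tker, sub_eq_add_neg]
  obtain ⟨j1, j2⟩ := integral_sq_mul_heatK n hσ 0
  simp only [sub_zero] at j1 j2
  have it := integrable_tker (n := n) hc0 hσ
  have key : ∫ z : Eucl n, (2 * v x a * tker c σ z - N * (‖z‖ ^ 2 * heatK n σ (‖z‖ ^ 2))) ≤
      ∫ z : Eucl n, (v (x + z) a * tker c σ z + v (x - z) a * tker c σ z) := by
    refine integral_mono ((it.const_mul _).sub (j1.const_mul _)) (i1.add i2) fun z => ?_
    have hP := heatK_pos n hσ (‖z‖ ^ 2)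
    by_cases hz : z ∈ Metric.closedBall (0 : Eucl n) r
    · have hz' : ‖z‖ ≤ r := by simpa using hz
      have h1 := mul_le_mul_of_nonneg_right (hs z hz') (tker_nonneg c σ z)
      have h2 : N * ‖z‖ ^ 2 * tker c σ z ≤ N * ‖z‖ ^ 2 * heatK n σ (‖z‖ ^ 2) :=
        mul_le_mul_of_nonneg_left (tker_le hc0 hσ z) (by positivity)
      simp only
      linarith
    · have : 0 ≤ N * (‖z‖ ^ 2 * heatK n σ (‖z‖ ^ 2)) := by positivity
      simp only [hzero z hz]
      linarith
  rw [integral_sub (it.const_mul _) (j1.const_mul _), integral_add i1 i2, ← e2, ← e1,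
    integral_const_mul, integral_const_mul] at key
  have loss := one_sub_le_integral_tker (n := n) hc0 hσ hr
  have t1 : N * ∫ z : Eucl n, ‖z‖ ^ 2 * heatK n σ (‖z‖ ^ 2) ≤ N * (C * (2 * (b - a))) := by
    gcongr
    exact j2.trans (by gcongr)
  have t2 : 1 - (6 * Kr * V + C * 2 / r ^ 2) * (b - a) ≤ ∫ z, tker (n := n) c σ z := by
    refine le_trans ?_ loss
    have : C * σ / r ^ 2 ≤ C * (2 * (b - a)) / r ^ 2 := by gcongr
    have e : C * (2 * (b - a)) / r ^ 2 = C * 2 / r ^ 2 * (b - a) := by ring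
    rw [hcdef]
    linarith
  have t3 : v x a * (1 - (6 * Kr * V + C * 2 / r ^ 2) * (b - a)) ≤
      v x a * ∫ z, tker (n := n) c σ z := by gcongr
  have t4 : v x a * ((6 * Kr * V + C * 2 / r ^ 2) * (b - a)) ≤
      M * ((6 * Kr * V + C * 2 / r ^ 2) * (b - a)) := by gcongr
  linarith

end Kernel

section Semiconvex

variable {n : ℕ}

lemma nonneg_deriv_deriv_of_isLocalMin {q q1 : ℝ → ℝ} {q2 : ℝ} (h1 : ∀ θ, HasDerivAt q (q1 θ) θ)
    (h2 : HasDerivAt q1 q2 0) (h0 : IsLocalMin q 0) : 0 ≤ q2 := by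
  by_contra hneg
  push Not at hneg
  have d1 : deriv q = q1 := funext fun θ => (h1 θ).deriv
  have z : deriv q 0 = 0 := h0.deriv_eq_zero
  have hmax := isLocalMax_of_deriv_deriv_neg (f := q) (x₀ := 0) (by rw [d1, h2.deriv]; exact hneg) z
    (h1 0).continuousAt
  have hconst : q =ᶠ[𝓝 0] fun _ => q 0 := by
    filter_upwards [hmax, h0] with θ a b using le_antisymm a b
  have : deriv (deriv q) 0 = 0 := by
    rw [hconst.deriv.deriv_eq]; simp
  rw [d1, h2.deriv] at this
  linarith

lemma neg_le_lap_of_semiconvex {f : Eucl n → ℝ} (hf : ContDiff ℝ 2 f) {x : Eucl n} {N r : ℝ}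
    (hr : 0 < r)
    (h : ∀ z, ‖z‖ ≤ r → -(N * ‖z‖ ^ 2) ≤ f (x + z) + f (x - z) - 2 * f x) :
    -(n * N) ≤ lap f x := by
  have key : ∀ i : Fin n, -N ≤ fderiv ℝ (fun y => fderiv ℝ f y (EuclideanSpace.single i 1)) x
      (EuclideanSpace.single i 1) := by
    intro i
    set w : Eucl n := EuclideanSpace.single i 1 with hw
    have hwn : ‖w‖ = 1 := by simp [hw]
    have h1 : ∀ (θ : ℝ) (σ : ℝ), HasDerivAt (fun θ : ℝ => f (x + (σ * θ) • w))
        (σ * fderiv ℝ f (x + (σ * θ) • w) w) θ := by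
      intro θ σ
      have a : HasDerivAt (fun θ : ℝ => x + (σ * θ) • w) (σ • w) θ := by
        have := (((hasDerivAt_id θ).const_mul σ).smul_const w).const_add x
        exact this.congr_deriv (by simp)
      have := ((hf.differentiable (by norm_num)) (x + (σ * θ) • w)).hasFDerivAt.comp_hasDerivAt θ a
      exact this.congr_deriv (by simp)
    have df : ContDiff ℝ 1 (fun y => fderiv ℝ f y w) :=
      contDiff_fderiv_apply_const hf (by norm_num) w
    have h2 : ∀ σ : ℝ, HasDerivAt (fun θ : ℝ => fderiv ℝ f (x + (σ * θ) • w) w)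
        (σ * fderiv ℝ (fun y => fderiv ℝ f y w) x w) 0 := by
      intro σ
      have a : HasDerivAt (fun θ : ℝ => x + (σ * θ) • w) (σ • w) 0 := by
        have := (((hasDerivAt_id (0:ℝ)).const_mul σ).smul_const w).const_add x
        exact this.congr_deriv (by simp)
      have := (((df.differentiable (by norm_num)) (x + (σ * 0) • w)).hasFDerivAt).comp_hasDerivAt
        0 a
      exact this.congr_deriv (by simp)
    have q1 : ∀ θ, HasDerivAt (fun θ : ℝ => f (x + (1 * θ) • w) + f (x + (-1 * θ) • w) - 2 * f x +
        N * θ ^ 2) (1 * fderiv ℝ f (x + (1 * θ) • w) w + -1 * fderiv ℝ f (x + (-1 * θ) • w) w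
          + N * (2 * θ)) θ := by
      intro θ
      have := (((h1 θ 1).add (h1 θ (-1))).sub_const (2 * f x)).add
        ((hasDerivAt_pow 2 θ).const_mul N)
      exact this.congr_deriv (by simp)
    have q2 : HasDerivAt (fun θ : ℝ => 1 * fderiv ℝ f (x + (1 * θ) • w) w +
        -1 * fderiv ℝ f (x + (-1 * θ) • w) w + N * (2 * θ))
        (1 * (1 * fderiv ℝ (fun y => fderiv ℝ f y w) x w) +
          -1 * (-1 * fderiv ℝ (fun y => fderiv ℝ f y w) x w) + N * (2 * 1)) 0 :=
      (((h2 1).const_mul 1).add ((h2 (-1)).const_mul (-1))).add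
        (((hasDerivAt_id (0:ℝ)).const_mul 2).const_mul N)
    have := nonneg_deriv_deriv_of_isLocalMin q1 q2 ?_
    · linarith
    · have hr' : Ioo (-r) r ∈ 𝓝 (0:ℝ) := Ioo_mem_nhds (by linarith) hr
      filter_upwards [hr'] with θ hθ
      have := h (θ • w) (by
        rw [norm_smul, hwn, mul_one, Real.norm_eq_abs]
        exact abs_le.2 ⟨hθ.1.le, hθ.2.le⟩)
      rw [norm_smul, hwn, mul_one, Real.norm_eq_abs, sq_abs] at this
      simp only [one_mul, neg_mul, neg_smul, ← sub_eq_add_neg, zero_smul, add_zero, mul_zero]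
      linarith
  unfold lap
  calc -(n * N) = ∑ i : Fin n, -N := by simp
    _ ≤ _ := Finset.sum_le_sum fun i _ => key i

lemma exists_semiconvex {f : Eucl n → ℝ} (hf : ContDiff ℝ 2 f) (x0 : Eucl n) (R r : ℝ) :
    ∃ N : ℕ, ∀ x ∈ Metric.closedBall x0 R, ∀ z, ‖z‖ ≤ r →
      -((N : ℝ) * ‖z‖ ^ 2) ≤ f (x + z) + f (x - z) - 2 * f x := by
  have d1 : ContDiff ℝ 1 (fderiv ℝ f) := hf.fderiv_right (by norm_num)
  have d2 := d1.continuous_fderiv (by norm_num)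
  obtain ⟨C, hC⟩ := (isCompact_closedBall x0 (R + r)).exists_bound_of_continuousOn d2.continuousOn
  obtain ⟨N, hN⟩ := exists_nat_ge (2 * C)
  refine ⟨N, fun x hx z hz => ?_⟩
  have hr : 0 ≤ r := (norm_nonneg z).trans hz
  have hC0 : 0 ≤ C := (norm_nonneg _).trans (hC x
    (Metric.closedBall_subset_closedBall (by linarith) hx))
  have hsub : Metric.closedBall x ‖z‖ ⊆ Metric.closedBall x0 (R + r) :=
    Metric.closedBall_subset_closedBall' (by linarith [Metric.mem_closedBall.1 hx])
  have lip : ∀ y ∈ Metric.closedBall x ‖z‖, ‖fderiv ℝ f y - fderiv ℝ f x‖ ≤ C * ‖z‖ := by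
    intro y hy
    have := (convex_closedBall x ‖z‖).norm_image_sub_le_of_norm_fderiv_le (𝕜 := ℝ)
      (f := fderiv ℝ f) (C := C) (x := x) (y := y)
      (fun w _ => (d1.differentiable (by norm_num)) w)
      (fun w hw => hC w (hsub hw)) (Metric.mem_closedBall_self (norm_nonneg _)) hy
    refine this.trans ?_
    gcongr
    simpa [dist_eq_norm] using hy
  have key : ∀ w, ‖w‖ ≤ ‖z‖ → ‖f (x + w) - f x - fderiv ℝ f x w‖ ≤ C * ‖z‖ * ‖z‖ := by
    intro w hw
    have := (convex_closedBall x ‖z‖).norm_image_sub_le_of_norm_hasFDerivWithin_le' (𝕜 := ℝ)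
      (f := f) (f' := fderiv ℝ f) (φ := fderiv ℝ f x) (C := C * ‖z‖) (x := x) (y := x + w)
      (fun y _ => ((hf.differentiable (by norm_num)) y).hasFDerivAt.hasFDerivWithinAt) lip
      (Metric.mem_closedBall_self (norm_nonneg _)) (by simpa [dist_eq_norm] using hw)
    simp only [add_sub_cancel_left] at this
    exact this.trans (by gcongr)
  have k1 := key z le_rfl
  have k2 := key (-z) (by rw [norm_neg])
  rw [Real.norm_eq_abs, abs_le] at k1 k2
  rw [map_neg, ← sub_eq_add_neg] at k2
  have : 2 * C * ‖z‖ ^ 2 ≤ N * ‖z‖ ^ 2 := by gcongr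
  nlinarith [k1.1, k2.1]

end Semiconvex

section Slope

variable {n : ℕ} {v g : Eucl n → ℝ → ℝ} {x0 x : Eucl n} {R α β M A : ℝ}

/-- If every point of a closed set `T` is a time of semiconvexity, and the weak inequality holds
on the gaps of `T`, then `v` cannot decrease fast starting from a time in `T`. -/
lemma SepBdd.lower_of_gaps (h : SepBdd v g x R α β M A)
    (hineq : ∀ t ∈ Icc α β, lap (fun y => v y t) x + g x t ≤ deriv (v x) t)
    {r N N' : ℝ} (hr : 0 < r) (hrR : r < R) {T : Set ℝ} (hT : IsClosed T) {t s0 : ℝ}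
    (hts : t ≤ s0)
    (hI : Icc t s0 ⊆ Icc α β) (htT : t ∈ T)
    (hsc : ∀ τ ∈ T ∩ Icc t s0, ∀ z, ‖z‖ ≤ r →
      -(N * ‖z‖ ^ 2) ≤ v (x + z) τ + v (x - z) τ - 2 * v x τ)
    (hN' : n * N + A ≤ N')
    (hgap : ∀ a ∈ T ∩ Icc t s0, ∀ b ∈ Icc t s0, a < b → Disjoint (Ioo a b) T →
      v x a - N' * (b - a) ≤ v x b) :
    v x t - N' * (s0 - t) ≤ v x s0 := by
  have hxR : x ∈ Metric.ball x R := Metric.mem_ball_self (hr.trans hrR)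
  refine le_of_forall_pos_le_add fun δ hδ => ?_
  obtain ⟨ε, hε, hεδ⟩ : ∃ ε > 0, ε * (s0 - t) ≤ δ := by
    refine ⟨δ / (s0 - t + 1), by have : 0 ≤ s0 - t := by linarith
                                 positivity, ?_⟩
    rw [div_mul_eq_mul_div, div_le_iff₀ (by linarith)]
    nlinarith
  set z : ℝ → ℝ := fun τ => v x τ + N' * τ + ε * τ with hz
  have zc : Continuous z := by
    have := (h.contDiff_t x).continuous
    simp only [hz]; fun_prop
  suffices hzz : z t ≤ z s0 by
    simp only [hz] at hzz; linarith
  have gap : ∀ a ∈ T ∩ Icc t s0, ∀ b ∈ Icc t s0, a < b → Disjoint (Ioo a b) T → z a ≤ z b := by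
    intro a ha b hb hab hd
    have := hgap a ha b hb hab hd
    have : 0 ≤ ε * (b - a) := mul_nonneg hε.le (by linarith)
    simp only [hz]
    linarith
  set S := {τ | z t ≤ z τ} ∩ (T ∩ Icc t s0) with hS
  have hScl : IsClosed S :=
    (isClosed_le continuous_const zc).inter (hT.inter isClosed_Icc)
  have hSne : S.Nonempty := ⟨t, le_refl (z t), htT, left_mem_Icc.2 hts⟩
  have hSb : BddAbove S := ⟨s0, fun τ hτ => hτ.2.2.2⟩
  have hm := hScl.csSup_mem hSne hSb
  set m := sSup S
  obtain ⟨hm1, hmT, hmI⟩ := hm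
  have hm1 : z t ≤ z m := hm1
  rcases hmI.2.eq_or_lt with e | hlt
  · rw [← e]; exact hm1
  have hder : HasDerivAt z (deriv (v x) m + N' + ε) m := by
    have h1 := ((h.contDiff_t x).differentiable (by norm_num) m).hasDerivAt
    have h2 := (h1.add ((hasDerivAt_id m).const_mul N')).add ((hasDerivAt_id m).const_mul ε)
    exact h2.congr_deriv (by simp)
  have hpos : 0 < deriv (v x) m + N' + ε := by
    have h1 := hineq m (hI hmI)
    have h2 := neg_le_lap_of_semiconvex (h.contDiff_x m) hr (hsc m ⟨hmT, hmI⟩)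
    have h3 := (_root_.abs_le.1 (h.abs_le x hxR m (hI hmI))).1
    linarith
  have ev : ∀ᶠ τ in 𝓝[>] m, z m ≤ z τ := by
    have := (hasDerivAt_iff_tendsto_slope.1 hder).mono_left
      (nhdsWithin_mono m (fun y (hy : m < y) => hy.ne'))
    filter_upwards [this.eventually (lt_mem_nhds hpos), self_mem_nhdsWithin] with τ h1 h2
    have h2 : m < τ := h2
    rw [slope_def_field, lt_div_iff₀ (by linarith), zero_mul] at h1
    linarith
  obtain ⟨u, hu, hu2⟩ := (mem_nhdsGT_iff_exists_Ioo_subset).1 ev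
  have hu : m < u := hu
  have noT : ∀ τ ∈ T ∩ Icc t s0, m < τ → z t ≤ z τ → False := fun τ hτ hmτ hzτ =>
    absurd (le_csSup hSb (show τ ∈ S from ⟨hzτ, hτ⟩)) (not_le.2 hmτ)
  have gt_u : ∀ τ ∈ T ∩ Icc t s0, m < τ → u ≤ τ := by
    intro τ hτ hmτ
    by_contra hlt'
    exact noT τ hτ hmτ (hm1.trans (hu2 ⟨hmτ, not_le.1 hlt'⟩))
  by_cases hne : (T ∩ Icc u s0).Nonempty
  · have hcl : IsClosed (T ∩ Icc u s0) := hT.inter isClosed_Icc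
    have hb : BddBelow (T ∩ Icc u s0) := ⟨u, fun τ hτ => hτ.2.1⟩
    have hi := hcl.csInf_mem hne hb
    set b := sInf (T ∩ Icc u s0)
    have hbI : b ∈ Icc t s0 := ⟨by linarith [hmI.1, hi.2.1], hi.2.2⟩
    have hmb : m < b := hu.trans_le hi.2.1
    have hd : Disjoint (Ioo m b) T := by
      rw [Set.disjoint_left]
      intro τ hτ hτT
      have hτI : τ ∈ Icc t s0 := ⟨by linarith [hmI.1, hτ.1], by linarith [hbI.2, hτ.2]⟩
      have := gt_u τ ⟨hτT, hτI⟩ hτ.1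
      exact absurd (csInf_le hb ⟨hτT, this, hτI.2⟩) (not_le.2 hτ.2)
    exact (noT b ⟨hi.1, hbI⟩ hmb (hm1.trans (gap m ⟨hmT, hmI⟩ b hbI hmb hd))).elim
  · have hd : Disjoint (Ioo m s0) T := by
      rw [Set.disjoint_left]
      intro τ hτ hτT
      have hτI : τ ∈ Icc t s0 := ⟨by linarith [hmI.1, hτ.1], hτ.2.le⟩
      exact hne ⟨τ, hτT, gt_u τ ⟨hτT, hτI⟩ hτ.1, hτI.2⟩
    exact hm1.trans (gap m ⟨hmT, hmI⟩ s0 (right_mem_Icc.2 hts) hlt hd)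

/-- One-sided Lipschitz bounds from below, together with the pointwise differential inequality,
give the infinitesimal form of the weak inequality. -/
lemma SepBdd.slope_of_lower (h : SepBdd v g x0 R α β M A)
    (hineq : ∀ y ∈ Metric.ball x0 R, ∀ t ∈ Icc α β,
      lap (fun y => v y t) y + g y t ≤ deriv (v y) t)
    {a b t N' R' : ℝ} (hI : Icc a b ⊆ Icc α β) {ψ ψt ψL : Eucl n → ℝ → ℝ}
    (hψ : IsTest x0 R a b ψ ψt ψL) (ht : t ∈ Ioo a b) (hR0 : 0 ≤ R') (hR' : R' < R)
    (hs0 : ∀ y ∉ Metric.closedBall x0 R', ∀ s ∈ Icc a b, ψ y s = 0 ∧ ψt y s = 0 ∧ ψL y s = 0)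
    (hN' : 0 ≤ N')
    (hlow : ∀ y ∈ Metric.closedBall x0 R', ∀ s ∈ Ioc t b, v y t - N' * (s - t) ≤ v y s)
    {ε : ℝ} (hε : 0 < ε) :
    ∀ᶠ s in 𝓝[>] t, (∫ y, v y t * ψ y t) +
        (∫ r in t..s, ∫ y, (v y r * (ψt y r + ψL y r) + g y r * ψ y r)) - ε * (s - t)
        ≤ ∫ y, v y s * ψ y s := by
  obtain ⟨C, hC0, hC⟩ := hψ.bdd
  have htI : t ∈ Icc a b := Ioo_subset_Icc_self ht
  have hM : 0 ≤ M := (h.nonneg x0 (Metric.mem_ball_self (hR0.trans_lt hR')) t (hI htI)).trans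
    (h.le x0 (Metric.mem_ball_self (hR0.trans_lt hR')) t (hI htI))
  set k : ℝ → ℝ := fun r => ∫ y, (v y r * (ψt y r + ψL y r) + g y r * ψ y r) with hk
  have kc : ContinuousOn k (Icc a b) := h.continuousOn_source hI hψ
  have cψ := continuousOn_slices hψ.cont
  have cψt := continuousOn_slices hψ.cont_t
  have cψL := continuousOn_slices hψ.cont_L
  set ℓ : Eucl n → ℝ := fun y => (lap (fun y => v y t) y + g y t) * ψ y t + v y t * ψt y t with hℓ
  have lc : Continuous ℓ := (((continuous_lap (h.contDiff_x t)).add (h.cont_gx t)).mul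
    (cψ.2 t htI)).add ((h.contDiff_x t).continuous.mul (cψt.2 t htI))
  have csψ : ∀ s ∈ Icc a b, HasCompactSupport fun y => ψ y s := fun s hs =>
    HasCompactSupport.intro (isCompact_closedBall x0 R') fun y hy => (hs0 y hy s hs).1
  have csψt : HasCompactSupport fun y => ψt y t :=
    HasCompactSupport.intro (isCompact_closedBall x0 R') fun y hy => (hs0 y hy t htI).2.1
  have csψL : HasCompactSupport fun y => ψL y t :=
    HasCompactSupport.intro (isCompact_closedBall x0 R') fun y hy => (hs0 y hy t htI).2.2
  have hint : ∫ y, ℓ y = k t := by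
    have hv := (h.contDiff_x t).continuous
    have j1 : Integrable fun y => lap (fun y => v y t) y * ψ y t :=
      ((continuous_lap (h.contDiff_x t)).mul (cψ.2 t htI)).integrable_of_hasCompactSupport
        (csψ t htI).mul_left
    have j2 : Integrable fun y => g y t * ψ y t :=
      ((h.cont_gx t).mul (cψ.2 t htI)).integrable_of_hasCompactSupport (csψ t htI).mul_left
    have j3 : Integrable fun y => v y t * ψt y t :=
      (hv.mul (cψt.2 t htI)).integrable_of_hasCompactSupport csψt.mul_left
    have j4 : Integrable fun y => v y t * ψL y t :=
      (hv.mul (cψL.2 t htI)).integrable_of_hasCompactSupport csψL.mul_left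
    have e := integral_lap_mul (h.contDiff_x t) (hψ.contDiff t htI) (csψ t htI)
    simp only [hψ.lap_eq t htI] at e
    have e1 : ∫ y, ℓ y = (∫ y, lap (fun y => v y t) y * ψ y t) + (∫ y, g y t * ψ y t) +
        ∫ y, v y t * ψt y t := by
      have j12 : Integrable fun y => lap (fun y => v y t) y * ψ y t + g y t * ψ y t := j1.add j2
      rw [← integral_add j1 j2, ← integral_add j12 j3]
      refine integral_congr_ae (Eventually.of_forall fun y => ?_)
      simp only [hℓ]; ring
    have e2 : k t = (∫ y, v y t * ψt y t) + (∫ y, v y t * ψL y t) + (∫ y, g y t * ψ y t) := by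
      have j34 : Integrable fun y => v y t * ψt y t + v y t * ψL y t := j3.add j4
      rw [← integral_add j3 j4, ← integral_add j34 j2]
      refine integral_congr_ae (Eventually.of_forall fun y => ?_)
      ring
    rw [e1, e2, e]; ring
  obtain ⟨Cl, hCl⟩ := (isCompact_closedBall x0 R').exists_bound_of_continuousOn lc.continuousOn
  set Q : ℝ → Eucl n → ℝ := fun s y => (v y s * ψ y s - v y t * ψ y t) / (s - t) with hQ
  have l0 : ∀ y ∉ Metric.closedBall x0 R', ℓ y = 0 := fun y hy => by
    obtain ⟨z1, z2, z3⟩ := hs0 y hy t htI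
    simp only [hℓ, z1, z2]; ring
  have Q0 : ∀ s ∈ Icc a b, ∀ y ∉ Metric.closedBall x0 R', Q s y = 0 := fun s hs y hy => by
    simp only [hQ, (hs0 y hy t htI).1, (hs0 y hy s hs).1]; simp
  have Qlow : ∀ s ∈ Ioc t b, ∀ y ∈ Metric.closedBall x0 R', -(N' * C + M * C) ≤ Q s y := by
    intro s hs y hy
    have hsI : s ∈ Icc a b := ⟨by linarith [ht.1, hs.1], hs.2⟩
    have hyb := Metric.closedBall_subset_ball hR' hy
    have hyc := Metric.ball_subset_closedBall hyb
    have st : 0 < s - t := by linarith [hs.1]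
    have m1 := hlow y hy s hs
    have m2 : |ψ y s - ψ y t| ≤ C * |s - t| := by
      have := (convex_Icc a b).norm_image_sub_le_of_norm_hasDerivWithin_le (f := ψ y)
        (f' := ψt y) (C := C)
        (fun r hr => (hψ.hasDerivAt r hr y).hasDerivWithinAt) (fun r hr => (hC y hyc r hr).2.1)
        htI hsI
      simpa using this
    rw [abs_of_pos st] at m2
    have m3 := (_root_.abs_le.1 m2).1
    have m4 := hψ.nonneg y s hsI
    have m5 := (_root_.abs_le.1 (hC y hyc s hsI).1).2
    have v0 := h.nonneg y hyb t (hI htI)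
    have v1 := h.le y hyb t (hI htI)
    simp only [hQ]
    rw [le_div_iff₀ st]
    have e : v y s * ψ y s - v y t * ψ y t = (v y s - v y t) * ψ y s +
      v y t * (ψ y s - ψ y t) := by ring
    rw [e]
    have p1 : -(N' * C) * (s - t) ≤ (v y s - v y t) * ψ y s := by
      have a1 : -(N' * (s - t)) * ψ y s ≤ (v y s - v y t) * ψ y s :=
        mul_le_mul_of_nonneg_right (by linarith) m4
      have a2 : N' * (s - t) * ψ y s ≤ N' * (s - t) * C := by gcongr
      linarith
    have p2 : -(M * C) * (s - t) ≤ v y t * (ψ y s - ψ y t) := by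
      have a1 : v y t * -(C * (s - t)) ≤ v y t * (ψ y s - ψ y t) := by gcongr
      have a2 : v y t * (C * (s - t)) ≤ M * (C * (s - t)) := by gcongr
      linarith
    linarith
  set C' := max Cl (N' * C + M * C)
  have hlim : Tendsto (fun s => ∫ y, min (Q s y) (ℓ y)) (𝓝[>] t) (𝓝 (∫ y, ℓ y)) := by
    refine tendsto_integral_filter_of_dominated_convergence
      ((Metric.closedBall x0 R').indicator fun _ => C') ?_ ?_ ?_ ?_
    · filter_upwards [Ioo_mem_nhdsGT ht.2] with s hs
      have hsI : s ∈ Icc a b := ⟨by linarith [ht.1, hs.1], hs.2.le⟩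
      have : Continuous (Q s) := (((h.contDiff_x s).continuous.mul (cψ.2 s hsI)).sub
        ((h.contDiff_x t).continuous.mul (cψ.2 t htI))).div_const _
      exact (this.min lc).aestronglyMeasurable
    · filter_upwards [Ioo_mem_nhdsGT ht.2] with s hs
      have hsI : s ∈ Icc a b := ⟨by linarith [ht.1, hs.1], hs.2.le⟩
      refine Eventually.of_forall fun y => ?_
      by_cases hy : y ∈ Metric.closedBall x0 R'
      · rw [indicator_of_mem hy, Real.norm_eq_abs, _root_.abs_le]
        have q := Qlow s ⟨hs.1, hs.2.le⟩ y hy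
        have l := _root_.abs_le.1 (hCl y hy)
        have c1 : Cl ≤ C' := le_max_left _ _
        have c2 : N' * C + M * C ≤ C' := le_max_right _ _
        exact ⟨le_min (by linarith) (by linarith), (min_le_right _ _).trans (by linarith)⟩
      · rw [indicator_of_notMem hy, Q0 s hsI y hy, l0 y hy]; simp
    · exact (integrable_indicator_iff Metric.isClosed_closedBall.measurableSet).2
        (integrableOn_const (isCompact_closedBall x0 R').measure_lt_top.ne)
    · refine Eventually.of_forall fun y => ?_
      by_cases hy : y ∈ Metric.closedBall x0 R'
      · have hyb := Metric.closedBall_subset_ball hR' hy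
        have hd : HasDerivAt (fun s => v y s * ψ y s)
            (deriv (v y) t * ψ y t + v y t * ψt y t) t :=
          ((h.contDiff_t y).differentiable (by norm_num) t).hasDerivAt.mul
            (hψ.hasDerivAt t htI y)
        have hle : ℓ y ≤ deriv (v y) t * ψ y t + v y t * ψt y t := by
          have := mul_le_mul_of_nonneg_right (hineq y hyb t (hI htI)) (hψ.nonneg y t htI)
          simp only [hℓ]; linarith
        have hs := (hasDerivAt_iff_tendsto_slope.1 hd).mono_left
          (nhdsWithin_mono t (fun y (hy : t < y) => hy.ne'))
        have := hs.min (tendsto_const_nhds (x := ℓ y))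
        rw [min_eq_right hle] at this
        refine this.congr fun s => ?_
        simp only [hQ, slope_def_field]
      · refine tendsto_const_nhds.congr' ?_
        filter_upwards [Ioo_mem_nhdsGT ht.2] with s hs
        rw [Q0 s ⟨by linarith [ht.1, hs.1], hs.2.le⟩ y hy, l0 y hy, min_self]
  have ev1 : ∀ᶠ s in 𝓝[>] t, k t - ε / 2 < ∫ y, min (Q s y) (ℓ y) := by
    rw [hint] at hlim
    exact hlim.eventually (lt_mem_nhds (by linarith))
  have ev2 : ∀ᶠ s in 𝓝[>] t, ∀ r ∈ Icc t s, k r ≤ k t + ε / 2 := by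
    have hka : ContinuousAt k t := kc.continuousAt (Icc_mem_nhds ht.1 ht.2)
    obtain ⟨δ, hδ, hδ2⟩ := Metric.continuousAt_iff.1 hka (ε / 2) (by linarith)
    filter_upwards [Ioo_mem_nhdsGT (show t < t + δ by linarith)] with s hs r hr
    have : dist r t < δ := by
      rw [Real.dist_eq, abs_of_nonneg (by linarith [hr.1])]; linarith [hr.2, hs.2]
    have := hδ2 this
    rw [Real.dist_eq, abs_lt] at this
    linarith
  filter_upwards [ev1, ev2, Ioo_mem_nhdsGT ht.2] with s h1 h2 hs
  have hsI : s ∈ Icc a b := ⟨by linarith [ht.1, hs.1], hs.2.le⟩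
  have st : 0 < s - t := by linarith [hs.1]
  have i1 : Integrable fun y => v y s * ψ y s :=
    ((h.contDiff_x s).continuous.mul (cψ.2 s hsI)).integrable_of_hasCompactSupport
      (csψ s hsI).mul_left
  have i2 : Integrable fun y => v y t * ψ y t :=
    ((h.contDiff_x t).continuous.mul (cψ.2 t htI)).integrable_of_hasCompactSupport
      (csψ t htI).mul_left
  have iQ : Integrable (Q s) := (i1.sub i2).div_const _
  have il : Integrable ℓ := lc.integrable_of_hasCompactSupport
    (HasCompactSupport.intro (isCompact_closedBall x0 R') l0)
  have h3 : ∫ y, min (Q s y) (ℓ y) ≤ ∫ y, Q s y :=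
    integral_mono (iQ.inf il) iQ fun y => min_le_left _ _
  have h4 : ∫ y, Q s y = ((∫ y, v y s * ψ y s) - ∫ y, v y t * ψ y t) / (s - t) := by
    simp only [hQ]
    rw [integral_div, integral_sub i1 i2]
  have h5 : ∫ r in t..s, k r ≤ ∫ r in t..s, (k t + ε / 2) := by
    refine intervalIntegral.integral_mono_on hs.1.le ?_ (by simp) h2
    refine (kc.mono ?_).intervalIntegrable
    rw [uIcc_of_le hs.1.le]
    exact Icc_subset_Icc ht.1.le hs.2.le
  rw [intervalIntegral.integral_const, smul_eq_mul] at h5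
  have h6 : (k t - ε / 2) * (s - t) ≤ (∫ y, v y s * ψ y s) - ∫ y, v y t * ψ y t := by
    rw [← le_div_iff₀ st, ← h4]
    linarith
  linarith

end Slope

section PointwiseToWeak

variable {n : ℕ} {v g : Eucl n → ℝ → ℝ} {x0 : Eucl n} {R α β M A : ℝ}

lemma exists_inter_ball_subset_of_baire {E : Type*} [MetricSpace E] [CompleteSpace E] {T : Set E}
    (hT : IsClosed T) (hne : T.Nonempty) {F : ℕ → Set E} (hF : ∀ N, IsClosed (F N))
    (hc : T ⊆ ⋃ N, F N) : ∃ t0 ∈ T, ∃ δ > 0, ∃ N, T ∩ Metric.ball t0 δ ⊆ F N := by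
  have : CompleteSpace T := hT.completeSpace_coe
  have : Nonempty T := hne.to_subtype
  obtain ⟨N, ⟨t0, ht0⟩, h0⟩ := nonempty_interior_of_iUnion_of_closed
    (f := fun N => ((↑) : T → E) ⁻¹' F N) (fun N => (hF N).preimage continuous_subtype_val) (by
      rw [← preimage_iUnion, eq_univ_iff_forall]
      exact fun t => hc t.2)
  obtain ⟨δ, hδ, h1⟩ := Metric.mem_nhds_iff.1 (mem_interior_iff_mem_nhds.1 h0)
  refine ⟨t0, ht0, δ, hδ, N, fun s hs => ?_⟩
  exact h1 (show (⟨s, hs.1⟩ : T) ∈ Metric.ball (⟨t0, ht0⟩ : T) δ from hs.2)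

/-- A pointwise differential inequality between separately smooth functions implies its weak
form. -/
theorem SepBdd.weakOn (h : SepBdd v g x0 R α β M A) (hR : 0 < R)
    (hineq : ∀ y ∈ Metric.ball x0 R, ∀ t ∈ Icc α β,
      lap (fun y => v y t) y + g y t ≤ deriv (v y) t) : WeakOn v g x0 R (Icc α β) := by
  set T : Set ℝ := {t | t ∈ Icc α β ∧
    ∀ δ > 0, ¬ WeakOn v g x0 R (Icc α β ∩ Ioo (t - δ) (t + δ))} with hTdef
  have notT : ∀ t ∈ Icc α β, t ∉ T → ∃ δ > 0, WeakOn v g x0 R (Icc α β ∩ Ioo (t - δ) (t + δ)) := by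
    intro t ht htT
    by_contra hcon
    push Not at hcon
    exact htT ⟨ht, hcon⟩
  have hT : IsClosed T := by
    rw [← isOpen_compl_iff, Metric.isOpen_iff]
    intro t ht
    by_cases htI : t ∈ Icc α β
    · obtain ⟨δ, hδ, hw⟩ := notT t htI ht
      refine ⟨δ / 2, by linarith, fun s hs hsT => hsT.2 (δ / 2) (by linarith) (hw.mono ?_)⟩
      rw [Real.ball_eq_Ioo] at hs
      refine inter_subset_inter_right _ fun r hr => ?_
      exact ⟨by linarith [hs.1, hr.1], by linarith [hs.2, hr.2]⟩
    · obtain ⟨δ, hδ, hd⟩ := Metric.isOpen_iff.1 (isClosed_Icc (a := α) (b := β)).isOpen_compl t htI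
      exact ⟨δ, hδ, fun s hs hsT => hd hs hsT.1⟩
  have hgap : ∀ a b, Icc a b ⊆ Icc α β → Disjoint (Ioo a b) T → WeakOn v g x0 R (Icc a b) := by
    intro a b hI hd
    refine h.weakOn_of_slope hI fun a' b' hI' ψ ψt ψL hψ t ht ε hε => ?_
    have hab : a' ≤ b' := ht.1.le.trans ht.2.le
    have ha := hI' (left_mem_Icc.2 hab)
    have hb := hI' (right_mem_Icc.2 hab)
    have htT : t ∉ T := disjoint_left.1 hd ⟨ha.1.trans_lt ht.1, ht.2.trans_le hb.2⟩
    obtain ⟨δ, hδ, hw⟩ := notT t (hI (hI' (Ioo_subset_Icc_self ht))) htT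
    exact hw.slope hδ (hI'.trans hI) hψ ht hε
  rcases T.eq_empty_or_nonempty with hE | hne
  · exact hgap α β subset_rfl (by rw [hE]; exact disjoint_empty _)
  exfalso
  set F : ℕ → Set ℝ := fun N => {t | ∀ x ∈ Metric.closedBall x0 R, ∀ z, ‖z‖ ≤ R →
      -((N : ℝ) * ‖z‖ ^ 2) ≤ v (x + z) t + v (x - z) t - 2 * v x t} with hFdef
  have hFc : ∀ N, IsClosed (F N) := by
    intro N
    simp only [hFdef, ofPred_forall]
    refine isClosed_iInter fun x => isClosed_iInter fun _ => isClosed_iInter fun z =>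
      isClosed_iInter fun _ => isClosed_le continuous_const ?_
    have c := fun y => (h.contDiff_t y).continuous
    exact ((c _).add (c _)).sub (continuous_const.mul (c _))
  obtain ⟨t0, ht0, δ, hδ, N, hN⟩ := exists_inter_ball_subset_of_baire hT hne hFc (by
    intro t _
    obtain ⟨N, hN⟩ := exists_semiconvex (h.contDiff_x t) x0 R R
    exact mem_iUnion.2 ⟨N, hN⟩)
  rw [Real.ball_eq_Ioo] at hN
  refine ht0.2 δ hδ ?_
  refine h.weakOn_of_slope inter_subset_left fun a b hI ψ ψt ψL hψ t ht ε hε => ?_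
  have hIα : Icc a b ⊆ Icc α β := fun r hr => (hI hr).1
  by_cases htT : t ∈ T
  swap
  · obtain ⟨δ', hδ', hw⟩ := notT t (hIα (Ioo_subset_Icc_self ht)) htT
    exact hw.slope hδ' hIα hψ ht hε
  obtain ⟨R1, hR1, hs1⟩ := hψ.supp
  set R' := max R1 0 with hR'
  have hR'0 : 0 ≤ R' := le_max_right _ _
  have hR'R : R' < R := max_lt hR1 hR
  have hs' : ∀ y ∉ Metric.closedBall x0 R', ∀ s ∈ Icc a b,
      ψ y s = 0 ∧ ψt y s = 0 ∧ ψL y s = 0 := fun y hy s hs =>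
    hs1 y (fun hy' => hy (Metric.closedBall_subset_closedBall (le_max_left _ _) hy')) s hs
  set r := (R - R') / 2 with hr
  have hr0 : 0 < r := by simp only [hr]; linarith
  obtain ⟨N', hN'⟩ := exists_gap_bound n (r := r) (M := M) (A := A) (N := N) hr0 (Nat.cast_nonneg N)
  set N2 := max N' (max (n * N + A) 0) with hN2
  refine h.slope_of_lower hineq hIα hψ ht hR'0 hR'R hs' (N' := N2)
    ((le_max_right _ _).trans (le_max_right _ _)) (fun y hy s hs => ?_) hε
  have hys : dist y x0 + (R - R') ≤ R := by linarith [Metric.mem_closedBall.1 hy]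
  have hb := h.recenter hys
  have hts : Icc t s ⊆ Icc a b := Icc_subset_Icc ht.1.le hs.2
  have hyR : y ∈ Metric.ball x0 R := Metric.closedBall_subset_ball hR'R hy
  have hsc : ∀ τ ∈ T ∩ Icc t s, ∀ z, ‖z‖ ≤ r →
      -((N : ℝ) * ‖z‖ ^ 2) ≤ v (y + z) τ + v (y - z) τ - 2 * v y τ := fun τ hτ z hz =>
    hN ⟨hτ.1, (hI (hts hτ.2)).2⟩ y (Metric.ball_subset_closedBall hyR) z
      (hz.trans (by simp only [hr]; linarith))
  refine hb.lower_of_gaps (fun τ hτ => hineq y hyR τ hτ) hr0 (by simp only [hr]; linarith) hT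
    hs.1.le (hts.trans hIα) htT hsc ((le_max_left _ _).trans (le_max_right _ _)) ?_
  intro a' ha' b' hb' hab' hd
  have hI2 : Icc a' b' ⊆ Icc α β := (Icc_subset_Icc ha'.2.1 hb'.2).trans (hts.trans hIα)
  have := hN' v g y (R - R') α β a' b' hb (by simp only [hr]; linarith) hab' hI2
    ((hgap a' b' hI2 hd).recenter hys) (hsc a' ha')
  have h2 : N' * (b' - a') ≤ N2 * (b' - a') :=
    mul_le_mul_of_nonneg_right (le_max_left _ _) (by linarith)
  linarith

end PointwiseToWeak

section LapRules

variable {n : ℕ}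

lemma lap_comp_le {f : Eucl n → ℝ} (hf : ContDiff ℝ 2 f) {φ φ1 φ2 : ℝ → ℝ}
    (h1 : ∀ y, HasDerivAt φ (φ1 (f y)) (f y)) (h2 : ∀ y, HasDerivAt φ1 (φ2 (f y)) (f y))
    (hneg : ∀ y, φ2 (f y) ≤ 0) (x : Eucl n) :
    lap (fun y => φ (f y)) x ≤ φ1 (f x) * lap f x := by
  have df : ∀ y, HasFDerivAt f (fderiv ℝ f y) y := fun y =>
    ((hf.differentiable (by norm_num)) y).hasFDerivAt
  have e1 : ∀ y w, fderiv ℝ (fun y => φ (f y)) y w = φ1 (f y) * fderiv ℝ f y w := by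
    intro y w
    have : HasFDerivAt (fun y => φ (f y)) (φ1 (f y) • fderiv ℝ f y) y :=
      (h1 y).comp_hasFDerivAt y (df y)
    rw [this.fderiv]; rfl
  unfold lap
  rw [Finset.mul_sum]
  refine Finset.sum_le_sum fun i _ => ?_
  set w : Eucl n := EuclideanSpace.single i 1
  simp only [e1]
  have d1 : HasFDerivAt (fun y => φ1 (f y)) (φ2 (f x) • fderiv ℝ f x) x :=
    (h2 x).comp_hasFDerivAt x (df x)
  have d2 : DifferentiableAt ℝ (fun y => fderiv ℝ f y w) x :=
    (contDiff_fderiv_apply_const hf (m := 1) (by norm_num) w).differentiable (by norm_num) x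
  rw [fderiv_fun_mul d1.differentiableAt d2, d1.fderiv]
  simp only [add_apply, smul_apply, smul_eq_mul]
  have := mul_nonneg (neg_nonneg.2 (hneg x)) (mul_self_nonneg (fderiv ℝ f x w))
  linarith

lemma lap_const_mul {f : Eucl n → ℝ} (hf : ContDiff ℝ 2 f) (c : ℝ) (x : Eucl n) :
    lap (fun y => c * f y) x = c * lap f x := by
  unfold lap
  rw [Finset.mul_sum]
  refine Finset.sum_congr rfl fun i _ => ?_
  have e1 : ∀ y, fderiv ℝ (fun y => c * f y) y = c • fderiv ℝ f y := fun y =>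
    fderiv_const_mul ((hf.differentiable (by norm_num)) y) c
  simp only [e1, smul_apply, smul_eq_mul]
  rw [fderiv_const_mul ((contDiff_fderiv_apply_const hf (m := 1) (by norm_num) _).differentiable
    (by norm_num) x)]
  rfl

lemma lap_const_sub {f : Eucl n → ℝ} (hf : ContDiff ℝ 2 f) (c : ℝ) (x : Eucl n) :
    lap (fun y => c - f y) x = - lap f x := by
  have : lap (fun y => c - f y) x = lap (fun y => (-1) * f y) x := by
    unfold lap
    have : ∀ y, fderiv ℝ (fun y => c - f y) y = fderiv ℝ (fun y => (-1) * f y) y := by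
      intro y
      rw [fderiv_const_sub, fderiv_const_mul ((hf.differentiable (by norm_num)) y)]
      simp
    simp only [this]
  rw [this, lap_const_mul hf]; ring

lemma lap_comp_affine {f : Eucl n → ℝ} (hf : ContDiff ℝ 2 f) (x0 : Eucl n) (l : ℝ) (x : Eucl n) :
    lap (fun y => f (x0 + l • y)) x = l ^ 2 * lap f (x0 + l • x) := by
  have key : ∀ g : Eucl n → ℝ, Differentiable ℝ g → ∀ y w,
      fderiv ℝ (fun y => g (x0 + l • y)) y w = l * fderiv ℝ g (x0 + l • y) w := by
    intro g hg y w
    have a : HasFDerivAt (fun y : Eucl n => x0 + l • y) (l • ContinuousLinearMap.id ℝ (Eucl n)) y :=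
      ((hasFDerivAt_id y).const_smul l).const_add x0
    have : HasFDerivAt (fun y => g (x0 + l • y)) _ y := (hg _).hasFDerivAt.comp y a
    rw [this.fderiv]; simp
  unfold lap
  rw [Finset.mul_sum]
  refine Finset.sum_congr rfl fun i _ => ?_
  set w : Eucl n := EuclideanSpace.single i 1
  have df := contDiff_fderiv_apply_const hf (m := 1) (by norm_num) w
  simp only [key f (hf.differentiable (by norm_num))]
  rw [fderiv_const_mul]
  · simp only [smul_apply, smul_eq_mul]
    rw [key _ (df.differentiable (by norm_num))]; ring
  · have : ContDiff ℝ 1 fun y => fderiv ℝ f (x0 + l • y) w :=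
      df.comp (contDiff_const.add (contDiff_id.const_smul l))
    exact this.differentiable (by norm_num) x

end LapRules

/-- Positive entire solutions of `∂ₜ u = Δ u + u ^ p`, in curried form. -/
structure IsSol {n : ℕ} (p : ℝ) (u : Eucl n → ℝ → ℝ) : Prop where
  contDiff_x : ∀ t, ContDiff ℝ 2 fun y => u y t
  contDiff_t : ∀ y, ContDiff ℝ 1 (u y)
  pos : ∀ y t, 0 < u y t
  eq : ∀ y t, deriv (u y) t = lap (fun y => u y t) y + u y t ^ p

/-- The parabolic rescaling of `u` at scale `l` around `(x0, t0)`, with scaling exponent `e`. -/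
noncomputable def rescale {n : ℕ} (e : ℝ) (u : Eucl n → ℝ → ℝ) (x0 : Eucl n) (t0 l : ℝ)
    (y : Eucl n) (t : ℝ) : ℝ := l ^ e * u (x0 + l • y) (t0 + l ^ 2 * t)

section Sol

variable {n : ℕ} {p : ℝ} {u : Eucl n → ℝ → ℝ}

lemma IsSol.rescale (h : IsSol p u) (hp : 1 < p) (x0 : Eucl n) (t0 : ℝ) {l : ℝ} (hl : 0 < l) :
    IsSol p (rescale (2 / (p - 1)) u x0 t0 l) where
  contDiff_x t := contDiff_const.mul ((h.contDiff_x _).comp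
    (contDiff_const.add (contDiff_id.const_smul l)))
  contDiff_t y := contDiff_const.mul ((h.contDiff_t _).comp
    (contDiff_const.add (contDiff_const.mul contDiff_id)))
  pos y t := mul_pos (Real.rpow_pos_of_pos hl _) (h.pos _ _)
  eq y t := by
    have hp1 : p - 1 ≠ 0 := by linarith
    have c2 : ContDiff ℝ 2 fun y : Eucl n => u (x0 + l • y) (t0 + l ^ 2 * t) :=
      (h.contDiff_x _).comp (contDiff_const.add (contDiff_id.const_smul l))
    have e1 : lap (fun y => _root_.rescale (2 / (p - 1)) u x0 t0 l y t) y =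
        l ^ (2 / (p - 1)) * (l ^ 2 * lap (fun y => u y (t0 + l ^ 2 * t)) (x0 + l • y)) := by
      unfold _root_.rescale
      rw [lap_const_mul c2, lap_comp_affine (f := fun y => u y (t0 + l ^ 2 * t)) (h.contDiff_x _)]
    have e2 : HasDerivAt (_root_.rescale (2 / (p - 1)) u x0 t0 l y)
        (l ^ (2 / (p - 1)) * (deriv (u (x0 + l • y)) (t0 + l ^ 2 * t) * (l ^ 2))) t := by
      have a : HasDerivAt (fun t => t0 + l ^ 2 * t) (l ^ 2) t := by
        have := ((hasDerivAt_id t).const_mul (l ^ 2)).const_add t0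
        exact this.congr_deriv (by simp)
      exact ((((h.contDiff_t (x0 + l • y)).differentiable (by norm_num)
        (t0 + l ^ 2 * t)).hasDerivAt).comp t a).const_mul _
    have e3 : (l ^ (2 / (p - 1))) ^ p = l ^ (2 / (p - 1)) * l ^ 2 := by
      rw [← Real.rpow_mul hl.le, ← Real.rpow_natCast l 2, ← Real.rpow_add hl]
      congr 1
      push_cast
      field_simp
      ring
    rw [e1, e2.deriv, h.eq]
    unfold _root_.rescale
    rw [Real.mul_rpow (Real.rpow_pos_of_pos hl _).le (h.pos _ _).le, e3]
    ring

lemma exists_heatK_le_off_ball (n : ℕ) {c S : ℝ} (hc : 0 < c) :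
    ∃ R' > 0, ∀ σ ∈ Ioc 0 S, ∀ z : Eucl n, z ∉ Metric.closedBall (0 : Eucl n) R' →
      heatK n σ (‖z‖ ^ 2) ≤ c := by
  obtain ⟨K, hK, hK2⟩ := exists_heatK_le n
  have ha : 0 < (n : ℝ) / 2 + 1 := by positivity
  have h1 : Tendsto (fun r : ℝ => K * S * (r ^ 2) ^ (-((n : ℝ) / 2 + 1))) atTop (𝓝 (K * S * 0)) :=
    ((tendsto_rpow_neg_atTop ha).comp (tendsto_pow_atTop two_ne_zero)).const_mul _
  rw [mul_zero] at h1
  obtain ⟨r, hr1, hr2⟩ := ((h1.eventually (gt_mem_nhds hc)).and (eventually_gt_atTop 0)).exists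
  refine ⟨r, hr2, fun σ hσ z hz => ?_⟩
  rw [mem_closedBall_zero_iff, not_le] at hz
  have hS : 0 < S := hσ.1.trans_le hσ.2
  calc heatK n σ (‖z‖ ^ 2) ≤ heatK n σ (r ^ 2) := heatK_anti n hσ.1 (by gcongr)
    _ ≤ K * σ * (r ^ 2) ^ (-((n : ℝ) / 2 + 1)) := hK2 σ hσ.1 _ (by positivity)
    _ ≤ K * S * (r ^ 2) ^ (-((n : ℝ) / 2 + 1)) := by
      have := hσ.2
      gcongr
    _ ≤ c := hr1.le

lemma exists_integral_ball_le (n : ℕ) : ∃ C > 0, ∀ (p : ℝ) (u : Eucl n → ℝ → ℝ), IsSol p u →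
    ∫ y in Metric.ball (0 : Eucl n) 1, u y (-1) ≤ C * u 0 0 := by
  have hpi := Real.pi_pos
  set c : ℝ := heatK n 2 0 * Real.exp (-(1 / 4)) / 2 with hc
  have hc0 : 0 < c := by have := heatK_pos n (σ := 2) (by norm_num) 0; positivity
  obtain ⟨R', hR', hR2⟩ := exists_heatK_le_off_ball n (S := 2 * (0 - (-1))) hc0
  refine ⟨8 / c, by positivity, fun p u hu => ?_⟩
  obtain ⟨K, hK⟩ := (isCompact_closedBall (0 : Eucl n) 1).exists_bound_of_continuousOn
    (hu.contDiff_x (-1)).continuous.continuousOn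
  have hKb : ∀ y ∈ Metric.ball (0 : Eucl n) 1, u y (-1) ≤ K := fun y hy =>
    (le_abs_self _).trans (hK y (Metric.ball_subset_closedBall hy))
  have hK0 : 0 < K := (hu.pos 0 (-1)).trans_le (hKb 0 (by simp))
  set φ : ℝ → ℝ := fun s => K - K ^ 2 / (K + s) with hφ
  set v : Eucl n → ℝ → ℝ := fun y t => φ (u y t) with hv
  have hKu : ∀ y t, 0 < K + u y t := fun y t => add_pos hK0 (hu.pos y t)
  have d1 : ∀ y t, HasDerivAt φ (K ^ 2 / (K + u y t) ^ 2) (u y t) := by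
    intro y t
    have := ((hasDerivAt_const (u y t) (K ^ 2)).div ((hasDerivAt_id (u y t)).const_add K)
      (hKu y t).ne').const_sub K
    exact this.congr_deriv (by simp; ring)
  have d2 : ∀ y t, HasDerivAt (fun s => K ^ 2 / (K + s) ^ 2) (-(2 * K ^ 2 / (K + u y t) ^ 3))
      (u y t) := by
    intro y t
    have h := hKu y t
    have := (hasDerivAt_const (u y t) (K ^ 2)).div
      (((hasDerivAt_id (u y t)).const_add K).pow 2) (pow_pos h 2).ne'
    refine this.congr_deriv ?_
    simp
    field_simp
  have hb : SepBdd v (fun _ _ => 0) 0 (R' + 1) (-1) 0 K 0 := by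
    refine ⟨fun t => ?_, fun y => ?_, fun t => continuous_const, fun t => continuous_const,
      fun y _ t _ => ?_, fun y _ t _ => ?_, fun y _ t _ => by simp⟩
    · exact contDiff_const.sub (contDiff_const.div (contDiff_const.add (hu.contDiff_x t))
        fun y => (hKu y t).ne')
    · exact contDiff_const.sub (contDiff_const.div (contDiff_const.add (hu.contDiff_t y))
        fun t => (hKu y t).ne')
    · simp only [hv, hφ]
      rw [sub_nonneg, div_le_iff₀ (hKu y t)]
      nlinarith [hu.pos y t]
    · simp only [hv, hφ]
      have := hKu y t
      have : 0 ≤ K ^ 2 / (K + u y t) := by positivity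
      linarith
  have hW : WeakOn v (fun _ _ => 0) 0 (R' + 1) (Icc (-1) 0) := by
    refine hb.weakOn (by linarith) fun y _ t _ => ?_
    have h1 : lap (fun y => v y t) y ≤ K ^ 2 / (K + u y t) ^ 2 * lap (fun y => u y t) y :=
      lap_comp_le (hu.contDiff_x t) (φ1 := fun s => K ^ 2 / (K + s) ^ 2)
        (φ2 := fun s => -(2 * K ^ 2 / (K + s) ^ 3)) (fun y => d1 y t) (fun y => d2 y t)
        (fun y => by have := hKu y t; rw [neg_nonpos]; positivity) y
    have h2 : HasDerivAt (v y) (K ^ 2 / (K + u y t) ^ 2 * deriv (u y) t) t :=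
      (d1 y t).comp t ((hu.contDiff_t y).differentiable (by norm_num) t).hasDerivAt
    rw [h2.deriv, hu.eq]
    have h3 : 0 ≤ K ^ 2 / (K + u y t) ^ 2 * u y t ^ p := by
      have := hKu y t
      have := hu.pos y t
      positivity
    linarith
  have hlow := hb.kernel_lower (a := -1) (b := 0) (R' := R') (c := c)
    (L := c / 8 * ∫ y in Metric.ball (0 : Eucl n) 1, u y (-1)) (by norm_num) subset_rfl hW hR'.le
    (by linarith) hc0.le hR2 ?_
  · have hvu : v 0 0 ≤ u 0 0 := by
      simp only [hv, hφ]
      rw [sub_le_iff_le_add, ← sub_le_iff_le_add', le_div_iff₀ (hKu 0 0)]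
      nlinarith [sq_nonneg (u 0 0)]
    rw [div_mul_eq_mul_div, le_div_iff₀ hc0]
    linarith
  · intro ε hε
    have hσ : 0 < 0 - (-1) + ε := by linarith [hε.1]
    have hσ2 : 0 - (-1) + ε ≤ 2 := by linarith [hε.2]
    set σ := 0 - (-1) + ε with hσdef
    have hσ1 : 1 ≤ σ := by linarith [hε.1]
    have hker : ∀ z ∈ Metric.ball (0 : Eucl n) 1, c / 4 ≤ tker c σ z := by
      intro z hz
      refine trunc_ge_quarter hc0 ?_
      rw [mem_ball_zero_iff] at hz
      have hz2 : ‖z‖ ^ 2 ≤ 1 := by nlinarith [norm_nonneg z]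
      refine le_trans ?_ (heatK_anti n hσ hz2)
      simp only [hc, heatK]
      simp only [zero_div, neg_zero, Real.exp_zero, mul_one]
      have a1 : (4 * Real.pi * 2) ^ (-((n : ℝ) / 2)) ≤ (4 * Real.pi * σ) ^ (-((n : ℝ) / 2)) :=
        Real.rpow_le_rpow_of_nonpos (by positivity) (by gcongr) (by
          rw [neg_nonpos]; positivity)
      have a2 : Real.exp (-(1 / 4)) ≤ Real.exp (-(1 / (4 * σ))) := by
        apply Real.exp_le_exp.2
        rw [neg_le_neg_iff]
        exact one_div_le_one_div_of_le (by norm_num) (by linarith)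
      calc 2 * ((4 * Real.pi * 2) ^ (-((n : ℝ) / 2)) * Real.exp (-(1 / 4)) / 2)
          = (4 * Real.pi * 2) ^ (-((n : ℝ) / 2)) * Real.exp (-(1 / 4)) := by ring
        _ ≤ _ := mul_le_mul a1 a2 (Real.exp_pos _).le (by positivity)
    have vnn : ∀ y, 0 ≤ v y (-1) := by
      intro y
      simp only [hv, hφ]
      rw [sub_nonneg, div_le_iff₀ (hKu y _)]
      nlinarith [hu.pos y (-1)]
    have hvh : ∀ y ∈ Metric.ball (0 : Eucl n) 1, u y (-1) / 2 ≤ v y (-1) := by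
      intro y hy
      have h1 := hKb y hy
      have h2 := hu.pos y (-1)
      simp only [hv, hφ]
      rw [le_sub_iff_add_le, ← le_sub_iff_add_le', div_le_iff₀ (hKu y _)]
      nlinarith
    have cv : Continuous fun y => v y (-1) := (hb.contDiff_x (-1)).continuous
    have ck : Continuous fun y => tker (n := n) c σ y := continuous_tker c hσ
    have hcs : HasCompactSupport fun y => tker (n := n) c σ y :=
      hasCompactSupport_tker (R' := R') (hR2 σ ⟨hσ, by linarith⟩)
    have i1 : Integrable fun y => v y (-1) * tker c σ y :=
      (cv.mul ck).integrable_of_hasCompactSupport hcs.mul_left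
    simp only [sub_zero]
    calc c / 8 * ∫ y in Metric.ball (0 : Eucl n) 1, u y (-1)
        = ∫ y in Metric.ball (0 : Eucl n) 1, c / 8 * u y (-1) := (integral_const_mul _ _).symm
      _ ≤ ∫ y in Metric.ball (0 : Eucl n) 1, v y (-1) * tker c σ y := by
        refine setIntegral_mono_on ?_ i1.integrableOn measurableSet_ball fun y hy => ?_
        · have : IntegrableOn (fun y => c / 8 * u y (-1)) (Metric.closedBall (0 : Eucl n) 1) :=
            (continuous_const.mul (hu.contDiff_x (-1)).continuous).continuousOn.integrableOn_compact
              (isCompact_closedBall _ _)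
          exact this.mono_set Metric.ball_subset_closedBall
        · have h1 := hvh y hy
          have h2 := hker y hy
          have h3 := hu.pos y (-1)
          calc c / 8 * u y (-1) = u y (-1) / 2 * (c / 4) := by ring
            _ ≤ _ := mul_le_mul h1 h2 (by positivity) (vnn y)
      _ ≤ ∫ y, v y (-1) * tker c σ y := setIntegral_le_integral i1
        (Eventually.of_forall fun y => mul_nonneg (vnn y) (tker_nonneg _ _ _))

end Sol

section UpperBound

variable {n : ℕ}

lemma rpow_le_mul_of_le {p s S K : ℝ} (hp : 1 < p) (hs : 0 < s) (hsS : s ≤ S)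
    (hK : S ^ (p - 1) ≤ K) : s ^ p ≤ K * S := by
  have hS : 0 < S := hs.trans_le hsS
  calc s ^ p ≤ S ^ p := Real.rpow_le_rpow hs.le hsS (by linarith)
    _ = S ^ (p - 1) * S := by rw [← Real.rpow_add_one hS.ne']; ring_nf
    _ ≤ K * S := by gcongr

lemma IsSol.sepBdd_const_sub {p : ℝ} {u : Eucl n → ℝ → ℝ} (hu : IsSol p u) (hp : 1 < p)
    {x0 : Eucl n} {R α β S K : ℝ}
    (hS : ∀ y ∈ Metric.ball x0 R, ∀ t ∈ Icc α β, u y t ≤ S) (hK : S ^ (p - 1) ≤ K) :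
    SepBdd (fun y t => S - u y t) (fun y t => -(u y t ^ p)) x0 R α β S (K * S) where
  contDiff_x t := contDiff_const.sub (hu.contDiff_x t)
  contDiff_t y := contDiff_const.sub (hu.contDiff_t y)
  cont_gx t := ((hu.contDiff_x t).continuous.rpow_const fun y => Or.inl (hu.pos y t).ne').neg
  cont_gt y := ((hu.contDiff_t y).continuous.rpow_const fun t => Or.inl (hu.pos y t).ne').neg
  nonneg y hy t ht := sub_nonneg.2 (hS y hy t ht)
  le y _ t _ := by linarith [hu.pos y t]
  abs_le y hy t ht := by
    rw [abs_neg, abs_of_nonneg (Real.rpow_nonneg (hu.pos y t).le _)]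
    exact rpow_le_mul_of_le hp (hu.pos y t) (hS y hy t ht) hK

lemma IsSol.weakOn_const_sub {p : ℝ} {u : Eucl n → ℝ → ℝ} (hu : IsSol p u) (hp : 1 < p)
    {x0 : Eucl n} {R α β S : ℝ} (hR : 0 < R)
    (hS : ∀ y ∈ Metric.ball x0 R, ∀ t ∈ Icc α β, u y t ≤ S) :
    WeakOn (fun y t => S - u y t) (fun y t => -(u y t ^ p)) x0 R (Icc α β) := by
  refine (hu.sepBdd_const_sub hp hS le_rfl).weakOn hR fun y _ t _ => ?_
  have h2 : deriv (fun t => S - u y t) t = -deriv (u y) t := deriv_const_sub S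
  rw [lap_const_sub (hu.contDiff_x t)]
  change _ ≤ deriv (fun t => S - u y t) t
  rw [h2, hu.eq]
  linarith

lemma IsSol.sepBdd {p : ℝ} {u : Eucl n → ℝ → ℝ} (hu : IsSol p u) (hp : 1 < p)
    {x0 : Eucl n} {R α β S K : ℝ}
    (hS : ∀ y ∈ Metric.ball x0 R, ∀ t ∈ Icc α β, u y t ≤ S) (hK : S ^ (p - 1) ≤ K) :
    SepBdd u (fun y t => u y t ^ p) x0 R α β S (K * S) where
  contDiff_x := hu.contDiff_x
  contDiff_t := hu.contDiff_t
  cont_gx t := (hu.contDiff_x t).continuous.rpow_const fun y => Or.inl (hu.pos y t).ne'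
  cont_gt y := (hu.contDiff_t y).continuous.rpow_const fun t => Or.inl (hu.pos y t).ne'
  nonneg y _ t _ := (hu.pos y t).le
  le := hS
  abs_le y hy t ht := by
    rw [abs_of_nonneg (Real.rpow_nonneg (hu.pos y t).le _)]
    exact rpow_le_mul_of_le hp (hu.pos y t) (hS y hy t ht) hK

lemma IsSol.weakOn {p : ℝ} {u : Eucl n → ℝ → ℝ} (hu : IsSol p u) (hp : 1 < p)
    {x0 : Eucl n} {R α β S : ℝ} (hR : 0 < R)
    (hS : ∀ y ∈ Metric.ball x0 R, ∀ t ∈ Icc α β, u y t ≤ S) :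
    WeakOn u (fun y t => u y t ^ p) x0 R (Icc α β) :=
  (hu.sepBdd hp hS le_rfl).weakOn hR fun y _ t _ => (hu.eq y t).ge

lemma exists_le_of_le_on_cylinder (n : ℕ) : ∃ C > 0, ∀ (p : ℝ) (u : Eucl n → ℝ → ℝ), 1 < p →
    IsSol p u → ∀ S K, (∀ y ∈ Metric.ball (0 : Eucl n) 1, ∀ t ∈ Icc (-1) 0, u y t ≤ S) →
    S ^ (p - 1) ≤ K → ∀ τ ∈ Ioc (0 : ℝ) 1, u 0 0 ≤ C * (1 + K) * τ * S +
      C * τ ^ (-((n : ℝ) / 2)) * ∫ y in Metric.ball (0 : Eucl n) 1, u y (-τ) := by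
  have hpi := Real.pi_pos
  obtain ⟨K0, hK0, hK02⟩ := exists_heatK_le n
  set C1 : ℝ := K0 * 2 * (1 / 4) ^ (-((n : ℝ) / 2 + 1)) with hC1
  have hC10 : 0 < C1 := by positivity
  set V := volume.real (Metric.closedBall (0 : Eucl n) 1) with hV
  have hV0 : 0 ≤ V := measureReal_nonneg
  set C2 : ℝ := 3 * C1 * V + 16 * 2 ^ ((n : ℝ) / 2) with hC2
  have hC20 : 0 < C2 := by positivity
  set C3 : ℝ := (4 * Real.pi) ^ (-((n : ℝ) / 2)) with hC3
  have hC30 : 0 < C3 := by positivity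
  refine ⟨C2 + 1 + C3, by positivity, fun p u hp hu S K hS hK τ hτ => ?_⟩
  have hτ0 := hτ.1
  have hS0 : 0 < S := (hu.pos 0 0).trans_le (hS 0 (by simp) 0 (by simp))
  have hKn : 0 ≤ K := (Real.rpow_nonneg hS0.le _).trans hK
  have hb := hu.sepBdd_const_sub hp hS hK
  have hI : Icc (-τ) 0 ⊆ Icc (-1 : ℝ) 0 := Icc_subset_Icc_left (by linarith [hτ.2])
  set c := C1 * τ with hcdef
  have hc0 : 0 < c := by positivity
  set I := ∫ y in Metric.ball (0 : Eucl n) 1, u y (-τ) with hIdef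
  have hI0 : 0 ≤ I := setIntegral_nonneg measurableSet_ball fun y _ => (hu.pos y _).le
  have hcR : ∀ σ ∈ Ioc 0 (2 * (0 - (-τ))), ∀ z : Eucl n,
      z ∉ Metric.closedBall (0 : Eucl n) (1 / 2) → heatK n σ (‖z‖ ^ 2) ≤ c := by
    intro σ hσ z hz
    rw [mem_closedBall_zero_iff, not_le] at hz
    have h2 : σ ≤ 2 * τ := by linarith [hσ.2]
    calc heatK n σ (‖z‖ ^ 2) ≤ heatK n σ (1 / 4) := heatK_anti n hσ.1 (by nlinarith)
      _ ≤ K0 * σ * (1 / 4) ^ (-((n : ℝ) / 2 + 1)) := hK02 σ hσ.1 _ (by norm_num)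
      _ ≤ K0 * (2 * τ) * (1 / 4) ^ (-((n : ℝ) / 2 + 1)) := by gcongr
      _ = c := by rw [hcdef, hC1]; ring
  have hlow := hb.kernel_lower (a := -τ) (b := 0) (R' := 1 / 2) (c := c)
    (L := S * (1 - C2 * τ) - C3 * τ ^ (-((n : ℝ) / 2)) * I) (by linarith) hI
    ((hu.weakOn_const_sub hp one_pos hS).mono hI) (by norm_num) (by norm_num) hc0.le hcR ?_
  · have e : C2 * τ * S + C3 * τ ^ (-((n : ℝ) / 2)) * I + K * S * τ ≤
      (C2 + 1 + C3) * (1 + K) * τ * S + (C2 + 1 + C3) * τ ^ (-((n : ℝ) / 2)) * I := by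
      have t1 : 0 ≤ τ ^ (-((n : ℝ) / 2)) * I := by positivity
      have t2 : 0 ≤ τ * S := by positivity
      have t3 : 0 ≤ K * (τ * S) := by positivity
      nlinarith [mul_nonneg hC20.le t1, mul_nonneg hC30.le t2, mul_nonneg hC20.le t3,
        mul_nonneg hC30.le t3]
    linarith
  · intro ε hε
    simp only [sub_zero, zero_sub, neg_neg] at hε ⊢
    set σ := τ + ε with hσ
    have hσ0 : 0 < σ := by linarith [hε.1]
    have hσ2 : σ ≤ 2 * τ := by linarith [hε.2]
    have hoff : ∀ z : Eucl n, z ∉ Metric.closedBall (0 : Eucl n) (1 / 2) →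
      heatK n σ (‖z‖ ^ 2) ≤ c := hcR σ ⟨hσ0, by linarith⟩
    have ck : Continuous fun y => tker (n := n) c σ y := continuous_tker c hσ0
    have hcs : HasCompactSupport fun y => tker (n := n) c σ y := hasCompactSupport_tker hoff
    have i0 : Integrable fun y => tker (n := n) c σ y := integrable_tker hc0.le hσ0
    have i1 : Integrable fun y => u y (-τ) * tker c σ y :=
      ((hu.contDiff_x _).continuous.mul ck).integrable_of_hasCompactSupport hcs.mul_left
    have iu : IntegrableOn (fun y => C3 * τ ^ (-((n : ℝ) / 2)) * u y (-τ))
        (Metric.ball (0 : Eucl n) 1) := by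
      have : IntegrableOn (fun y => C3 * τ ^ (-((n : ℝ) / 2)) * u y (-τ))
          (Metric.closedBall (0 : Eucl n) 1) :=
        (continuous_const.mul (hu.contDiff_x _).continuous).continuousOn.integrableOn_compact
          (isCompact_closedBall _ _)
      exact this.mono_set Metric.ball_subset_closedBall
    have hkle : ∀ z : Eucl n, tker c σ z ≤ C3 * τ ^ (-((n : ℝ) / 2)) := by
      intro z
      refine (tker_le hc0.le hσ0 z).trans ?_
      refine (heatK_anti n hσ0 (sq_nonneg ‖z‖)).trans ?_
      simp only [heatK, zero_div, neg_zero, Real.exp_zero, mul_one, hC3]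
      rw [← Real.mul_rpow (by positivity) hτ0.le]
      exact Real.rpow_le_rpow_of_nonpos (by positivity) (by gcongr; linarith [hε.1])
        (by rw [neg_nonpos]; positivity)
    have h1 := one_sub_le_integral_tker (n := n) hc0.le hσ0 (r := 1) one_pos
    rw [one_pow, div_one] at h1
    have h1' : 1 - C2 * τ ≤ ∫ z, tker (n := n) c σ z := by
      refine le_trans ?_ h1
      have : 8 * 2 ^ ((n : ℝ) / 2) * σ ≤ 8 * 2 ^ ((n : ℝ) / 2) * (2 * τ) := by gcongr
      have e : C2 * τ = 3 * c * V + 8 * 2 ^ ((n : ℝ) / 2) * (2 * τ) := by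
        rw [hC2, hcdef]; ring
      linarith
    have h2 : ∫ y, u y (-τ) * tker c σ y ≤ C3 * τ ^ (-((n : ℝ) / 2)) * I := by
      have hz : ∀ y ∉ Metric.ball (0 : Eucl n) 1, u y (-τ) * tker c σ y = 0 := by
        intro y hy
        have hy' : y ∉ Metric.closedBall (0 : Eucl n) (1 / 2) := fun h =>
          hy (Metric.closedBall_subset_ball (by norm_num) h)
        rw [tker_eq_zero_of_notMem hoff hy', mul_zero]
      rw [← setIntegral_eq_integral_of_forall_compl_eq_zero hz, hIdef, ← integral_const_mul]
      refine setIntegral_mono i1.integrableOn iu fun y => ?_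
      have := mul_le_mul_of_nonneg_left (hkle y) (hu.pos y (-τ)).le
      simp only
      linarith
    have h3 : ∫ y, (S - u y (-τ)) * tker c σ y =
        S * (∫ y, tker (n := n) c σ y) - ∫ y, u y (-τ) * tker c σ y := by
      rw [← integral_const_mul, ← integral_sub (i0.const_mul S) i1]
      simp only [sub_mul]
    rw [h3]
    have := mul_le_mul_of_nonneg_left h1' hS0.le
    linarith

end UpperBound

section SpaceTime

variable {n : ℕ}

instance isAddHaarMeasure_volume_spaceTime :
    (volume : Measure (Eucl n × ℝ)).IsAddHaarMeasure := by
  rw [Measure.volume_eq_prod]; infer_instance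

/-- The `i`-th spatial derivative on space-time. -/
noncomputable def dx (i : Fin n) (φ : Eucl n × ℝ → ℝ) (X : Eucl n × ℝ) : ℝ :=
  fderiv ℝ φ X (EuclideanSpace.single i 1, 0)

/-- The time derivative on space-time. -/
noncomputable def dt (φ : Eucl n × ℝ → ℝ) (X : Eucl n × ℝ) : ℝ := fderiv ℝ φ X (0, 1)

/-- The spatial Laplacian on space-time. -/
noncomputable def slap (φ : Eucl n × ℝ → ℝ) (X : Eucl n × ℝ) : ℝ := ∑ i, dx i (dx i φ) X

lemma contDiff_dx {φ : Eucl n × ℝ → ℝ} {m k : WithTop ℕ∞} (hφ : ContDiff ℝ k φ) (hmk : m + 1 ≤ k)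
    (i : Fin n) : ContDiff ℝ m (dx i φ) := contDiff_fderiv_apply_const hφ hmk _

lemma contDiff_dt {φ : Eucl n × ℝ → ℝ} {m k : WithTop ℕ∞} (hφ : ContDiff ℝ k φ)
    (hmk : m + 1 ≤ k) : ContDiff ℝ m (dt φ) := contDiff_fderiv_apply_const hφ hmk _

lemma continuous_slap {φ : Eucl n × ℝ → ℝ} (hφ : ContDiff ℝ 2 φ) : Continuous (slap φ) := by
  unfold slap
  exact continuous_finsetSum _ fun i _ =>
    (contDiff_dx (m := 0) (contDiff_dx (m := 1) hφ (by norm_num) i) (by norm_num) i).continuous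

lemma continuous_dt {φ : Eucl n × ℝ → ℝ} (hφ : ContDiff ℝ 1 φ) : Continuous (dt φ) :=
  (contDiff_dt (m := 0) hφ (by norm_num)).continuous

lemma continuous_dx {φ : Eucl n × ℝ → ℝ} (hφ : ContDiff ℝ 1 φ) (i : Fin n) :
    Continuous (dx i φ) := (contDiff_dx (m := 0) hφ (by norm_num) i).continuous

lemma fderiv_slice {φ : Eucl n × ℝ → ℝ} (hφ : Differentiable ℝ φ) (s : ℝ) (y w : Eucl n) :
    fderiv ℝ (fun y => φ (y, s)) y w = fderiv ℝ φ (y, s) (w, 0) := by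
  have h1 : HasFDerivAt (fun y : Eucl n => (y, s))
      (ContinuousLinearMap.inl ℝ (Eucl n) ℝ) y := hasFDerivAt_prodMk_left y s
  have h2 : HasFDerivAt (fun y => φ (y, s)) _ y := (hφ (y, s)).hasFDerivAt.comp y h1
  rw [h2.fderiv]; simp

lemma lap_slice {φ : Eucl n × ℝ → ℝ} (hφ : ContDiff ℝ 2 φ) (s : ℝ) (y : Eucl n) :
    lap (fun y => φ (y, s)) y = slap φ (y, s) := by
  unfold lap slap
  refine Finset.sum_congr rfl fun i _ => ?_
  simp only [fderiv_slice (hφ.differentiable (by norm_num))]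
  exact fderiv_slice ((contDiff_dx (m := 1) hφ (by norm_num) i).differentiable (by norm_num)) s y _

lemma hasDerivAt_slice {φ : Eucl n × ℝ → ℝ} (hφ : Differentiable ℝ φ) (s : ℝ) (y : Eucl n) :
    HasDerivAt (fun s => φ (y, s)) (dt φ (y, s)) s := by
  have h1 : HasDerivAt (fun s : ℝ => (y, s)) ((0 : Eucl n), (1 : ℝ)) s :=
    (hasDerivAt_const s y).prodMk (hasDerivAt_id s)
  exact (hφ (y, s)).hasFDerivAt.comp_hasDerivAt s h1

lemma fderiv_eq_zero_of_off {φ : Eucl n × ℝ → ℝ} {K : Set (Eucl n × ℝ)} (hK : IsClosed K)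
    (h : ∀ X ∉ K, φ X = 0) : ∀ X ∉ K, fderiv ℝ φ X = 0 := by
  intro X hX
  have : φ =ᶠ[𝓝 X] fun _ => 0 := by
    filter_upwards [hK.isOpen_compl.mem_nhds hX] with Y hY using h Y hY
  rw [this.fderiv_eq]; simp

lemma dt_eq_zero_of_off {φ : Eucl n × ℝ → ℝ} {K : Set (Eucl n × ℝ)} (hK : IsClosed K)
    (h : ∀ X ∉ K, φ X = 0) : ∀ X ∉ K, dt φ X = 0 := fun X hX => by
  simp [dt, fderiv_eq_zero_of_off hK h X hX]

lemma dx_eq_zero_of_off {φ : Eucl n × ℝ → ℝ} {K : Set (Eucl n × ℝ)} (hK : IsClosed K)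
    (h : ∀ X ∉ K, φ X = 0) (i : Fin n) : ∀ X ∉ K, dx i φ X = 0 := fun X hX => by
  simp [dx, fderiv_eq_zero_of_off hK h X hX]

lemma slap_eq_zero_of_off {φ : Eucl n × ℝ → ℝ} {K : Set (Eucl n × ℝ)} (hK : IsClosed K)
    (h : ∀ X ∉ K, φ X = 0) : ∀ X ∉ K, slap φ X = 0 := fun X hX =>
  Finset.sum_eq_zero fun i _ => dx_eq_zero_of_off hK (dx_eq_zero_of_off hK h i) i X hX

lemma integrable_mul_of_bdd_on {G f : Eucl n × ℝ → ℝ} {K : Set (Eucl n × ℝ)} {S : ℝ}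
    (hG : Measurable G) (hf : Continuous f) (hK : IsCompact K) (hb : ∀ X ∈ K, |G X| ≤ S)
    (h0 : ∀ X ∉ K, f X = 0) : Integrable fun X => G X * f X := by
  have i1 : Integrable f :=
    hf.integrable_of_hasCompactSupport (HasCompactSupport.intro hK h0)
  have : (fun X => G X * f X) = fun X => K.indicator G X * f X := by
    ext X
    by_cases hX : X ∈ K
    · rw [indicator_of_mem hX]
    · rw [h0 X hX, mul_zero, mul_zero]
  rw [this]
  refine i1.bdd_mul (c := max S 0) (hG.indicator hK.measurableSet).aestronglyMeasurable
    (Eventually.of_forall fun X => ?_)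
  by_cases hX : X ∈ K
  · rw [indicator_of_mem hX]; exact (hb X hX).trans (le_max_left _ _)
  · rw [indicator_of_notMem hX]; simp

lemma integral_dt_eq_zero {φ : Eucl n × ℝ → ℝ} (hφ : ContDiff ℝ 1 φ) (hc : HasCompactSupport φ) :
    ∫ X, dt φ X = 0 := by
  have := integral_fderiv_mul_comm volume (f := fun _ : Eucl n × ℝ => (1 : ℝ)) contDiff_const hφ hc
    ((0 : Eucl n), (1 : ℝ))
  simpa [dt] using this

lemma integral_dx_eq_zero {φ : Eucl n × ℝ → ℝ} (hφ : ContDiff ℝ 1 φ) (hc : HasCompactSupport φ)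
    (i : Fin n) : ∫ X, dx i φ X = 0 := by
  have := integral_fderiv_mul_comm volume (f := fun _ : Eucl n × ℝ => (1 : ℝ)) contDiff_const hφ hc
    (EuclideanSpace.single i (1 : ℝ), (0 : ℝ))
  simpa [dx] using this

lemma HasCompactSupport.dx {φ : Eucl n × ℝ → ℝ} (h : HasCompactSupport φ) (i : Fin n) :
    HasCompactSupport (dx i φ) := hasCompactSupport_fderiv_apply h _

lemma HasCompactSupport.dt {φ : Eucl n × ℝ → ℝ} (h : HasCompactSupport φ) :
    HasCompactSupport (dt φ) := hasCompactSupport_fderiv_apply h _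

lemma integrable_slap {φ : Eucl n × ℝ → ℝ} (hφ : ContDiff ℝ 2 φ) (hc : HasCompactSupport φ) :
    Integrable (slap φ) := by
  unfold slap
  exact integrable_finsetSum _ fun i _ =>
    (continuous_dx (contDiff_dx (m := 1) hφ (by norm_num) i) i).integrable_of_hasCompactSupport
      ((hc.dx i).dx i)

lemma integral_slap_eq_zero {φ : Eucl n × ℝ → ℝ} (hφ : ContDiff ℝ 2 φ)
    (hc : HasCompactSupport φ) : ∫ X, slap φ X = 0 := by
  unfold slap
  rw [integral_finsetSum]
  · exact Finset.sum_eq_zero fun i _ =>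
      integral_dx_eq_zero (contDiff_dx (m := 1) hφ (by norm_num) i) (hc.dx i) i
  · exact fun i _ =>
      (continuous_dx (contDiff_dx (m := 1) hφ (by norm_num) i) i).integrable_of_hasCompactSupport
        ((hc.dx i).dx i)

lemma isTest_of_contDiff {φ : Eucl n × ℝ → ℝ} (hφ : ContDiff ℝ 2 φ) (h0 : ∀ X, 0 ≤ φ X)
    {x0 : Eucl n} {R R' α β α' β' : ℝ} (hR : R' < R)
    (hs : ∀ X ∉ Metric.closedBall x0 R' ×ˢ Icc α' β', φ X = 0) :
    IsTest x0 R α β (fun y s => φ (y, s)) (fun y s => dt φ (y, s)) (fun y s => slap φ (y, s)) where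
  nonneg y s _ := h0 _
  supp := by
    have hK : IsClosed (Metric.closedBall x0 R' ×ˢ Icc α' β') :=
      Metric.isClosed_closedBall.prod isClosed_Icc
    refine ⟨R', hR, fun y hy s _ => ?_⟩
    have : (y, s) ∉ Metric.closedBall x0 R' ×ˢ Icc α' β' := fun h => hy h.1
    exact ⟨hs _ this, dt_eq_zero_of_off hK hs _ this, slap_eq_zero_of_off hK hs _ this⟩
  contDiff s _ := hφ.comp (contDiff_id.prodMk contDiff_const)
  lap_eq s _ y := lap_slice hφ s y
  hasDerivAt s _ y := hasDerivAt_slice (hφ.differentiable (by norm_num)) s y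
  cont := hφ.continuous.continuousOn
  cont_t := (continuous_dt (hφ.of_le (by norm_num))).continuousOn
  cont_L := (continuous_slap hφ).continuousOn

lemma WeakOn.integral_nonpos {v g : Eucl n → ℝ → ℝ} {x0 : Eucl n} {R R' α β α' β' : ℝ}
    (hW : WeakOn v g x0 R (Icc α β)) (hR : R' < R) (hα : α < α') (hα' : α' ≤ β') (hβ : β' < β)
    {φ : Eucl n × ℝ → ℝ} (hφ : ContDiff ℝ 2 φ) (h0 : ∀ X, 0 ≤ φ X)
    (hs : ∀ X ∉ Metric.closedBall x0 R' ×ˢ Icc α' β', φ X = 0)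
    (hi : Integrable fun X : Eucl n × ℝ => v X.1 X.2 * (dt φ X + slap φ X) + g X.1 X.2 * φ X) :
    ∫ X : Eucl n × ℝ, (v X.1 X.2 * (dt φ X + slap φ X) + g X.1 X.2 * φ X) ≤ 0 := by
  have hK : IsClosed (Metric.closedBall x0 R' ×ˢ Icc α' β') :=
    Metric.isClosed_closedBall.prod isClosed_Icc
  have h := hW α β (by linarith) subset_rfl _ _ _ (isTest_of_contDiff hφ h0 hR hs)
  have z : ∀ s ∉ Icc α' β', ∀ y, φ (y, s) = 0 := fun s hs' y => hs _ fun h => hs' h.2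
  simp only [z α (fun h => by linarith [h.1]), z β (fun h => by linarith [h.2]), mul_zero,
    integral_zero, sub_zero] at h
  rw [Measure.volume_eq_prod] at hi ⊢
  rw [integral_prod_symm _ hi]
  refine le_trans (le_of_eq ?_) h
  rw [intervalIntegral.integral_of_le (by linarith)]
  refine (setIntegral_eq_integral_of_forall_compl_eq_zero fun s hs' => ?_).symm
  have hoff : ∀ y, (y, s) ∉ Metric.closedBall x0 R' ×ˢ Icc α' β' := fun y h =>
    hs' ⟨by linarith [h.2.1], by linarith [h.2.2]⟩
  simp only [hs _ (hoff _), dt_eq_zero_of_off hK hs _ (hoff _),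
    slap_eq_zero_of_off hK hs _ (hoff _)]
  simp

lemma IsSol.measurable {p : ℝ} {u : Eucl n → ℝ → ℝ} (hu : IsSol p u) :
    Measurable fun X : Eucl n × ℝ => u X.1 X.2 := by
  have := measurable_uncurry_of_continuous_of_measurable (u := fun (t : ℝ) (y : Eucl n) => u y t)
    (fun y => (hu.contDiff_t y).continuous) (fun t => (hu.contDiff_x t).continuous.measurable)
  exact this.comp measurable_swap

/-- The weak form of the equation in a cylinder where the solution is bounded. -/
lemma IsSol.weak_eq {p : ℝ} {u : Eucl n → ℝ → ℝ} (hu : IsSol p u) (hp : 1 < p) {x0 : Eucl n}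
    {R R' α β α' β' S : ℝ} (hR0 : 0 < R) (hR : R' < R) (hα : α < α') (hα' : α' ≤ β') (hβ : β' < β)
    (hS : ∀ y ∈ Metric.ball x0 R, ∀ t ∈ Icc α β, u y t ≤ S)
    {φ : Eucl n × ℝ → ℝ} (hφ : ContDiff ℝ 2 φ) (h0 : ∀ X, 0 ≤ φ X)
    (hs : ∀ X ∉ Metric.closedBall x0 R' ×ˢ Icc α' β', φ X = 0) :
    ∫ X : Eucl n × ℝ, u X.1 X.2 ^ p * φ X =
      -∫ X : Eucl n × ℝ, u X.1 X.2 * (dt φ X + slap φ X) := by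
  have hKc : IsCompact (Metric.closedBall x0 R' ×ˢ Icc α' β') :=
    (isCompact_closedBall x0 R').prod isCompact_Icc
  have hK := hKc.isClosed
  have hb : ∀ X ∈ Metric.closedBall x0 R' ×ˢ Icc α' β', |u X.1 X.2| ≤ S := fun X hX => by
    rw [abs_of_pos (hu.pos _ _)]
    exact hS _ (Metric.closedBall_subset_ball hR hX.1) _ ⟨by linarith [hX.2.1], by linarith [hX.2.2]⟩
  have hbp : ∀ X ∈ Metric.closedBall x0 R' ×ˢ Icc α' β', |u X.1 X.2 ^ p| ≤ S ^ p := fun X hX => by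
    have := hu.pos X.1 X.2
    rw [abs_of_pos (Real.rpow_pos_of_pos this _)]
    refine Real.rpow_le_rpow this.le ?_ (by linarith)
    simpa [abs_of_pos this] using hb X hX
  have cD : Continuous fun X => dt φ X + slap φ X :=
    (continuous_dt (hφ.of_le (by norm_num))).add (continuous_slap hφ)
  have hcs : HasCompactSupport φ := HasCompactSupport.intro hKc hs
  have i1 : Integrable fun X : Eucl n × ℝ => u X.1 X.2 * (dt φ X + slap φ X) :=
    integrable_mul_of_bdd_on hu.measurable cD hKc hb fun X hX => by
      rw [dt_eq_zero_of_off hK hs _ hX, slap_eq_zero_of_off hK hs _ hX, add_zero]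
  have i2 : Integrable fun X : Eucl n × ℝ => u X.1 X.2 ^ p * φ X :=
    integrable_mul_of_bdd_on (hu.measurable.pow_const p) hφ.continuous hKc hbp hs
  have iD : Integrable (dt φ) :=
    (continuous_dt (hφ.of_le (by norm_num))).integrable_of_hasCompactSupport hcs.dt
  have iS := integrable_slap hφ hcs
  have iDS : Integrable fun X => S * (dt φ X + slap φ X) := (iD.add iS).const_mul S
  have e0 : ∫ X, S * (dt φ X + slap φ X) = 0 := by
    rw [integral_const_mul, integral_add iD iS, integral_dt_eq_zero (hφ.of_le (by norm_num)) hcs,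
      integral_slap_eq_zero hφ hcs]
    simp
  have le1 := (hu.weakOn hp hR0 hS).integral_nonpos hR hα hα' hβ hφ h0 hs (i1.add i2)
  have e2 : (fun X : Eucl n × ℝ => (S - u X.1 X.2) * (dt φ X + slap φ X) + -(u X.1 X.2 ^ p) * φ X)
      = fun X => S * (dt φ X + slap φ X) -
        (u X.1 X.2 * (dt φ X + slap φ X) + u X.1 X.2 ^ p * φ X) := by
    ext X; ring
  have i12 : Integrable fun X : Eucl n × ℝ =>
      u X.1 X.2 * (dt φ X + slap φ X) + u X.1 X.2 ^ p * φ X := i1.add i2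
  have le2 := (hu.weakOn_const_sub hp hR0 hS).integral_nonpos hR hα hα' hβ hφ h0 hs (by
    rw [e2]; exact iDS.sub i12)
  rw [e2, integral_sub iDS i12, e0, integral_add i1 i2] at le2
  rw [integral_add i1 i2] at le1
  linarith

end SpaceTime

section Cutoff

variable {n : ℕ}

lemma dx_mul {f g : Eucl n × ℝ → ℝ} (hf : Differentiable ℝ f) (hg : Differentiable ℝ g) (i : Fin n)
    (X : Eucl n × ℝ) : dx i (fun Y => f Y * g Y) X = dx i f X * g X + f X * dx i g X := by
  unfold dx
  rw [fderiv_fun_mul (hf X) (hg X)]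
  simp; ring

lemma dx_pow {f : Eucl n × ℝ → ℝ} (hf : Differentiable ℝ f) (m : ℕ) (i : Fin n)
    (X : Eucl n × ℝ) : dx i (fun Y => f Y ^ m) X = m * f X ^ (m - 1) * dx i f X := by
  unfold dx
  rw [fderiv_fun_pow m (hf X)]
  simp

lemma dt_pow {f : Eucl n × ℝ → ℝ} (hf : Differentiable ℝ f) (m : ℕ)
    (X : Eucl n × ℝ) : dt (fun Y => f Y ^ m) X = m * f X ^ (m - 1) * dt f X := by
  unfold dt
  rw [fderiv_fun_pow m (hf X)]
  simp

lemma dx_const_mul {f : Eucl n × ℝ → ℝ} (hf : Differentiable ℝ f) (c : ℝ) (i : Fin n)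
    (X : Eucl n × ℝ) : dx i (fun Y => c * f Y) X = c * dx i f X := by
  unfold dx
  rw [fderiv_const_mul (hf X)]
  simp

/-- Anisotropic dilation of space-time. -/
noncomputable def dil (a b : ℝ) : Eucl n × ℝ →L[ℝ] Eucl n × ℝ :=
  (a • ContinuousLinearMap.fst ℝ (Eucl n) ℝ).prod (b • ContinuousLinearMap.snd ℝ (Eucl n) ℝ)

lemma dil_apply (a b : ℝ) (X : Eucl n × ℝ) : dil a b X = (a • X.1, b * X.2) := rfl

lemma dx_dil {f : Eucl n × ℝ → ℝ} (hf : Differentiable ℝ f) (a b : ℝ) (i : Fin n)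
    (X : Eucl n × ℝ) : dx i (fun Y => f (dil a b Y)) X = a * dx i f (dil a b X) := by
  have h : HasFDerivAt (fun Y => f (dil a b Y)) _ X :=
    (hf (dil a b X)).hasFDerivAt.comp X (dil a b).hasFDerivAt
  unfold dx
  rw [h.fderiv]
  have : dil a b ((EuclideanSpace.single i 1, 0) : Eucl n × ℝ)
      = a • ((EuclideanSpace.single i 1, 0) : Eucl n × ℝ) := by simp [dil_apply]
  rw [ContinuousLinearMap.comp_apply, this, map_smul, smul_eq_mul]

lemma dt_dil {f : Eucl n × ℝ → ℝ} (hf : Differentiable ℝ f) (a b : ℝ)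
    (X : Eucl n × ℝ) : dt (fun Y => f (dil a b Y)) X = b * dt f (dil a b X) := by
  have h : HasFDerivAt (fun Y => f (dil a b Y)) _ X :=
    (hf (dil a b X)).hasFDerivAt.comp X (dil a b).hasFDerivAt
  unfold dt
  rw [h.fderiv]
  have : dil a b ((0, 1) : Eucl n × ℝ) = b • ((0, 1) : Eucl n × ℝ) := by simp [dil_apply]
  rw [ContinuousLinearMap.comp_apply, this, map_smul, smul_eq_mul]

lemma slap_dil {f : Eucl n × ℝ → ℝ} (hf : ContDiff ℝ 2 f) (a b : ℝ)
    (X : Eucl n × ℝ) : slap (fun Y => f (dil a b Y)) X = a ^ 2 * slap f (dil a b X) := by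
  unfold slap
  rw [Finset.mul_sum]
  refine Finset.sum_congr rfl fun i _ => ?_
  have h1 : Differentiable ℝ f := hf.differentiable (by norm_num)
  have h2 : ContDiff ℝ 1 (dx i f) := contDiff_dx hf (by norm_num) i
  have h3 : Differentiable ℝ (dx i f) := h2.differentiable (by norm_num)
  have e : dx i (fun Y => f (dil a b Y)) = fun Y => a * dx i f (dil a b Y) :=
    funext fun Y => dx_dil h1 a b i Y
  have h4 : Differentiable ℝ fun Y => dx i f (dil a b Y) := h3.comp (dil a b).differentiable
  rw [e, dx_const_mul h4, dx_dil h3]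
  ring

lemma integral_dil (f : Eucl n × ℝ → ℝ) {a b : ℝ} (ha : 0 < a) (hb : 0 < b) :
    ∫ X, f (dil a b X) = (a ^ n * b)⁻¹ * ∫ X, f X := by
  have hdet : ((dil a b : Eucl n × ℝ →L[ℝ] Eucl n × ℝ) : Eucl n × ℝ →ₗ[ℝ] Eucl n × ℝ).det = a ^ n * b := by
    have : ((dil a b : Eucl n × ℝ →L[ℝ] Eucl n × ℝ) : Eucl n × ℝ →ₗ[ℝ] Eucl n × ℝ)
        = (a • LinearMap.id).prodMap (b • LinearMap.id) := by
      ext <;> simp [dil_apply]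
    rw [this, LinearMap.det_prodMap]
    simp
  have hne : ((dil a b : Eucl n × ℝ →L[ℝ] Eucl n × ℝ) : Eucl n × ℝ →ₗ[ℝ] Eucl n × ℝ).det ≠ 0 := by rw [hdet]; positivity
  have hmap := Measure.map_linearMap_addHaar_eq_smul_addHaar (μ := volume) hne
  have hinj : Function.Injective (dil a b : Eucl n × ℝ → Eucl n × ℝ) := by
    intro X Y h
    simp only [dil_apply, Prod.mk.injEq] at h
    exact Prod.ext (smul_right_injective _ ha.ne' h.1) (mul_left_cancel₀ hb.ne' h.2)
  have hemb : MeasurableEmbedding (dil a b : Eucl n × ℝ → Eucl n × ℝ) :=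
    (dil a b).continuous.measurableEmbedding hinj
  have := hemb.integral_map (μ := volume) f
  rw [← this]
  have h2 : Measure.map (dil a b : Eucl n × ℝ → Eucl n × ℝ) volume
      = ENNReal.ofReal |(((dil a b : Eucl n × ℝ →L[ℝ] Eucl n × ℝ) : Eucl n × ℝ →ₗ[ℝ] Eucl n × ℝ).det)⁻¹| • volume := hmap
  rw [h2, integral_smul_measure, hdet, ENNReal.toReal_ofReal (abs_nonneg _),
    abs_of_pos (by positivity), smul_eq_mul]

/-- A cutoff function on the unit cylinder whose derivatives are controlled by its powers. -/
structure IsCutoff (p C : ℝ) (η : Eucl n × ℝ → ℝ) : Prop where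
  contDiff : ContDiff ℝ 2 η
  nonneg : ∀ X, 0 ≤ η X
  le_one : ∀ X, η X ≤ 1
  eq_one : ∀ X ∈ Metric.closedBall (0 : Eucl n) (1 / 2) ×ˢ Icc (-(1 / 2)) (1 / 2 : ℝ), η X = 1
  eq_zero : ∀ X ∉ Metric.closedBall (0 : Eucl n) 1 ×ˢ Icc (-1) (1 : ℝ), η X = 0
  dt_le : ∀ X, |dt η X| ≤ C * η X ^ (1 / p)
  slap_le : ∀ X, |slap η X| ≤ C * η X ^ (1 / p)
  grad_le : ∀ X, ∑ i, dx i η X ^ 2 ≤ C * η X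

lemma exists_isCutoff (n : ℕ) {p : ℝ} (hp : 1 < p) :
    ∃ C ≥ 0, ∃ η : Eucl n × ℝ → ℝ, IsCutoff p C η := by
  let b : ContDiffBump (0 : Eucl n × ℝ) := ⟨1 / 2, 1, by norm_num, by norm_num⟩
  have hb : ContDiff ℝ 2 b := b.contDiff
  have hbc : HasCompactSupport b := b.hasCompactSupport
  have hd : Differentiable ℝ b := hb.differentiable (by norm_num)
  obtain ⟨m, hm⟩ := exists_nat_gt (2 + 2 * p / (p - 1))
  have hp1 : 0 < p - 1 := by linarith
  have hpp : 0 < 2 * p / (p - 1) := by positivity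
  have hm2 : 2 ≤ m := by have : (2 : ℝ) < m := by linarith
                         exact_mod_cast this.le
  have hmp : (m : ℝ) / p ≤ (m : ℝ) - 2 := by
    have h1 : 2 * p / (p - 1) < m := by linarith
    rw [div_lt_iff₀ hp1] at h1
    rw [div_le_iff₀ (by linarith)]
    nlinarith
  obtain ⟨A, hA⟩ : ∃ A : ℝ, ∀ X, |dt b X| ≤ A := by
    obtain ⟨A, hA⟩ := (HasCompactSupport.dt hbc).exists_bound_of_continuous
      (continuous_dt (hb.of_le (by norm_num)))
    exact ⟨A, hA⟩
  obtain ⟨B, hB⟩ : ∃ B : ℝ, ∀ X, |∑ i, dx i b X ^ 2| ≤ B := by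
    have hc : Continuous fun X => ∑ i, dx i b X ^ 2 := continuous_finsetSum _ fun i _ =>
      (continuous_dx (hb.of_le (by norm_num)) i).pow 2
    have : HasCompactSupport fun X => ∑ i, dx i b X ^ 2 := by
      refine HasCompactSupport.intro hbc.isCompact fun X hX => ?_
      refine Finset.sum_eq_zero fun i _ => ?_
      rw [dx_eq_zero_of_off (isClosed_tsupport b)
        (fun Y hY => image_eq_zero_of_notMem_tsupport hY) i X hX]; simp
    obtain ⟨A, hA⟩ := this.exists_bound_of_continuous hc
    exact ⟨A, hA⟩
  obtain ⟨D, hD⟩ : ∃ D : ℝ, ∀ X, |slap b X| ≤ D := by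
    have : HasCompactSupport (slap b) := by
      refine HasCompactSupport.intro hbc.isCompact fun X hX => ?_
      exact slap_eq_zero_of_off (isClosed_tsupport b)
        (fun Y hY => image_eq_zero_of_notMem_tsupport hY) X hX
    obtain ⟨A, hA⟩ := this.exists_bound_of_continuous (continuous_slap hb)
    exact ⟨A, hA⟩
  have hA0 : 0 ≤ A := (abs_nonneg _).trans (hA 0)
  have hB0 : 0 ≤ B := (abs_nonneg _).trans (hB 0)
  have hD0 : 0 ≤ D := (abs_nonneg _).trans (hD 0)
  have b0 : ∀ X, 0 ≤ b X := fun X => b.nonneg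
  have b1 : ∀ X, b X ≤ 1 := fun X => b.le_one
  have hpow : ∀ X, b X ^ (m - 2) ≤ (b X ^ m) ^ (1 / p) := by
    intro X
    rcases (b0 X).eq_or_lt with h | h
    · rw [← h, zero_pow (by omega : m ≠ 0)]
      rcases Nat.eq_or_lt_of_le hm2 with h2 | h2
      · exfalso
        rw [← h2] at hmp
        have h3 : (0 : ℝ) < ((2 : ℕ) : ℝ) / p := by
          have : 0 < p := by linarith
          positivity
        have h4 : ((2 : ℕ) : ℝ) - 2 = 0 := by norm_num
        linarith
      · rw [zero_pow (by omega), Real.zero_rpow (by positivity)]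
    · rw [← Real.rpow_natCast (b X) m, ← Real.rpow_mul h.le, ← Real.rpow_natCast]
      apply Real.rpow_le_rpow_of_exponent_ge h (b1 X)
      rw [Nat.cast_sub hm2]
      have : (m : ℝ) * (1 / p) = m / p := by ring
      rw [this]; exact_mod_cast hmp
  have hpow1 : ∀ X, b X ^ (m - 1) ≤ (b X ^ m) ^ (1 / p) := fun X =>
    (pow_le_pow_of_le_one (b0 X) (b1 X) (by omega)).trans (hpow X)
  have hm0 : (0 : ℝ) ≤ m := Nat.cast_nonneg m
  have hdx : ∀ i, dx i (fun X => b X ^ m) = fun X => m * b X ^ (m - 1) * dx i b X := fun i =>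
    funext fun X => dx_pow hd m i X
  have hslap : ∀ X, slap (fun X => b X ^ m) X
      = (m * (m - 1 : ℕ)) * b X ^ (m - 2) * ∑ i, dx i b X ^ 2 + m * b X ^ (m - 1) * slap b X := by
    intro X
    unfold slap
    rw [Finset.mul_sum, Finset.mul_sum, ← Finset.sum_add_distrib]
    refine Finset.sum_congr rfl fun i _ => ?_
    have h2 : ContDiff ℝ 1 (dx i b) := contDiff_dx hb (by norm_num) i
    have h5 : Differentiable ℝ fun X => b X ^ (m - 1) := hd.pow (m - 1)
    have h6 : Differentiable ℝ fun X => (m : ℝ) * b X ^ (m - 1) := h5.const_mul _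
    rw [hdx, dx_mul h6 (h2.differentiable (by norm_num)), dx_const_mul h5, dx_pow hd]
    rw [show m - 1 - 1 = m - 2 by omega]
    ring
  set C := m * A + m * (m - 1 : ℕ) * B + m * D + m ^ 2 * B with hC
  have hC1 : 0 ≤ m * A := by positivity
  have hC2 : 0 ≤ m * (m - 1 : ℕ) * B := by positivity
  have hC3 : 0 ≤ m * D := by positivity
  have hC4 : 0 ≤ m ^ 2 * B := by positivity
  refine ⟨C, by positivity, fun X => b X ^ m, hb.pow m, fun X => pow_nonneg (b0 X) m,
    fun X => pow_le_one₀ (b0 X) (b1 X), ?_, ?_, ?_, ?_, ?_⟩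
  · rintro ⟨y, s⟩ ⟨hy, hs⟩
    have : b (y, s) = 1 := by
      apply b.one_of_mem_closedBall
      have : (y, s) ∈ Metric.closedBall ((0 : Eucl n), (0 : ℝ)) (1 / 2) := by
        rw [← closedBall_prod_same, Real.closedBall_eq_Icc]
        exact ⟨hy, by simpa using hs⟩
      exact this
    simp [this]
  · rintro ⟨y, s⟩ h
    have : b (y, s) = 0 := by
      apply b.zero_of_le_dist
      by_contra hlt
      push Not at hlt
      apply h
      have : (y, s) ∈ Metric.closedBall ((0 : Eucl n), (0 : ℝ)) 1 := hlt.le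
      rw [← closedBall_prod_same, Real.closedBall_eq_Icc] at this
      simpa using this
    show b (y, s) ^ m = 0
    rw [this, zero_pow (by omega)]
  · intro X
    have hX := b0 X
    rw [dt_pow hd, abs_mul, abs_mul, abs_of_nonneg hm0, abs_of_nonneg (pow_nonneg (b0 X) _)]
    calc m * b X ^ (m - 1) * |dt b X| ≤ m * (b X ^ m) ^ (1 / p) * A := by
          gcongr
          · exact hpow1 X
          · exact hA X
      _ = m * A * (b X ^ m) ^ (1 / p) := by ring
      _ ≤ C * (b X ^ m) ^ (1 / p) := by
          apply mul_le_mul_of_nonneg_right _ (Real.rpow_nonneg (pow_nonneg (b0 X) _) _)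
          linarith
  · intro X
    have hX := b0 X
    have n1 : 0 ≤ (m : ℝ) * (m - 1 : ℕ) * b X ^ (m - 2) := by positivity
    have n2 : 0 ≤ (m : ℝ) * b X ^ (m - 1) := by positivity
    rw [hslap]
    calc _ ≤ |m * (m - 1 : ℕ) * b X ^ (m - 2) * ∑ i, dx i b X ^ 2|
          + |m * b X ^ (m - 1) * slap b X| := abs_add_le _ _
      _ = m * (m - 1 : ℕ) * b X ^ (m - 2) * |∑ i, dx i b X ^ 2|
          + m * b X ^ (m - 1) * |slap b X| := by
          rw [abs_mul, abs_mul (_ * _) (slap b X), abs_of_nonneg n1, abs_of_nonneg n2]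
      _ ≤ m * (m - 1 : ℕ) * (b X ^ m) ^ (1 / p) * B + m * (b X ^ m) ^ (1 / p) * D := by
          gcongr
          · exact hpow X
          · exact hB X
          · exact hpow1 X
          · exact hD X
      _ = (m * (m - 1 : ℕ) * B + m * D) * (b X ^ m) ^ (1 / p) := by ring
      _ ≤ C * (b X ^ m) ^ (1 / p) := by
          apply mul_le_mul_of_nonneg_right _ (Real.rpow_nonneg (pow_nonneg (b0 X) _) _)
          linarith
  · intro X
    simp only [hdx]
    have e : ∑ i, (m * b X ^ (m - 1) * dx i b X) ^ 2
        = m ^ 2 * (b X ^ (m - 1)) ^ 2 * ∑ i, dx i b X ^ 2 := by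
      rw [Finset.mul_sum]
      exact Finset.sum_congr rfl fun i _ => by ring
    rw [e]
    calc _ ≤ m ^ 2 * b X ^ m * B := by
          have h1 : (b X ^ (m - 1)) ^ 2 ≤ b X ^ m := by
            rw [← pow_mul]; exact pow_le_pow_of_le_one (b0 X) (b1 X) (by omega)
          have := (le_abs_self _).trans (hB X)
          have h2 := pow_nonneg (b0 X) m
          have h3 : 0 ≤ ∑ i, dx i b X ^ 2 := Finset.sum_nonneg fun i _ => sq_nonneg _
          gcongr
      _ = m ^ 2 * B * b X ^ m := by ring
      _ ≤ C * b X ^ m := by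
          apply mul_le_mul_of_nonneg_right _ (pow_nonneg (b0 X) _)
          linarith

end Cutoff

section Energy

variable {n : ℕ}

lemma dx_dt_comm {V : Eucl n × ℝ → ℝ} (hV : ContDiff ℝ 2 V) (i : Fin n) (X : Eucl n × ℝ) :
    dx i (dt V) X = dt (dx i V) X := by
  have hs : IsSymmSndFDerivAt ℝ V X :=
    hV.contDiffAt.isSymmSndFDerivAt (by rw [minSmoothness_of_isRCLikeNormedField])
  have hd : DifferentiableAt ℝ (fderiv ℝ V) X :=
    (hV.fderiv_right (m := 1) (by norm_num)).differentiable (by norm_num) X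
  have key : ∀ v w : Eucl n × ℝ, fderiv ℝ (fun Y => fderiv ℝ V Y v) X w
      = fderiv ℝ (fderiv ℝ V) X w v := by
    intro v w
    rw [fderiv_clm_apply hd (differentiableAt_const v)]
    simp
  unfold dx dt
  rw [key, key]
  exact hs _ _

/-- The local energy inequality for a perturbed nonlinear heat equation, with cutoffs `φ ≤ Φ`. -/
lemma energy_inequality {V F φ Φ : Eucl n × ℝ → ℝ} {p C : ℝ} {K L : Set (Eucl n × ℝ)}
    (hp : 1 < p) (hC : 0 ≤ C) (hV : ContDiff ℝ 2 V) (hV0 : ∀ X, 0 ≤ V X) (hF : Continuous F)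
    (hφ : ContDiff ℝ 2 φ) (hφ0 : ∀ X, 0 ≤ φ X) (hΦ : ContDiff ℝ 2 Φ) (hΦ0 : ∀ X, 0 ≤ Φ X)
    (hK : IsClosed K) (hL : IsCompact L) (hφK : ∀ X ∉ K, φ X = 0) (hΦK : ∀ X ∈ K, Φ X = 1)
    (hΦL : ∀ X ∉ L, Φ X = 0) (hdt : ∀ X, |dt φ X| ≤ C)
    (hgrad : ∀ X, ∑ i, dx i φ X ^ 2 ≤ C * φ X)
    (heq : ∀ X, Φ X ≠ 0 → dt V X = slap V X + F X) :
    1 / 2 * ∫ X, dt V X ^ 2 * φ X ≤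
      ∫ X, (2 * C * (V X * F X * Φ X + 1 / 2 * V X ^ 2 * (dt Φ X + slap Φ X))
        + C * (V X ^ (p + 1) * Φ X) + (F X - V X ^ p) ^ 2 * φ X) := by
  have hφL : ∀ X ∉ L, φ X = 0 := fun X hX => by
    by_contra h
    have hXK : X ∈ K := by by_contra h2; exact h (hφK X h2)
    have := hΦK X hXK
    rw [hΦL X hX] at this; norm_num at this
  have dV : Differentiable ℝ V := hV.differentiable (by norm_num)
  have dφ : Differentiable ℝ φ := hφ.differentiable (by norm_num)
  have dΦ : Differentiable ℝ Φ := hΦ.differentiable (by norm_num)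
  have cdtV : ContDiff ℝ 1 (dt V) := contDiff_dt hV (by norm_num)
  have cdxV : ∀ i, ContDiff ℝ 1 (dx i V) := fun i => contDiff_dx hV (by norm_num) i
  have cdxΦ : ∀ i, ContDiff ℝ 1 (dx i Φ) := fun i => contDiff_dx hΦ (by norm_num) i
  have hV1 : ContDiff ℝ 1 V := hV.of_le (by norm_num)
  have hφ1 : ContDiff ℝ 1 φ := hφ.of_le (by norm_num)
  have hΦ1 : ContDiff ℝ 1 Φ := hΦ.of_le (by norm_num)
  have cVp : ContDiff ℝ 1 fun X => V X ^ (p + 1) :=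
    (Real.contDiff_rpow_const_of_le (by norm_num; linarith)).comp hV1
  -- the divergence terms
  let G : Fin n → Eucl n × ℝ → ℝ := fun i X =>
    dt V X * dx i V X * φ X + 2 * C * (V X * dx i V X * Φ X - 1 / 2 * (V X * V X) * dx i Φ X)
  let H : Eucl n × ℝ → ℝ := fun X =>
    (-(1 / 2)) * ((∑ i, dx i V X * dx i V X) * φ X) + 1 / (p + 1) * (V X ^ (p + 1) * φ X)
      - 2 * C * (1 / 2) * (V X * V X * Φ X)
  have hG : ∀ i, ContDiff ℝ 1 (G i) := fun i =>
    ((cdtV.mul (cdxV i)).mul hφ1).add (contDiff_const.mul (((hV1.mul (cdxV i)).mul hΦ1).sub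
      ((contDiff_const.mul (hV1.mul hV1)).mul (cdxΦ i))))
  have cgr : ContDiff ℝ 1 fun X => ∑ i, dx i V X * dx i V X :=
    ContDiff.sum fun i _ => (cdxV i).mul (cdxV i)
  have hH : ContDiff ℝ 1 H :=
    ((contDiff_const.mul (cgr.mul hφ1)).add (contDiff_const.mul (cVp.mul hφ1))).sub
      (contDiff_const.mul ((hV1.mul hV1).mul hΦ1))
  have hdxΦL := fun i => dx_eq_zero_of_off hL.isClosed hΦL i
  have hGc : ∀ i, HasCompactSupport (G i) := fun i =>
    HasCompactSupport.intro hL fun X hX => by simp [G, hφL X hX, hΦL X hX, hdxΦL i X hX]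
  have hHc : HasCompactSupport H :=
    HasCompactSupport.intro hL fun X hX => by simp [H, hφL X hX, hΦL X hX]
  have iG : ∀ i, Integrable (dx i (G i)) := fun i =>
    (continuous_dx (hG i) i).integrable_of_hasCompactSupport ((hGc i).dx i)
  have iH : Integrable (dt H) :=
    (continuous_dt hH).integrable_of_hasCompactSupport hHc.dt
  have iJ : Integrable fun X => ∑ i, dx i (G i) X + dt H X :=
    (integrable_finsetSum _ fun i _ => iG i).add iH
  have hJ : ∫ X, (∑ i, dx i (G i) X + dt H X) = 0 := by
    rw [integral_add (integrable_finsetSum _ fun i _ => iG i) iH,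
      integral_finsetSum _ fun i _ => iG i, integral_dt_eq_zero hH hHc,
      Finset.sum_eq_zero fun i _ => integral_dx_eq_zero (hG i) (hGc i) i, add_zero]
  have eG : ∀ i X, dx i (G i) X = dx i (dt V) X * dx i V X * φ X + dt V X * dx i (dx i V) X * φ X
      + dt V X * dx i V X * dx i φ X + 2 * C * (dx i V X ^ 2 * Φ X + V X * dx i (dx i V) X * Φ X
      - 1 / 2 * V X ^ 2 * dx i (dx i Φ) X) := by
    intro i X
    have d1 : Differentiable ℝ (dt V) := cdtV.differentiable (by norm_num)
    have d2 : Differentiable ℝ (dx i V) := (cdxV i).differentiable (by norm_num)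
    have d3 : Differentiable ℝ (dx i Φ) := (cdxΦ i).differentiable (by norm_num)
    have ex : ∀ f : Eucl n × ℝ → ℝ, fderiv ℝ f X (EuclideanSpace.single i 1, 0) = dx i f X :=
      fun _ => rfl
    have h1 := (dV X).hasFDerivAt
    have h2 := (d1 X).hasFDerivAt
    have h3 := (d2 X).hasFDerivAt
    have h4 := (d3 X).hasFDerivAt
    have h5 := (dφ X).hasFDerivAt
    have h6 := (dΦ X).hasFDerivAt
    have h7 := ((h2.mul h3).mul h5).add ((((h1.mul h3).mul h6).sub
      (((h1.mul h1).const_mul (1 / 2)).mul h4)).const_mul (2 * C))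
    have h8 : HasFDerivAt (G i) _ X := h7
    rw [← ex (G i), h8.fderiv]
    simp
    simp only [ex]
    ring
  have eH : ∀ X, dt H X = -(∑ i, dt (dx i V) X * dx i V X) * φ X
      - 1 / 2 * (∑ i, dx i V X ^ 2) * dt φ X + V X ^ p * dt V X * φ X
      + 1 / (p + 1) * V X ^ (p + 1) * dt φ X - C * (2 * V X * dt V X * Φ X + V X ^ 2 * dt Φ X) := by
    intro X
    have d2 : ∀ i, Differentiable ℝ (dx i V) := fun i => (cdxV i).differentiable (by norm_num)
    have h2 : HasFDerivAt (fun X => ∑ i, dx i V X * dx i V X)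
        (∑ i, (dx i V X • fderiv ℝ (dx i V) X + dx i V X • fderiv ℝ (dx i V) X)) X :=
      HasFDerivAt.fun_sum fun i _ => (d2 i X).hasFDerivAt.mul (d2 i X).hasFDerivAt
    have h3 : HasFDerivAt (fun Y => V Y ^ (p + 1)) _ X :=
      (Real.hasDerivAt_rpow_const (Or.inr (by linarith : 1 ≤ p + 1))).comp_hasFDerivAt X
        (dV X).hasFDerivAt
    have h1 := (dV X).hasFDerivAt
    have h5 := (dφ X).hasFDerivAt
    have h6 := (dΦ X).hasFDerivAt
    have h7 := (((h2.mul h5).const_mul (-(1 / 2))).add ((h3.mul h5).const_mul (1 / (p + 1)))).sub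
      (((h1.mul h1).mul h6).const_mul (2 * C * (1 / 2)))
    have h8 : HasFDerivAt H _ X := h7
    have hp1 : p + 1 ≠ 0 := by linarith
    have e1 : ∑ i, dt (dx i V) X * dx i V X = ∑ i, dx i V X * dt (dx i V) X :=
      Finset.sum_congr rfl fun i _ => mul_comm _ _
    have e2 : ∑ i, dx i V X * dx i V X = ∑ i, dx i V X ^ 2 :=
      Finset.sum_congr rfl fun i _ => (sq _).symm
    rw [e1, ← e2]
    have et : ∀ f : Eucl n × ℝ → ℝ, fderiv ℝ f X (0, 1) = dt f X := fun _ => rfl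
    rw [← et H, h8.fderiv]
    simp [Finset.sum_add_distrib]
    simp only [et]
    field_simp
    ring
  have hpt : ∀ X, 1 / 2 * (dt V X ^ 2 * φ X) ≤ (∑ i, dx i (G i) X + dt H X)
      + (2 * C * (V X * F X * Φ X + 1 / 2 * V X ^ 2 * (dt Φ X + slap Φ X))
        + C * (V X ^ (p + 1) * Φ X) + (F X - V X ^ p) ^ 2 * φ X) := by
    intro X
    have sG : ∑ i, dx i (G i) X = (∑ i, dt (dx i V) X * dx i V X) * φ X + dt V X * slap V X * φ X
      + dt V X * (∑ i, dx i V X * dx i φ X) + 2 * C * ((∑ i, dx i V X ^ 2) * Φ X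
      + V X * slap V X * Φ X - 1 / 2 * V X ^ 2 * slap Φ X) := by
      simp only [eG, dx_dt_comm hV, slap, Finset.mul_sum, Finset.sum_mul, Finset.sum_add_distrib,
        Finset.sum_sub_distrib, mul_add, mul_sub]
      simp only [mul_assoc]
    rw [sG, eH]
    have hg0 : 0 ≤ ∑ i, dx i V X ^ 2 := Finset.sum_nonneg fun i _ => sq_nonneg _
    have hcs : (∑ i, dx i V X * dx i φ X) ^ 2 ≤ (∑ i, dx i V X ^ 2) * (∑ i, dx i φ X ^ 2) :=
      Finset.sum_mul_sq_le_sq_mul_sq _ _ _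
    have hVp : 0 ≤ V X ^ (p + 1) := Real.rpow_nonneg (hV0 X) _
    set A := ∑ i, dx i V X ^ 2
    set S := ∑ i, dx i V X * dx i φ X
    set B := ∑ i, dt (dx i V) X * dx i V X
    set P := V X ^ (p + 1)
    have hE : dt V X * (dt V X - slap V X - F X) * φ X = 0 := by
      rcases (hφ0 X).eq_or_lt with h | h
      · rw [← h]; ring
      · have : X ∈ K := by by_contra h2; exact h.ne' (hφK X h2)
        rw [heq X (by rw [hΦK X this]; norm_num)]; ring
    have hE2 : V X * (dt V X - slap V X - F X) * Φ X = 0 := by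
      by_cases h : Φ X = 0
      · rw [h]; ring
      · rw [heq X h]; ring
    have b1 : 1 / 2 * A * dt φ X ≤ 1 / 2 * C * (A * Φ X) ∧
        -(1 / (p + 1) * P * dt φ X) ≤ C * (P * Φ X) ∧
        -(dt V X * S) ≤ 1 / 4 * (dt V X ^ 2 * φ X) + C * (A * Φ X) := by
      by_cases hX : X ∈ K
      · rw [hΦK X hX]
        have h1 := abs_le.1 (hdt X)
        refine ⟨by nlinarith, ?_, ?_⟩
        · have h3 : 1 / (p + 1) ≤ 1 := by rw [div_le_one (by linarith)]; linarith
          have h4 : 0 ≤ 1 / (p + 1) := by have : 0 < p + 1 := by linarith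
                                          positivity
          have h5 : -(P * dt φ X) ≤ P * C := by nlinarith
          calc -(1 / (p + 1) * P * dt φ X) = 1 / (p + 1) * -(P * dt φ X) := by ring
            _ ≤ 1 / (p + 1) * (P * C) := by gcongr
            _ ≤ 1 * (P * C) := by gcongr
            _ = _ := by ring
        · have h3 : S ^ 2 ≤ A * (C * φ X) :=
            hcs.trans (mul_le_mul_of_nonneg_left (hgrad X) hg0)
          rcases (hφ0 X).eq_or_lt with h | h
          · rw [← h] at h3 ⊢
            have : S = 0 := by nlinarith [sq_nonneg S]
            rw [this]; nlinarith [mul_nonneg hC hg0]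
          · have h4 : S ^ 2 / φ X ≤ A * C := by
              rw [div_le_iff₀ h]; linarith
            have h5 : -(dt V X * S) ≤ 1 / 4 * (dt V X ^ 2 * φ X) + S ^ 2 / φ X := by
              have : 0 ≤ (1 / 2 * dt V X * φ X + S) ^ 2 / φ X := by positivity
              have e : (1 / 2 * dt V X * φ X + S) ^ 2 / φ X
                  = 1 / 4 * (dt V X ^ 2 * φ X) + dt V X * S + S ^ 2 / φ X := by
                field_simp; ring
              linarith
            linarith
      · have hz : dt φ X = 0 := dt_eq_zero_of_off hK hφK X hX
        have hz2 : S = 0 := Finset.sum_eq_zero fun i _ => by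
          rw [dx_eq_zero_of_off hK hφK i X hX, mul_zero]
        have h1 := mul_nonneg hC (mul_nonneg hg0 (hΦ0 X))
        have h2 := mul_nonneg hC (mul_nonneg hVp (hΦ0 X))
        rw [hz, hz2, hφK X hX]
        refine ⟨by nlinarith, by linarith, by linarith⟩
    obtain ⟨b1, b2, b3⟩ := b1
    have b4 : dt V X * (F X - V X ^ p) * φ X
        ≤ 1 / 4 * (dt V X ^ 2 * φ X) + (F X - V X ^ p) ^ 2 * φ X := by
      nlinarith [mul_nonneg (hφ0 X) (sq_nonneg (1 / 2 * dt V X - (F X - V X ^ p)))]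
    have b5 : 0 ≤ C * (A * Φ X) := mul_nonneg hC (mul_nonneg hg0 (hΦ0 X))
    linear_combination b1 + b2 + b3 + b4 + 1 / 2 * b5 + hE + 2 * C * hE2
  have cVp0 : Continuous fun X => V X ^ p :=
    hV.continuous.rpow_const fun X => Or.inr (by linarith)
  have iR : Integrable fun X => 2 * C * (V X * F X * Φ X + 1 / 2 * V X ^ 2 * (dt Φ X + slap Φ X))
        + C * (V X ^ (p + 1) * Φ X) + (F X - V X ^ p) ^ 2 * φ X := by
    refine Continuous.integrable_of_hasCompactSupport ?_ (HasCompactSupport.intro hL fun X hX => ?_)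
    · have c1 := hV.continuous
      have c2 := hΦ.continuous
      have c3 := hφ.continuous
      have c4 := continuous_dt hΦ1
      have c5 := continuous_slap hΦ
      have c6 := cVp.continuous
      fun_prop
    · simp [hφL X hX, hΦL X hX, dt_eq_zero_of_off hL.isClosed hΦL X hX,
        slap_eq_zero_of_off hL.isClosed hΦL X hX]
  have iL : Integrable fun X => 1 / 2 * (dt V X ^ 2 * φ X) := by
    refine Continuous.integrable_of_hasCompactSupport ?_ (HasCompactSupport.intro hL fun X hX => ?_)
    · have c3 := hφ.continuous
      have c4 := continuous_dt hV1
      fun_prop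
    · simp [hφL X hX]
  have := integral_mono iL (iJ.add iR) hpt
  rw [integral_const_mul] at this
  refine this.trans (le_of_eq ?_)
  have e := integral_add iJ iR
  rw [hJ, zero_add] at e
  exact e

end Energy

section Mollify

variable {n : ℕ}

/-- Scalar convolution on space-time. -/
noncomputable def conv (f g : Eucl n × ℝ → ℝ) (X : Eucl n × ℝ) : ℝ := ∫ Y, f (X - Y) * g Y

lemma conv_eq_convolution (f g : Eucl n × ℝ → ℝ) :
    conv f g = convolution f g (ContinuousLinearMap.lsmul ℝ ℝ) volume := by
  ext X
  rw [convolution_lsmul_swap]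
  rfl

lemma contDiff_conv {f g : Eucl n × ℝ → ℝ} (hf : ContDiff ℝ 2 f) (hc : HasCompactSupport f)
    (hg : LocallyIntegrable g) : ContDiff ℝ 2 (conv f g) := by
  rw [conv_eq_convolution]
  exact hc.contDiff_convolution_left _ hf hg

lemma continuous_conv {f g : Eucl n × ℝ → ℝ} (hf : Continuous f) (hc : HasCompactSupport f)
    (hg : LocallyIntegrable g) : Continuous (conv f g) := by
  rw [conv_eq_convolution]
  exact hc.continuous_convolution_left _ hf hg

lemma fderiv_conv {f g : Eucl n × ℝ → ℝ} (hf : ContDiff ℝ 1 f) (hc : HasCompactSupport f)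
    (hg : LocallyIntegrable g) (X v : Eucl n × ℝ) :
    fderiv ℝ (conv f g) X v = conv (fun Y => fderiv ℝ f Y v) g X := by
  rw [conv_eq_convolution, (hc.hasFDerivAt_convolution_left _ hf hg X).fderiv]
  have hex : ConvolutionExistsAt (fderiv ℝ f) g X
      ((ContinuousLinearMap.lsmul ℝ ℝ).precompL (Eucl n × ℝ)) volume :=
    (hc.fderiv ℝ).convolutionExists_left _ (hf.continuous_fderiv (by norm_num)) hg X
  unfold convolution conv
  rw [ContinuousLinearMap.integral_apply hex]
  rw [← integral_sub_left_eq_self _ volume X]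
  simp

lemma dx_conv {f g : Eucl n × ℝ → ℝ} (hf : ContDiff ℝ 1 f) (hc : HasCompactSupport f)
    (hg : LocallyIntegrable g) (i : Fin n) : dx i (conv f g) = conv (dx i f) g :=
  funext fun X => fderiv_conv hf hc hg X _

lemma dt_conv {f g : Eucl n × ℝ → ℝ} (hf : ContDiff ℝ 1 f) (hc : HasCompactSupport f)
    (hg : LocallyIntegrable g) : dt (conv f g) = conv (dt f) g :=
  funext fun X => fderiv_conv hf hc hg X _

lemma integrable_conv {f g : Eucl n × ℝ → ℝ} (hf : Continuous f) (hc : HasCompactSupport f)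
    (hg : LocallyIntegrable g) (X : Eucl n × ℝ) : Integrable fun Y => f (X - Y) * g Y := by
  have := (hc.convolutionExists_left (ContinuousLinearMap.lsmul ℝ ℝ) hf hg X).integrable_swap
  simpa using this

lemma slap_conv {f g : Eucl n × ℝ → ℝ} (hf : ContDiff ℝ 2 f) (hc : HasCompactSupport f)
    (hg : LocallyIntegrable g) : slap (conv f g) = conv (slap f) g := by
  ext X
  unfold slap
  have h1 : ∀ i, ContDiff ℝ 1 (dx i f) := fun i => contDiff_dx hf (by norm_num) i
  have e : ∀ i, dx i (dx i (conv f g)) X = conv (dx i (dx i f)) g X := fun i => by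
    rw [dx_conv (hf.of_le (by norm_num)) hc hg, dx_conv (h1 i) (hc.dx i) hg]
  simp only [e]
  unfold conv
  rw [← integral_finsetSum _ fun i _ =>
    integrable_conv (continuous_dx (h1 i) i) ((hc.dx i).dx i) hg X]
  simp only [Finset.sum_mul]

lemma fderiv_reflect {f : Eucl n × ℝ → ℝ} (hf : Differentiable ℝ f) (X Y v : Eucl n × ℝ) :
    fderiv ℝ (fun Y => f (X - Y)) Y v = -fderiv ℝ f (X - Y) v := by
  have h : HasFDerivAt (fun Y => f (X - Y)) _ Y :=
    (hf (X - Y)).hasFDerivAt.comp Y ((hasFDerivAt_id Y).const_sub X)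
  rw [h.fderiv]; simp

lemma dt_reflect {f : Eucl n × ℝ → ℝ} (hf : Differentiable ℝ f) (X Y : Eucl n × ℝ) :
    dt (fun Y => f (X - Y)) Y = -dt f (X - Y) := fderiv_reflect hf X Y _

lemma dx_reflect {f : Eucl n × ℝ → ℝ} (hf : Differentiable ℝ f) (i : Fin n) (X Y : Eucl n × ℝ) :
    dx i (fun Y => f (X - Y)) Y = -dx i f (X - Y) := fderiv_reflect hf X Y _

lemma slap_reflect {f : Eucl n × ℝ → ℝ} (hf : ContDiff ℝ 2 f) (X Y : Eucl n × ℝ) :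
    slap (fun Y => f (X - Y)) Y = slap f (X - Y) := by
  unfold slap
  refine Finset.sum_congr rfl fun i _ => ?_
  have h1 : ContDiff ℝ 1 (dx i f) := contDiff_dx hf (by norm_num) i
  have h2 : Differentiable ℝ (dx i f) := h1.differentiable (by norm_num)
  have e : dx i (fun Y => f (X - Y)) = fun Y => (-1) * dx i f (X - Y) := funext fun Y => by
    rw [dx_reflect (hf.differentiable (by norm_num))]; ring
  have h3 : Differentiable ℝ fun Y => dx i f (X - Y) :=
    h2.comp (differentiable_id.const_sub X)
  rw [e, dx_const_mul h3, dx_reflect h2]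
  ring

lemma conv_mem_Icc {f g : Eucl n × ℝ → ℝ} {M : ℝ} (hf : Continuous f) (hc : HasCompactSupport f)
    (hg : LocallyIntegrable g) (hf0 : ∀ X, 0 ≤ f X) (hf1 : ∫ X, f X = 1)
    (hM : ∀ X, g X ∈ Icc 0 M) (X : Eucl n × ℝ) : conv f g X ∈ Icc 0 M := by
  refine ⟨integral_nonneg fun Y => mul_nonneg (hf0 _) (hM Y).1, ?_⟩
  have i1 : Integrable fun Y => f (X - Y) :=
    (hf.integrable_of_hasCompactSupport hc).comp_sub_left X
  calc conv f g X ≤ ∫ Y, f (X - Y) * M :=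
        integral_mono (integrable_conv hf hc hg X) (i1.mul_const M) fun Y =>
          mul_le_mul_of_nonneg_left (hM Y).2 (hf0 _)
    _ = M := by
        rw [integral_mul_const, integral_sub_left_eq_self f volume X, hf1, one_mul]

/-- A standard mollifier sequence. -/
noncomputable def mollBump (n k : ℕ) : ContDiffBump (0 : Eucl n × ℝ) where
  rIn := 1 / (2 * ((k : ℝ) + 2))
  rOut := 1 / ((k : ℝ) + 2)
  rIn_pos := by positivity
  rIn_lt_rOut := by
    have : (0 : ℝ) < k + 2 := by positivity
    apply one_div_lt_one_div_of_lt this; linarith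

/-- The normalized mollifier sequence. -/
noncomputable def moll (n k : ℕ) : Eucl n × ℝ → ℝ := (mollBump n k).normed volume

lemma contDiff_moll (n k : ℕ) : ContDiff ℝ 2 (moll n k) := (mollBump n k).contDiff_normed

lemma hasCompactSupport_moll (n k : ℕ) : HasCompactSupport (moll n k) :=
  (mollBump n k).hasCompactSupport_normed

lemma moll_nonneg (n k : ℕ) (X : Eucl n × ℝ) : 0 ≤ moll n k X := (mollBump n k).nonneg_normed X

lemma integral_moll (n k : ℕ) : ∫ X, moll n k X = 1 := (mollBump n k).integral_normed

lemma moll_eq_zero {k : ℕ} {X : Eucl n × ℝ} (h : 1 < dist X 0) : moll n k X = 0 := by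
  have h2 := (mollBump n k).tsupport_normed_eq (μ := volume)
  apply image_eq_zero_of_notMem_tsupport
  unfold moll
  rw [h2]
  intro h3
  have h4 : dist X 0 ≤ 1 / ((k : ℝ) + 2) := h3
  have : (1 : ℝ) / (k + 2) ≤ 1 := by
    rw [div_le_one (by positivity)]
    have : (0 : ℝ) ≤ k := Nat.cast_nonneg k
    linarith
  linarith

lemma ae_tendsto_conv_moll {g : Eucl n × ℝ → ℝ} (hg : LocallyIntegrable g) :
    ∀ᵐ X, Tendsto (fun k => conv (moll n k) g X) atTop (𝓝 (g X)) := by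
  have h := ContDiffBump.ae_convolution_tendsto_right_of_locallyIntegrable (μ := volume)
    (φ := mollBump n) (l := atTop) (K := 2) (g := g) ?_ ?_ hg
  · filter_upwards [h] with X hX
    simp only [conv_eq_convolution]
    exact hX
  · have : Tendsto (fun k : ℕ => (k : ℝ) + 2) atTop atTop :=
      tendsto_natCast_atTop_atTop.atTop_add tendsto_const_nhds
    exact tendsto_const_nhds.div_atTop this
  · refine Eventually.of_forall fun k => le_of_eq ?_
    show 1 / ((k : ℝ) + 2) = 2 * (1 / (2 * ((k : ℝ) + 2)))
    field_simp

end Mollify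

section SolEnergy

variable {n : ℕ} {p : ℝ}

lemma mul_le_half_rpow_add {a c : ℝ} (hp : 1 < p) (ha : 0 ≤ a) (hc : 0 ≤ c) :
    c * a ≤ 1 / 2 * a ^ p + c * (2 * c) ^ (1 / (p - 1)) := by
  have hp1 : 0 < p - 1 := by linarith
  have h0 : 0 ≤ a ^ p := Real.rpow_nonneg ha p
  rcases le_total a ((2 * c) ^ (1 / (p - 1))) with h | h
  · have := mul_le_mul_of_nonneg_left h hc
    linarith
  · have h1 : 2 * c ≤ a ^ (p - 1) := by
      have := Real.rpow_le_rpow (Real.rpow_nonneg (by positivity) _) h hp1.le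
      rwa [← Real.rpow_mul (by positivity), one_div_mul_cancel hp1.ne', Real.rpow_one] at this
    have h2 : a ^ p = a ^ (p - 1) * a := by
      rcases ha.eq_or_lt with h3 | h3
      · rw [← h3, Real.zero_rpow (by linarith), mul_zero]
      · rw [← Real.rpow_add_one h3.ne']; ring_nf
    have h3 : 0 ≤ c * (2 * c) ^ (1 / (p - 1)) := by positivity
    nlinarith

/-- Absorbing a linear term, with a weight dominated by a power of the cutoff. -/
lemma IsSol.integral_mul_abs_le {u : Eucl n → ℝ → ℝ} (hu : IsSol p u) (hp : 1 < p) {c S : ℝ}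
    (hc : 0 ≤ c) {φ g : Eucl n × ℝ → ℝ} {L : Set (Eucl n × ℝ)} (hL : IsCompact L)
    (hφ : Continuous φ) (hg : Continuous g) (hφ0 : ∀ X, 0 ≤ φ X)
    (hφL : ∀ X ∉ L, φ X = 0) (hgL : ∀ X ∉ L, g X = 0)
    (hS : ∀ X ∈ L, u X.1 X.2 ≤ S) (hgφ : ∀ X, |g X| ≤ c * φ X ^ (1 / p)) :
    ∫ X : Eucl n × ℝ, u X.1 X.2 * |g X| ≤ 1 / 2 * (∫ X : Eucl n × ℝ, u X.1 X.2 ^ p * φ X)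
      + c * (2 * c) ^ (1 / (p - 1)) * (volume L).toReal := by
  have hm := hu.measurable
  have i1 : Integrable fun X : Eucl n × ℝ => u X.1 X.2 * |g X| :=
    integrable_mul_of_bdd_on hm hg.abs hL (S := S)
      (fun X hX => by rw [abs_of_pos (hu.pos _ _)]; exact hS X hX) (fun X hX => by simp [hgL X hX])
  have i2 : Integrable fun X : Eucl n × ℝ => u X.1 X.2 ^ p * φ X :=
    integrable_mul_of_bdd_on (hm.pow_const p) hφ hL (S := S ^ p)
      (fun X hX => by
        rw [abs_of_pos (Real.rpow_pos_of_pos (hu.pos _ _) _)]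
        exact Real.rpow_le_rpow (hu.pos _ _).le (hS X hX) (by linarith)) hφL
  set D := c * (2 * c) ^ (1 / (p - 1)) with hD
  have i3 : Integrable (L.indicator fun _ : Eucl n × ℝ => D) :=
    (integrable_indicator_iff hL.measurableSet).2
      (integrableOn_const hL.measure_lt_top.ne)
  calc ∫ X : Eucl n × ℝ, u X.1 X.2 * |g X|
      ≤ ∫ X : Eucl n × ℝ, (1 / 2 * (u X.1 X.2 ^ p * φ X) + L.indicator (fun _ => D) X) := by
        refine integral_mono i1 ((i2.const_mul _).add i3) fun X => ?_
        have hux := (hu.pos X.1 X.2).le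
        show u X.1 X.2 * |g X| ≤ 1 / 2 * (u X.1 X.2 ^ p * φ X) + L.indicator (fun _ => D) X
        by_cases hX : X ∈ L
        · rw [indicator_of_mem hX]
          have h1 := mul_le_half_rpow_add hp (mul_nonneg hux (Real.rpow_nonneg (hφ0 X) (1 / p))) hc
          rw [Real.mul_rpow hux (Real.rpow_nonneg (hφ0 X) _), ← Real.rpow_mul (hφ0 X),
            one_div_mul_cancel (by linarith), Real.rpow_one] at h1
          have h2 := mul_le_mul_of_nonneg_left (hgφ X) hux
          linarith
        · rw [indicator_of_notMem hX, hφL X hX, hgL X hX]; simp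
    _ = _ := by
        rw [integral_add (i2.const_mul _) i3, integral_const_mul, integral_indicator hL.measurableSet,
          setIntegral_const, smul_eq_mul, Measure.real, mul_comm (ENNReal.toReal _)]

/-- Pointwise identity: a mollified solution solves the mollified equation. -/
lemma IsSol.conv_eq {u : Eucl n → ℝ → ℝ} (hu : IsSol p u) (hp : 1 < p) {S : ℝ}
    (hS : ∀ y ∈ Metric.ball (0 : Eucl n) 4, ∀ t ∈ Icc (-4) (4 : ℝ), u y t ≤ S) (k : ℕ)
    {w : Eucl n × ℝ → ℝ} (hw : w = (Metric.closedBall (0 : Eucl n) 3 ×ˢ Icc (-3) (3 : ℝ)).indicator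
      fun X => u X.1 X.2) (hwi : LocallyIntegrable w)
    {X : Eucl n × ℝ} (hX : X ∈ Metric.closedBall (0 : Eucl n) 2 ×ˢ Icc (-2) (2 : ℝ)) :
    dt (conv (moll n k) w) X = slap (conv (moll n k) w) X + conv (moll n k) (fun Y => w Y ^ p) X := by
  have hρ := contDiff_moll n k
  have hc := hasCompactSupport_moll n k
  have hdρ : Differentiable ℝ (moll n k) := hρ.differentiable (by norm_num)
  rw [dt_conv (hρ.of_le (by norm_num)) hc hwi, slap_conv hρ hc hwi]
  set K := Metric.closedBall (0 : Eucl n) 3 ×ˢ Icc (-3) (3 : ℝ) with hK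
  have hKc : IsCompact K := (isCompact_closedBall _ _).prod isCompact_Icc
  have hφ : ContDiff ℝ 2 fun Y => moll n k (X - Y) := hρ.comp (contDiff_const.sub contDiff_id)
  have hz : ∀ Y ∉ K, moll n k (X - Y) = 0 := by
    intro Y hY
    apply moll_eq_zero
    by_contra h
    push Not at h
    apply hY
    rw [dist_zero_right, Prod.norm_def, max_le_iff] at h
    have h1 := h.1
    have h2 := abs_le.1 h.2
    simp only [Prod.fst_sub, Prod.snd_sub] at h1 h2
    have h3 : ‖X.1‖ ≤ 2 := by simpa using hX.1
    have h4 := hX.2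
    simp only [mem_Icc] at h4
    refine ⟨?_, by linarith [h2.2], by linarith [h2.1]⟩
    rw [mem_closedBall_zero_iff]
    calc ‖Y.1‖ = ‖X.1 - (X.1 - Y.1)‖ := by congr 1; abel
      _ ≤ ‖X.1‖ + ‖X.1 - Y.1‖ := norm_sub_le _ _
      _ ≤ 3 := by linarith
  have key := hu.weak_eq hp (x0 := 0) (R := 4) (R' := 3) (α := -4) (α' := -3) (β' := 3) (β := 4)
    (by norm_num) (by norm_num) (by norm_num) (by norm_num) (by norm_num) hS hφ
    (fun Y => moll_nonneg n k _) hz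
  have hz1 := dt_eq_zero_of_off hKc.isClosed hz
  have hz2 := slap_eq_zero_of_off hKc.isClosed hz
  simp only [dt_reflect hdρ, slap_reflect hρ] at key hz1 hz2
  have e1 : conv (moll n k) (fun Y => w Y ^ p) X
      = ∫ Y : Eucl n × ℝ, u Y.1 Y.2 ^ p * moll n k (X - Y) := by
    refine integral_congr_ae (Eventually.of_forall fun Y => ?_)
    by_cases hY : Y ∈ K
    · simp only [hw, indicator_of_mem hY]; ring
    · simp only [hz Y hY]; simp
  have e2 : -∫ Y : Eucl n × ℝ, u Y.1 Y.2 * (-dt (moll n k) (X - Y) + slap (moll n k) (X - Y))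
      = conv (dt (moll n k)) w X - conv (slap (moll n k)) w X := by
    unfold conv
    rw [← integral_neg, ← integral_sub]
    · refine integral_congr_ae (Eventually.of_forall fun Y => ?_)
      by_cases hY : Y ∈ K
      · simp only [hw, indicator_of_mem hY]; ring
      · simp only [neg_eq_zero.1 (hz1 Y hY), hz2 Y hY]; ring
    · exact integrable_conv (continuous_dt (hρ.of_le (by norm_num))) hc.dt hwi X
    · refine integrable_conv (continuous_slap hρ) (HasCompactSupport.intro hc.isCompact ?_) hwi X
      exact slap_eq_zero_of_off (isClosed_tsupport _)
        (fun Y hY => image_eq_zero_of_notMem_tsupport hY)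
  rw [e1, key, e2]; ring

end SolEnergy

section SolEnergy

variable {n : ℕ} {p : ℝ}

/-- The cutoff dilated by a factor two. -/
lemma IsCutoff.dil_half {C : ℝ} {η : Eucl n × ℝ → ℝ} (hη : IsCutoff p C η) :
    ContDiff ℝ 2 (fun X => η (dil (1 / 2) (1 / 2) X)) ∧
    (∀ X ∈ Metric.closedBall (0 : Eucl n) 1 ×ˢ Icc (-1) (1 : ℝ), η (dil (1 / 2) (1 / 2) X) = 1) ∧
    (∀ X ∉ Metric.closedBall (0 : Eucl n) 2 ×ˢ Icc (-2) (2 : ℝ), η (dil (1 / 2) (1 / 2) X) = 0) ∧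
    (∀ X, |dt (fun X => η (dil (1 / 2) (1 / 2) X)) X + slap (fun X => η (dil (1 / 2) (1 / 2) X)) X|
      ≤ 2 * C * η (dil (1 / 2) (1 / 2) X) ^ (1 / p)) := by
  refine ⟨hη.contDiff.comp (dil (1 / 2) (1 / 2)).contDiff, fun X hX => ?_, fun X hX => ?_,
    fun X => ?_⟩
  · apply hη.eq_one
    have h1 : ‖X.1‖ ≤ 1 := by simpa using hX.1
    have h2 := hX.2
    simp only [mem_Icc] at h2
    refine ⟨?_, ?_, ?_⟩
    · rw [mem_closedBall_zero_iff, dil_apply, norm_smul, Real.norm_of_nonneg (by norm_num)]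
      linarith
    · simp only [dil_apply]; linarith
    · simp only [dil_apply]; linarith
  · apply hη.eq_zero
    intro h
    apply hX
    have h1 : ‖(1 / 2 : ℝ) • X.1‖ ≤ 1 := mem_closedBall_zero_iff.1 h.1
    rw [norm_smul, Real.norm_of_nonneg (by norm_num)] at h1
    have h2 := h.2
    simp only [mem_Icc, dil_apply] at h2
    refine ⟨?_, by linarith, by linarith⟩
    rw [mem_closedBall_zero_iff]; linarith
  · rw [dt_dil (hη.contDiff.differentiable (by norm_num)), slap_dil hη.contDiff]
    have h1 := hη.dt_le (dil (1 / 2) (1 / 2) X)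
    have h2 := hη.slap_le (dil (1 / 2) (1 / 2) X)
    refine (abs_add_le _ _).trans ?_
    rw [abs_mul, abs_mul, abs_of_nonneg (by norm_num : (0 : ℝ) ≤ 1 / 2),
      abs_of_nonneg (by norm_num : (0 : ℝ) ≤ (1 / 2) ^ 2)]
    have h3 := abs_nonneg (dt η (dil (1 / 2) (1 / 2) X))
    have h4 := abs_nonneg (slap η (dil (1 / 2) (1 / 2) X))
    linarith

/-- The first moment bound and its consequences at unit scale. -/
lemma IsCutoff.exists_outer_cutoff {C : ℝ} (hC : 0 ≤ C) {η : Eucl n × ℝ → ℝ} (hη : IsCutoff p C η)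
    (hp : 1 < p) : ∃ Φ : Eucl n × ℝ → ℝ, ContDiff ℝ 2 Φ ∧ (∀ X, Φ X ∈ Icc 0 1) ∧
    (∀ X ∈ Metric.closedBall (0 : Eucl n) 1 ×ˢ Icc (-1) (1 : ℝ), Φ X = 1) ∧
    (∀ X ∉ Metric.closedBall (0 : Eucl n) 2 ×ˢ Icc (-2) (2 : ℝ), Φ X = 0) ∧
    ∃ D ≥ 0, ∀ u : Eucl n → ℝ → ℝ, IsSol p u → ∀ S,
    (∀ y ∈ Metric.ball (0 : Eucl n) 4, ∀ t ∈ Icc (-4) (4 : ℝ), u y t ≤ S) →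
    (∫ X : Eucl n × ℝ, u X.1 X.2 ^ p * Φ X) ≤ D ∧
    (∫ X : Eucl n × ℝ, u X.1 X.2 * |dt Φ X + slap Φ X|) ≤ D := by
  obtain ⟨Φ, hΦ01, h1, h2, h3, h4⟩ : ∃ Φ : Eucl n × ℝ → ℝ, (∀ X, Φ X ∈ Icc 0 1) ∧
      ContDiff ℝ 2 Φ ∧
      (∀ X ∈ Metric.closedBall (0 : Eucl n) 1 ×ˢ Icc (-1) (1 : ℝ), Φ X = 1) ∧
      (∀ X ∉ Metric.closedBall (0 : Eucl n) 2 ×ˢ Icc (-2) (2 : ℝ), Φ X = 0) ∧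
      (∀ X, |dt Φ X + slap Φ X| ≤ 2 * C * Φ X ^ (1 / p)) :=
    ⟨_, fun X => ⟨hη.nonneg _, hη.le_one _⟩, hη.dil_half⟩
  refine ⟨Φ, h1, hΦ01, h2, h3, ?_⟩
  set L := Metric.closedBall (0 : Eucl n) 2 ×ˢ Icc (-2) (2 : ℝ) with hL
  have hLc : IsCompact L := (isCompact_closedBall _ _).prod isCompact_Icc
  refine ⟨2 * (2 * C * (2 * (2 * C)) ^ (1 / (p - 1)) * (volume L).toReal), by positivity,
    fun u hu S hS => ?_⟩
  have hSL : ∀ X ∈ L, u X.1 X.2 ≤ S := fun X hX => by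
    have hX2 := hX.2
    simp only [mem_Icc] at hX2
    exact hS _ (Metric.closedBall_subset_ball (by norm_num) hX.1) _ ⟨by linarith, by linarith⟩
  have cg : Continuous fun X => dt Φ X + slap Φ X :=
    (continuous_dt (h1.of_le (by norm_num))).add (continuous_slap h1)
  have key := hu.integral_mul_abs_le hp (c := 2 * C) (by positivity) hLc h1.continuous cg
    (fun X => (hΦ01 _).1) h3 (fun X hX => by
      rw [dt_eq_zero_of_off hLc.isClosed h3 X hX, slap_eq_zero_of_off hLc.isClosed h3 X hX,
        add_zero]) hSL h4
  have hw := hu.weak_eq hp (x0 := 0) (R := 4) (R' := 2) (α := -4) (α' := -2) (β' := 2) (β := 4)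
    (by norm_num) (by norm_num) (by norm_num) (by norm_num) (by norm_num) hS h1
    (fun Y => (hΦ01 _).1) h3
  have hle : (∫ X : Eucl n × ℝ, u X.1 X.2 ^ p * Φ X)
      ≤ ∫ X : Eucl n × ℝ, u X.1 X.2 * |dt Φ X + slap Φ X| := by
    rw [hw]
    refine (neg_le_abs _).trans ?_
    refine abs_integral_le_integral_abs.trans (le_of_eq ?_)
    congr 1; ext X
    rw [abs_mul, abs_of_pos (hu.pos _ _)]
  constructor <;> linarith

lemma abs_mul_le_weighted {a b κ : ℝ} (hκ : 0 < κ) : |a * b| ≤ κ * a ^ 2 + κ⁻¹ * b ^ 2 := by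
  have h1 : 0 ≤ κ * (a - κ⁻¹ * b) ^ 2 := by positivity
  have h2 : 0 ≤ κ * (a + κ⁻¹ * b) ^ 2 := by positivity
  have e1 : κ * (a - κ⁻¹ * b) ^ 2 = κ * a ^ 2 - 2 * (a * b) + κ⁻¹ * b ^ 2 := by field_simp; ring
  have e2 : κ * (a + κ⁻¹ * b) ^ 2 = κ * a ^ 2 + 2 * (a * b) + κ⁻¹ * b ^ 2 := by field_simp; ring
  have h3 : 0 ≤ κ * a ^ 2 + κ⁻¹ * b ^ 2 := by positivity
  exact abs_le.2 ⟨by linarith, by linarith⟩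

lemma abs_integral_mul_dt_le_add {V θ φ : Eucl n × ℝ → ℝ} (hV : ContDiff ℝ 2 V)
    (hθ : ContDiff ℝ 2 θ) (hφ : Continuous φ) (hφ0 : ∀ X, 0 ≤ φ X) {L : Set (Eucl n × ℝ)}
    (hL : IsCompact L) (hφL : ∀ X ∉ L, φ X = 0) (hθc : HasCompactSupport θ)
    (hφ1 : ∀ X, θ X ≠ 0 → φ X = 1) {κ : ℝ} (hκ : 0 < κ) :
    |∫ X, V X * dt θ X| ≤ κ * (∫ X, dt V X ^ 2 * φ X) + κ⁻¹ * ∫ X, θ X ^ 2 := by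
  have hVd : Continuous (dt V) := continuous_dt (hV.of_le (by norm_num))
  have e : ∫ X, V X * dt θ X = -∫ X, dt V X * θ X :=
    integral_fderiv_mul_comm volume (hV.of_le (by norm_num)) (hθ.of_le (by norm_num)) hθc
      ((0 : Eucl n), (1 : ℝ))
  rw [e, abs_neg]
  have hθk : Continuous θ := hθ.continuous
  have i1 : Integrable fun X => |dt V X * θ X| := by
    have c : Continuous fun X => dt V X * θ X := hVd.mul hθk
    exact (c.integrable_of_hasCompactSupport hθc.mul_left).abs
  have i4 : Integrable fun X => κ * (dt V X ^ 2 * φ X) := by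
    have c : Continuous fun X => dt V X ^ 2 * φ X := (hVd.pow 2).mul hφ
    exact (c.integrable_of_hasCompactSupport
      (HasCompactSupport.intro hL fun X hX => by rw [hφL X hX, mul_zero])).const_mul κ
  have i5 : Integrable fun X => κ⁻¹ * θ X ^ 2 := by
    have c : Continuous fun X => θ X ^ 2 := hθk.pow 2
    have hc : HasCompactSupport fun X => θ X ^ 2 :=
      hθc.comp_left (g := fun s : ℝ => s ^ 2) (by norm_num)
    exact (c.integrable_of_hasCompactSupport hc).const_mul κ⁻¹
  have i6 : Integrable fun X => κ * (dt V X ^ 2 * φ X) + κ⁻¹ * θ X ^ 2 := i4.add i5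
  have hle : ∀ X, |dt V X * θ X| ≤ κ * (dt V X ^ 2 * φ X) + κ⁻¹ * θ X ^ 2 := by
    intro X
    by_cases hX : θ X = 0
    · rw [hX, mul_zero, abs_zero]
      have := mul_nonneg hκ.le (mul_nonneg (sq_nonneg (dt V X)) (hφ0 X))
      rwa [zero_pow two_ne_zero, mul_zero, add_zero]
    · rw [hφ1 X hX, mul_one]
      exact abs_mul_le_weighted hκ
  refine abs_integral_le_integral_abs.trans ((integral_mono i1 i6 hle).trans (le_of_eq ?_))
  rw [integral_add i4 i5, integral_const_mul, integral_const_mul]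

set_option maxHeartbeats 1600000 in
/-- Local energy estimate at unit scale: the solution is nearly constant in time in a weak sense. -/
lemma exists_abs_integral_mul_dt_le (n : ℕ) {p : ℝ} (hp : 1 < p) :
    ∃ C ≥ 0, ∀ u : Eucl n → ℝ → ℝ, IsSol p u → ∀ M ≥ 0,
    (∀ y ∈ Metric.ball (0 : Eucl n) 4, ∀ t ∈ Icc (-4) (4 : ℝ), u y t ≤ M) →
    ∀ θ : Eucl n × ℝ → ℝ, ContDiff ℝ 2 θ →
    (∀ X ∉ Metric.closedBall (0 : Eucl n) (1 / 2) ×ˢ Icc (-(1 / 2)) (1 / 2 : ℝ), θ X = 0) →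
    ∀ κ > 0, |∫ X : Eucl n × ℝ, u X.1 X.2 * dt θ X| ≤ κ * (C * M) + κ⁻¹ * ∫ X, θ X ^ 2 := by
  obtain ⟨C, hC, φ, hφ⟩ := exists_isCutoff n hp
  obtain ⟨Φ, hΦ, hΦ01, hΦ1, hΦ0, D, hD, hDu⟩ := hφ.exists_outer_cutoff hC hp
  set L := Metric.closedBall (0 : Eucl n) 2 ×ˢ Icc (-2) (2 : ℝ) with hL
  set K := Metric.closedBall (0 : Eucl n) 1 ×ˢ Icc (-1) (1 : ℝ) with hK
  have hLc : IsCompact L := (isCompact_closedBall _ _).prod isCompact_Icc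
  have hKc : IsCompact K := (isCompact_closedBall _ _).prod isCompact_Icc
  refine ⟨8 * C * D, by positivity, fun u hu M hM hS θ hθ hθ0 κ hκ => ?_⟩
  obtain ⟨hD1, hD2⟩ := hDu u hu M hS
  set K3 := Metric.closedBall (0 : Eucl n) 3 ×ˢ Icc (-3) (3 : ℝ) with hK3
  have hK3c : IsCompact K3 := (isCompact_closedBall _ _).prod isCompact_Icc
  have hLK : L ⊆ K3 := prod_mono (Metric.closedBall_subset_closedBall (by norm_num))
    (Icc_subset_Icc (by norm_num) (by norm_num))
  have hKL : K ⊆ L := prod_mono (Metric.closedBall_subset_closedBall (by norm_num))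
    (Icc_subset_Icc (by norm_num) (by norm_num))
  set w := K3.indicator (fun X : Eucl n × ℝ => u X.1 X.2) with hw
  have hwm : Measurable w := hu.measurable.indicator hK3c.measurableSet
  have hwM : ∀ X, w X ∈ Icc 0 M := by
    intro X
    by_cases hX : X ∈ K3
    · rw [hw, indicator_of_mem hX]
      have hX2 := hX.2
      simp only [mem_Icc] at hX2
      exact ⟨(hu.pos _ _).le, hS _ (Metric.closedBall_subset_ball (by norm_num) hX.1) _
        ⟨by linarith, by linarith⟩⟩
    · rw [hw, indicator_of_notMem hX]; exact ⟨le_rfl, hM⟩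
  have hwp : ∀ X, w X ^ p ∈ Icc 0 (M ^ p) := fun X =>
    ⟨Real.rpow_nonneg (hwM X).1 _, Real.rpow_le_rpow (hwM X).1 (hwM X).2 (by linarith)⟩
  have bdd_li : ∀ (g : Eucl n × ℝ → ℝ) (A : ℝ), Measurable g → (∀ X, g X ∈ Icc 0 A) →
      LocallyIntegrable g := by
    intro g A hg hA
    have : LocallyIntegrable fun _ : Eucl n × ℝ => A := locallyIntegrable_const A
    refine this.mono hg.aestronglyMeasurable (Eventually.of_forall fun X => ?_)
    rw [Real.norm_of_nonneg (hA X).1]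
    exact (hA X).2.trans (le_abs_self A)
  have hwi := bdd_li w M hwm hwM
  have hwpi := bdd_li (fun X => w X ^ p) (M ^ p) (hwm.pow_const p) hwp
  set V : ℕ → Eucl n × ℝ → ℝ := fun k => conv (moll n k) w with hV
  set F : ℕ → Eucl n × ℝ → ℝ := fun k => conv (moll n k) (fun X => w X ^ p) with hF
  have hVs : ∀ k, ContDiff ℝ 2 (V k) := fun k =>
    contDiff_conv (contDiff_moll n k) (hasCompactSupport_moll n k) hwi
  have hFc : ∀ k, Continuous (F k) := fun k =>
    continuous_conv (contDiff_moll n k).continuous (hasCompactSupport_moll n k) hwpi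
  have hVM : ∀ k X, V k X ∈ Icc 0 M := fun k =>
    conv_mem_Icc (contDiff_moll n k).continuous (hasCompactSupport_moll n k) hwi (moll_nonneg n k)
      (integral_moll n k) hwM
  have hFM : ∀ k X, F k X ∈ Icc 0 (M ^ p) := fun k =>
    conv_mem_Icc (contDiff_moll n k).continuous (hasCompactSupport_moll n k) hwpi (moll_nonneg n k)
      (integral_moll n k) hwp
  set R : (Eucl n × ℝ → ℝ) → (Eucl n × ℝ → ℝ) → Eucl n × ℝ → ℝ := fun V F X =>
    2 * C * (V X * F X * Φ X + 1 / 2 * V X ^ 2 * (dt Φ X + slap Φ X))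
        + C * (V X ^ (p + 1) * Φ X) + (F X - V X ^ p) ^ 2 * φ X with hR
  have hdtC : ∀ X, |dt φ X| ≤ C := fun X => (hφ.dt_le X).trans
    (mul_le_of_le_one_right hC (Real.rpow_le_one (hφ.nonneg X) (hφ.le_one X)
      (by have : 0 < p := by linarith
          positivity)))
  have henergy : ∀ k, 1 / 2 * ∫ X, dt (V k) X ^ 2 * φ X ≤ ∫ X, R (V k) (F k) X := fun k =>
    energy_inequality hp hC (hVs k) (fun X => (hVM k X).1) (hFc k) hφ.contDiff hφ.nonneg hΦ
      (fun X => (hΦ01 X).1) hKc.isClosed hLc hφ.eq_zero hΦ1 hΦ0 hdtC hφ.grad_le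
      (fun X hX => hu.conv_eq hp hS k hw hwi (by by_contra h; exact hX (hΦ0 X h)))
  have hφL : ∀ X ∉ L, φ X = 0 := fun X hX => hφ.eq_zero X fun h => hX (hKL h)
  have hgL : ∀ X ∉ L, dt Φ X + slap Φ X = 0 := fun X hX => by
    rw [dt_eq_zero_of_off hLc.isClosed hΦ0 X hX, slap_eq_zero_of_off hLc.isClosed hΦ0 X hX,
      add_zero]
  have hθc : HasCompactSupport θ :=
    HasCompactSupport.intro ((isCompact_closedBall _ _).prod isCompact_Icc) hθ0
  have hdθ : Continuous (dt θ) := continuous_dt (hθ.of_le (by norm_num))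
  -- the estimate for the mollified function
  have hk : ∀ k, |∫ X, V k X * dt θ X|
      ≤ κ * (2 * ∫ X, R (V k) (F k) X) + κ⁻¹ * ∫ X, θ X ^ 2 := by
    intro k
    have h1 := abs_integral_mul_dt_le_add (hVs k) hθ hφ.contDiff.continuous hφ.nonneg hLc hφL hθc
      (fun X hX => hφ.eq_one X (by by_contra h; exact hX (hθ0 X h))) hκ
    have := henergy k
    have h2 : (∫ X, dt (V k) X ^ 2 * φ X) ≤ 2 * ∫ X, R (V k) (F k) X := by linarith
    have := mul_le_mul_of_nonneg_left h2 hκ.le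
    linarith
  -- passing to the limit
  have hae1 := ae_tendsto_conv_moll hwi
  have hae2 := ae_tendsto_conv_moll hwpi
  have hlim1 : Tendsto (fun k => ∫ X, V k X * dt θ X) atTop (𝓝 (∫ X, w X * dt θ X)) := by
    refine tendsto_integral_of_dominated_convergence (fun X => M * |dt θ X|) ?_ ?_ ?_ ?_
    · exact fun k => ((hVs k).continuous.mul hdθ).aestronglyMeasurable
    · exact (hdθ.integrable_of_hasCompactSupport hθc.dt).abs.const_mul M
    · refine fun k => Eventually.of_forall fun X => ?_
      rw [Real.norm_eq_abs, abs_mul, abs_of_nonneg (hVM k X).1]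
      exact mul_le_mul_of_nonneg_right (hVM k X).2 (abs_nonneg _)
    · filter_upwards [hae1] with X hX using hX.mul_const _
  obtain ⟨B, hB⟩ : ∃ B : ℝ, ∀ X, |dt Φ X + slap Φ X| ≤ B := by
    have hc : Continuous fun X => dt Φ X + slap Φ X :=
      (continuous_dt (hΦ.of_le (by norm_num))).add (continuous_slap hΦ)
    obtain ⟨B, hB⟩ := (HasCompactSupport.intro hLc hgL).exists_bound_of_continuous hc
    exact ⟨B, hB⟩
  have hp1 : 0 < p + 1 := by linarith
  have hlim2 : Tendsto (fun k => ∫ X, R (V k) (F k) X) atTop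
      (𝓝 (∫ X, R w (fun X => w X ^ p) X)) := by
    set A := 2 * C * (M * M ^ p + 1 / 2 * M ^ 2 * B) + C * M ^ (p + 1) + (M ^ p) ^ 2 with hA
    refine tendsto_integral_of_dominated_convergence (L.indicator fun _ => A) ?_ ?_ ?_ ?_
    · intro k
      have c1 := (hVs k).continuous
      have c2 := hFc k
      have c3 := hφ.contDiff.continuous
      have c4 := hΦ.continuous
      have c5 := continuous_dt (hΦ.of_le (by norm_num : (1 : WithTop ℕ∞) ≤ 2))
      have c6 := continuous_slap hΦ
      have c7 : Continuous fun X => V k X ^ (p + 1) := c1.rpow_const fun X => Or.inr hp1.le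
      have c8 : Continuous fun X => V k X ^ p := c1.rpow_const fun X => Or.inr (by linarith)
      apply Continuous.aestronglyMeasurable
      simp only [hR]
      fun_prop
    · exact (integrable_indicator_iff hLc.measurableSet).2 (integrableOn_const hLc.measure_lt_top.ne)
    · refine fun k => Eventually.of_forall fun X => ?_
      by_cases hX : X ∈ L
      · rw [indicator_of_mem hX, Real.norm_eq_abs]
        have hv := hVM k X
        have hf := hFM k X
        have hvp : V k X ^ p ∈ Icc 0 (M ^ p) :=
          ⟨Real.rpow_nonneg hv.1 _, Real.rpow_le_rpow hv.1 hv.2 (by linarith)⟩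
        have hvp1 : V k X ^ (p + 1) ∈ Icc 0 (M ^ (p + 1)) :=
          ⟨Real.rpow_nonneg hv.1 _, Real.rpow_le_rpow hv.1 hv.2 hp1.le⟩
        have a1 : |V k X * F k X * Φ X| ≤ M * M ^ p := by
          rw [abs_of_nonneg (mul_nonneg (mul_nonneg hv.1 hf.1) (hΦ01 X).1)]
          exact (mul_le_of_le_one_right (mul_nonneg hv.1 hf.1) (hΦ01 X).2).trans
            (mul_le_mul hv.2 hf.2 hf.1 hM)
        have a2 : |1 / 2 * V k X ^ 2 * (dt Φ X + slap Φ X)| ≤ 1 / 2 * M ^ 2 * B := by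
          rw [abs_mul, abs_of_nonneg (by positivity)]
          have := pow_le_pow_left₀ hv.1 hv.2 2
          have := hB X
          gcongr
        have a3 : |V k X ^ (p + 1) * Φ X| ≤ M ^ (p + 1) := by
          rw [abs_of_nonneg (mul_nonneg hvp1.1 (hΦ01 X).1)]
          exact (mul_le_of_le_one_right hvp1.1 (hΦ01 X).2).trans hvp1.2
        have a4 : |(F k X - V k X ^ p) ^ 2 * φ X| ≤ (M ^ p) ^ 2 := by
          rw [abs_of_nonneg (mul_nonneg (sq_nonneg _) (hφ.nonneg _))]
          refine (mul_le_of_le_one_right (sq_nonneg _) (hφ.le_one _)).trans ?_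
          rw [← sq_abs]
          refine pow_le_pow_left₀ (abs_nonneg _) ?_ 2
          exact abs_le.2 ⟨by linarith [hf.1, hvp.2], by linarith [hf.2, hvp.1]⟩
        calc |R (V k) (F k) X| ≤ |2 * C * (V k X * F k X * Φ X
              + 1 / 2 * V k X ^ 2 * (dt Φ X + slap Φ X))| + |C * (V k X ^ (p + 1) * Φ X)|
              + |(F k X - V k X ^ p) ^ 2 * φ X| := abs_add_three _ _ _
          _ ≤ A := by
              rw [abs_mul (2 * C), abs_mul C, abs_of_nonneg hC, abs_of_nonneg (by positivity : 0 ≤ 2 * C)]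
              have a5 := (abs_add_le (V k X * F k X * Φ X)
                (1 / 2 * V k X ^ 2 * (dt Φ X + slap Φ X))).trans (add_le_add a1 a2)
              rw [hA]
              gcongr
      · rw [indicator_of_notMem hX]
        simp only [hR]
        rw [hΦ0 X hX, hφL X hX, hgL X hX]; simp
    · filter_upwards [hae1, hae2] with X h1 h2
      have h3 : Tendsto (fun k => V k X ^ p) atTop (𝓝 (w X ^ p)) :=
        h1.rpow_const (Or.inr (by linarith))
      have h4 : Tendsto (fun k => V k X ^ (p + 1)) atTop (𝓝 (w X ^ (p + 1))) :=
        h1.rpow_const (Or.inr hp1.le)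
      exact ((((h1.mul h2).mul_const (Φ X)).add (((h1.pow 2).const_mul (1 / 2)).mul_const
        (dt Φ X + slap Φ X))).const_mul (2 * C)).add ((h4.mul_const (Φ X)).const_mul C) |>.add
        (((h2.sub h3).pow 2).mul_const (φ X))
  have hfin := le_of_tendsto_of_tendsto' hlim1.abs
    (((hlim2.const_mul 2).const_mul κ).add_const (κ⁻¹ * ∫ X, θ X ^ 2)) hk
  have e1 : ∫ X, w X * dt θ X = ∫ X : Eucl n × ℝ, u X.1 X.2 * dt θ X := by
    refine integral_congr_ae (Eventually.of_forall fun X => ?_)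
    by_cases hX : X ∈ K3
    · simp only [hw, indicator_of_mem hX]
    · have : dt θ X = 0 := dt_eq_zero_of_off (hLc.isClosed) (fun Y hY => hθ0 Y fun h => hY
        ⟨Metric.closedBall_subset_closedBall (by norm_num) h.1,
          Icc_subset_Icc (by norm_num) (by norm_num) h.2⟩) X (fun h => hX (hLK h))
      simp only [this, mul_zero]
  rw [e1] at hfin
  refine hfin.trans (add_le_add_left (mul_le_mul_of_nonneg_left ?_ hκ.le) _)
  have hm := hu.measurable
  have hSL : ∀ X ∈ L, |u X.1 X.2| ≤ M := fun X hX => by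
    have hX2 := hX.2
    simp only [mem_Icc] at hX2
    rw [abs_of_pos (hu.pos _ _)]
    exact hS _ (Metric.closedBall_subset_ball (by norm_num) hX.1) _ ⟨by linarith, by linarith⟩
  have j1 : Integrable fun X : Eucl n × ℝ => u X.1 X.2 ^ p * Φ X :=
    integrable_mul_of_bdd_on (hm.pow_const p) hΦ.continuous hLc (S := M ^ p)
      (fun X hX => by
        rw [abs_of_pos (Real.rpow_pos_of_pos (hu.pos _ _) _)]
        exact Real.rpow_le_rpow (hu.pos _ _).le ((le_abs_self _).trans (hSL X hX))
          (by linarith)) hΦ0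
  have j2 : Integrable fun X : Eucl n × ℝ => u X.1 X.2 * |dt Φ X + slap Φ X| :=
    integrable_mul_of_bdd_on hm ((continuous_dt (hΦ.of_le (by norm_num))).add
      (continuous_slap hΦ)).abs hLc hSL (fun X hX => by simp [hgL X hX])
  have hRle : ∀ X, R w (fun X => w X ^ p) X ≤ 3 * C * M * (u X.1 X.2 ^ p * Φ X)
      + C * M * (u X.1 X.2 * |dt Φ X + slap Φ X|) := by
    intro X
    simp only [hR]
    by_cases hX : X ∈ L
    · have hwu : w X = u X.1 X.2 := indicator_of_mem (hLK hX) _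
      rw [hwu]
      have h0 := hu.pos X.1 X.2
      have h1 := (le_abs_self _).trans (hSL X hX)
      have h2 : u X.1 X.2 ^ (p + 1) = u X.1 X.2 ^ p * u X.1 X.2 := Real.rpow_add_one h0.ne' p
      rw [h2]
      have h3 := Real.rpow_pos_of_pos h0 p
      have h4 := (hΦ01 X).1
      have h5 : u X.1 X.2 * (u X.1 X.2 ^ p * Φ X) ≤ M * (u X.1 X.2 ^ p * Φ X) :=
        mul_le_mul_of_nonneg_right h1 (mul_nonneg h3.le h4)
      have h6 : u X.1 X.2 ^ 2 * (dt Φ X + slap Φ X) ≤ M * (u X.1 X.2 * |dt Φ X + slap Φ X|) := by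
        calc u X.1 X.2 ^ 2 * (dt Φ X + slap Φ X)
            ≤ u X.1 X.2 ^ 2 * |dt Φ X + slap Φ X| := by gcongr; exact le_abs_self _
          _ = u X.1 X.2 * (u X.1 X.2 * |dt Φ X + slap Φ X|) := by ring
          _ ≤ _ := mul_le_mul_of_nonneg_right h1 (by positivity)
      have h7 := mul_le_mul_of_nonneg_left h5 hC
      have h8 := mul_le_mul_of_nonneg_left h6 hC
      nlinarith
    · rw [hΦ0 X hX, hφL X hX, hgL X hX]; simp
  have hR0 : ∫ X, R w (fun X => w X ^ p) X ≤ 3 * C * M * D + C * M * D := by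
    have hRi : Integrable fun X : Eucl n × ℝ => 3 * C * M * (u X.1 X.2 ^ p * Φ X)
      + C * M * (u X.1 X.2 * |dt Φ X + slap Φ X|) := (j1.const_mul _).add (j2.const_mul _)
    by_cases hi : Integrable fun X => R w (fun X => w X ^ p) X
    · refine (integral_mono hi hRi hRle).trans ?_
      rw [integral_add (j1.const_mul _) (j2.const_mul _), integral_const_mul, integral_const_mul]
      have h3 := mul_le_mul_of_nonneg_left hD1 (by positivity : 0 ≤ 3 * C * M)
      have h4 := mul_le_mul_of_nonneg_left hD2 (by positivity : 0 ≤ C * M)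
      exact add_le_add h3 h4
    · rw [integral_undef hi]; positivity
  linarith

end SolEnergy

section Liouville

variable {n : ℕ} {p : ℝ}

/-- A solution normalised at the origin carries a definite amount of mass near it. -/
lemma exists_le_integral_rpow_mul (n : ℕ) (hp : 1 < p) {Λ : ℝ} (hΛ : 0 < Λ) :
    ∃ c > 0, ∀ u : Eucl n → ℝ → ℝ, IsSol p u → u 0 0 = 1 →
    ∀ φ : Eucl n × ℝ → ℝ, Continuous φ → (∀ X, 0 ≤ φ X) →
    (∀ X ∈ Metric.closedBall (0 : Eucl n) 1 ×ˢ Icc (-(1 / 2)) (1 / 2 : ℝ), φ X = 1) →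
    (∀ y ∈ Metric.ball (0 : Eucl n) 1, ∀ t ∈ Icc (-1) 0, u y t ≤ Λ) →
    Integrable (fun X : Eucl n × ℝ => u X.1 X.2 ^ p * φ X) →
    c ≤ ∫ X : Eucl n × ℝ, u X.1 X.2 ^ p * φ X := by
  obtain ⟨C, hC, hCu⟩ := exists_le_of_le_on_cylinder n
  set K := Λ ^ (p - 1) with hK
  have hK0 : 0 < K := Real.rpow_pos_of_pos hΛ _
  set D := C * (1 + K) * Λ with hD
  have hD0 : 0 < D := by positivity
  set τ1 := min (1 / 2) (1 / (2 * D)) with hτ1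
  have hτ0 : 0 < τ1 := lt_min (by norm_num) (by positivity)
  have hτh : τ1 ≤ 1 / 2 := min_le_left _ _
  have hτD : τ1 * (2 * D) ≤ 1 := by
    rw [← le_div_iff₀ (by positivity)]; exact min_le_right _ _
  set c0 := (τ1 / 2) ^ ((n : ℝ) / 2) / (2 * C) with hc0
  have hc00 : 0 < c0 := div_pos (Real.rpow_pos_of_pos (by linarith) _) (by linarith)
  set B := Metric.ball (0 : Eucl n) 1 with hB
  set ω := volume.real B with hω
  have hBfin : volume B ≠ ⊤ := Metric.isBounded_ball.measure_lt_top.ne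
  have hω0 : 0 < ω := ENNReal.toReal_pos (Metric.measure_ball_pos _ _ one_pos).ne' hBfin
  set a := c0 / (2 * ω) with ha
  have ha0 : 0 < a := by positivity
  set T := Icc (-τ1) (-(τ1 / 2)) with hT
  have hTv : volume.real T = τ1 / 2 := by
    rw [hT, Real.volume_real_Icc_of_le (by linarith)]; ring
  refine ⟨a ^ (p - 1) * (c0 / 2 * (τ1 / 2)),
    mul_pos (Real.rpow_pos_of_pos ha0 _) (by positivity), fun u hu h1 φ hφ hφ0 hφ1 hS hi => ?_⟩
  have hI : ∀ t ∈ T, c0 ≤ ∫ y in B, u y t := by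
    intro t ht
    have h2 := hCu p u hp hu Λ K hS le_rfl (-t) ⟨by linarith [ht.2], by linarith [ht.1]⟩
    rw [h1, neg_neg] at h2
    have ht0 : 0 < -t := by linarith [ht.2]
    have hI0 : 0 ≤ ∫ y in B, u y t := integral_nonneg fun y => (hu.pos _ _).le
    have h3 : C * (1 + K) * -t * Λ ≤ 1 / 2 := by
      have : C * (1 + K) * -t * Λ = -t * D := by rw [hD]; ring
      rw [this]
      have := mul_le_mul_of_nonneg_right (by linarith [ht.1] : -t ≤ τ1) hD0.le
      linarith
    have h4 : (-t) ^ (-((n : ℝ) / 2)) ≤ ((τ1 / 2) ^ ((n : ℝ) / 2))⁻¹ := by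
      rw [Real.rpow_neg ht0.le]
      apply inv_anti₀ (Real.rpow_pos_of_pos (by linarith) _)
      exact Real.rpow_le_rpow (by linarith) (by linarith [ht.2]) (by positivity)
    have hr : 0 < (τ1 / 2) ^ ((n : ℝ) / 2) := Real.rpow_pos_of_pos (by linarith) _
    have h5 : C * (-t) ^ (-((n : ℝ) / 2)) * ∫ y in B, u y t
        ≤ C * ((τ1 / 2) ^ ((n : ℝ) / 2))⁻¹ * ∫ y in B, u y t := by gcongr
    have h6 : 1 / 2 ≤ C * ((τ1 / 2) ^ ((n : ℝ) / 2))⁻¹ * ∫ y in B, u y t := by linarith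
    rw [hc0, div_le_iff₀ (by positivity)]
    calc (τ1 / 2) ^ ((n : ℝ) / 2) = (τ1 / 2) ^ ((n : ℝ) / 2) * 2 * (1 / 2) := by ring
      _ ≤ (τ1 / 2) ^ ((n : ℝ) / 2) * 2 *
        (C * ((τ1 / 2) ^ ((n : ℝ) / 2))⁻¹ * ∫ y in B, u y t) := by gcongr
      _ = _ := by field_simp
  have hTS : ∀ t ∈ T, t ∈ Icc (-1 : ℝ) 0 := fun t ht => ⟨by linarith [ht.1], by linarith [ht.2]⟩
  have hBT : MeasurableSet (B ×ˢ T) := measurableSet_ball.prod measurableSet_Icc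
  have hBTfin : volume (B ×ˢ T) ≠ ⊤ := by
    rw [Measure.volume_eq_prod, Measure.prod_prod]
    exact ENNReal.mul_ne_top hBfin isCompact_Icc.measure_lt_top.ne
  have hm : Measurable fun X : Eucl n × ℝ => u X.1 X.2 := hu.measurable
  have iu : IntegrableOn (fun X : Eucl n × ℝ => u X.1 X.2) (B ×ˢ T) := by
    refine Measure.integrableOn_of_bounded (M := Λ) hBTfin hm.aestronglyMeasurable ?_
    refine (ae_restrict_iff' hBT).2 (Eventually.of_forall fun X hX => ?_)
    rw [Real.norm_of_nonneg (hu.pos _ _).le]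
    exact hS _ hX.1 _ (hTS _ hX.2)
  have ic : IntegrableOn (fun _ : Eucl n × ℝ => a) (B ×ˢ T) := integrableOn_const hBTfin
  have iua : IntegrableOn (fun X : Eucl n × ℝ => a ^ (p - 1) * (u X.1 X.2 - a)) (B ×ˢ T) :=
    (iu.sub ic).const_mul _
  have e1 : ∫ X in B ×ˢ T, u X.1 X.2 = ∫ t in T, ∫ y in B, u y t := by
    have hr : volume.restrict (B ×ˢ T) = (volume.restrict B).prod (volume.restrict T) := by
      rw [Measure.prod_restrict, Measure.volume_eq_prod]
    rw [hr]
    apply integral_prod_symm (fun X : Eucl n × ℝ => u X.1 X.2)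
    rw [← hr]
    exact iu
  have h7 : c0 * (τ1 / 2) ≤ ∫ X in B ×ˢ T, u X.1 X.2 := by
    rw [e1, ← hTv, mul_comm, ← smul_eq_mul, ← setIntegral_const]
    refine setIntegral_mono_on (integrableOn_const isCompact_Icc.measure_lt_top.ne) ?_
      measurableSet_Icc hI
    have hr : volume.restrict (B ×ˢ T) = (volume.restrict B).prod (volume.restrict T) := by
      rw [Measure.prod_restrict, Measure.volume_eq_prod]
    have : Integrable (fun X : Eucl n × ℝ => u X.1 X.2)
        ((volume.restrict B).prod (volume.restrict T)) := by rw [← hr]; exact iu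
    exact this.integral_prod_right
  have e2 : ∫ X in B ×ˢ T, a = c0 / 2 * (τ1 / 2) := by
    rw [setIntegral_const, smul_eq_mul, measureReal_def, Measure.volume_eq_prod,
      Measure.prod_prod, ENNReal.toReal_mul, ← measureReal_def, ← measureReal_def, hTv, ha,
      ← hω]
    field_simp
  calc a ^ (p - 1) * (c0 / 2 * (τ1 / 2))
      ≤ a ^ (p - 1) * ∫ X in B ×ˢ T, (u X.1 X.2 - a) := by
        have e3 : ∫ X in B ×ˢ T, (u X.1 X.2 - a)
            = (∫ X in B ×ˢ T, u X.1 X.2) - ∫ X in B ×ˢ T, a := integral_sub iu ic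
        rw [e3, e2]
        have := Real.rpow_pos_of_pos ha0 (p - 1)
        gcongr
        linarith
    _ = ∫ X in B ×ˢ T, a ^ (p - 1) * (u X.1 X.2 - a) := (integral_const_mul _ _).symm
    _ ≤ ∫ X in B ×ˢ T, u X.1 X.2 ^ p * φ X := by
        refine setIntegral_mono_on iua hi.integrableOn hBT fun X hX => ?_
        have hφX : φ X = 1 := hφ1 X ⟨Metric.ball_subset_closedBall hX.1,
          by linarith [hX.2.1], by linarith [hX.2.2]⟩
        have hu0 := hu.pos X.1 X.2
        have hup : u X.1 X.2 ^ p = u X.1 X.2 ^ (p - 1) * u X.1 X.2 := by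
          rw [← Real.rpow_add_one hu0.ne']; ring_nf
        rw [hφX, mul_one, hup]
        have hap := Real.rpow_pos_of_pos ha0 (p - 1)
        rcases le_total a (u X.1 X.2) with h | h
        · have := Real.rpow_le_rpow ha0.le h (by linarith : 0 ≤ p - 1)
          calc a ^ (p - 1) * (u X.1 X.2 - a) ≤ a ^ (p - 1) * u X.1 X.2 := by gcongr; linarith
            _ ≤ _ := by gcongr
        · exact (mul_nonpos_of_nonneg_of_nonpos hap.le (by linarith)).trans
            (mul_pos (Real.rpow_pos_of_pos hu0 _) hu0).le
    _ ≤ ∫ X, u X.1 X.2 ^ p * φ X :=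
        setIntegral_le_integral hi (Eventually.of_forall fun X =>
          mul_nonneg (Real.rpow_nonneg (hu.pos _ _).le _) (hφ0 X))

/-- The estimate of the time derivative term for large cylinders. -/
lemma exists_abs_integral_mul_dt_le_rpow (n : ℕ) (hp : 1 < p) :
    ∃ C ≥ 0, ∀ v : Eucl n → ℝ → ℝ, IsSol p v → ∀ Λ ≥ 0, ∀ ρ R : ℝ, 2 ≤ ρ → 2 * R ≤ ρ →
    (∀ y ∈ Metric.ball (0 : Eucl n) (4 * ρ), ∀ t ∈ Icc (-(4 * ρ ^ 2)) (4 * ρ ^ 2), v y t ≤ Λ) →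
    ∀ φ : Eucl n × ℝ → ℝ, ContDiff ℝ 2 φ →
    (∀ X ∉ Metric.closedBall (0 : Eucl n) R ×ˢ Icc (-1) (1 : ℝ), φ X = 0) →
    |∫ X : Eucl n × ℝ, v X.1 X.2 * dt φ X|
      ≤ ρ ^ (((n : ℝ) - 2 - 2 / (p - 1)) / 2) * (C * Λ + ∫ X, φ X ^ 2) := by
  obtain ⟨C, hC, h⟩ := exists_abs_integral_mul_dt_le n hp
  refine ⟨C, hC, fun v hv Λ hΛ ρ R hρ hR hS φ hφ hφ0 => ?_⟩
  set b := 2 / (p - 1) with hb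
  have hρ0 : 0 < ρ := by linarith
  have hρb : 0 < ρ ^ b := Real.rpow_pos_of_pos hρ0 b
  have hw := hv.rescale hp 0 0 hρ0
  rw [← hb] at hw
  have hwS : ∀ y ∈ Metric.ball (0 : Eucl n) 4, ∀ t ∈ Icc (-4) (4 : ℝ),
      rescale b v 0 0 ρ y t ≤ ρ ^ b * Λ := by
    intro y hy t ht
    unfold rescale
    refine mul_le_mul_of_nonneg_left (hS _ ?_ _ ?_) hρb.le
    · rw [mem_ball_zero_iff] at hy ⊢
      rw [zero_add, norm_smul, Real.norm_of_nonneg hρ0.le]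
      nlinarith
    · rw [zero_add]
      have := sq_nonneg ρ
      constructor <;> nlinarith [ht.1, ht.2]
  have hρ2 : 0 < ρ ^ 2 := by positivity
  set θ : Eucl n × ℝ → ℝ := fun X => φ (dil ρ (ρ ^ 2) X) with hθ
  have hθs : ∀ X ∉ Metric.closedBall (0 : Eucl n) (1 / 2) ×ˢ Icc (-(1 / 2)) (1 / 2 : ℝ),
      θ X = 0 := by
    intro X hX
    apply hφ0
    intro hX2
    apply hX
    have h1 : ‖ρ • X.1‖ ≤ R := mem_closedBall_zero_iff.1 hX2.1
    rw [norm_smul, Real.norm_of_nonneg hρ0.le] at h1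
    have h2 : -1 ≤ ρ ^ 2 * X.2 ∧ ρ ^ 2 * X.2 ≤ 1 := hX2.2
    refine ⟨mem_closedBall_zero_iff.2 ?_, ?_, ?_⟩
    · by_contra h3
      push Not at h3
      nlinarith
    · by_contra h3
      push Not at h3
      nlinarith
    · by_contra h3
      push Not at h3
      nlinarith
  set κ := ρ ^ (-((n : ℝ) + 2 + b) / 2) with hκ
  have hκ0 : 0 < κ := Real.rpow_pos_of_pos hρ0 _
  have key := h _ hw (ρ ^ b * Λ) (by positivity) hwS θ (hφ.comp (dil ρ (ρ ^ 2)).contDiff) hθs κ hκ0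
  have e1 : ∫ X : Eucl n × ℝ, rescale b v 0 0 ρ X.1 X.2 * dt θ X
      = ρ ^ b * ρ ^ 2 * ((ρ ^ n * ρ ^ 2)⁻¹ * ∫ X : Eucl n × ℝ, v X.1 X.2 * dt φ X) := by
    rw [← integral_dil (fun X : Eucl n × ℝ => v X.1 X.2 * dt φ X) hρ0 hρ2, ← integral_const_mul]
    congr 1
    ext X
    rw [hθ, dt_dil (hφ.differentiable (by norm_num))]
    simp only [rescale, dil_apply, zero_add]
    ring
  have e2 : ∫ X, θ X ^ 2 = (ρ ^ n * ρ ^ 2)⁻¹ * ∫ X, φ X ^ 2 :=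
    integral_dil (fun X => φ X ^ 2) hρ0 hρ2
  rw [e1, e2] at key
  set I := ∫ X : Eucl n × ℝ, v X.1 X.2 * dt φ X with hI
  set J := ∫ X, φ X ^ 2 with hJ
  have hρn : 0 < ρ ^ n := by positivity
  rw [abs_mul, abs_of_pos (by positivity : 0 < ρ ^ b * ρ ^ 2), abs_mul,
    abs_of_pos (by positivity : 0 < (ρ ^ n * ρ ^ 2)⁻¹)] at key
  have a1 : ρ ^ (((n : ℝ) - 2 - b) / 2) = κ * ρ ^ n := by
    rw [hκ, ← Real.rpow_natCast ρ n, ← Real.rpow_add hρ0]; congr 1; ring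
  have a2 : ρ ^ (((n : ℝ) - 2 - b) / 2) = κ⁻¹ * (ρ ^ b)⁻¹ * (ρ ^ 2)⁻¹ := by
    rw [hκ, ← Real.rpow_neg hρ0.le, ← Real.rpow_neg hρ0.le, ← Real.rpow_natCast ρ 2,
      ← Real.rpow_neg hρ0.le, ← Real.rpow_add hρ0, ← Real.rpow_add hρ0]
    congr 1; push_cast; ring
  have key2 : |I| ≤ κ * ρ ^ n * (C * Λ) + κ⁻¹ * (ρ ^ b)⁻¹ * (ρ ^ 2)⁻¹ * J := by
    have := mul_le_mul_of_nonneg_left key (by positivity : 0 ≤ ρ ^ n * (ρ ^ b)⁻¹)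
    have l1 : ρ ^ n * (ρ ^ b)⁻¹ * (ρ ^ b * ρ ^ 2 * ((ρ ^ n * ρ ^ 2)⁻¹ * |I|)) = |I| := by
      field_simp
    have l2 : ρ ^ n * (ρ ^ b)⁻¹ * (κ * (C * (ρ ^ b * Λ)) + κ⁻¹ * ((ρ ^ n * ρ ^ 2)⁻¹ * J))
        = κ * ρ ^ n * (C * Λ) + κ⁻¹ * (ρ ^ b)⁻¹ * (ρ ^ 2)⁻¹ * J := by field_simp
    rwa [l1, l2] at this
  rw [← a1, ← a2] at key2
  linarith

end Liouville

section LiouvilleBounded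

variable {n : ℕ} {p : ℝ}

lemma exponent_neg (hp : 1 < p) (hpn : ((n : ℝ) - 2) * p < n) : (n : ℝ) - 2 - 2 / (p - 1) < 0 := by
  have h : (n : ℝ) - 2 < 2 / (p - 1) := by
    rw [lt_div_iff₀ (by linarith)]; linarith
  linarith

lemma exists_rpow_mul_le {e c : ℝ} (he : e < 0) (hc : 0 < c) (A m : ℝ) :
    ∃ R ≥ m, R ^ e * A ≤ c := by
  have h1 : Tendsto (fun R : ℝ => R ^ e * A) atTop (𝓝 (0 * A)) := by
    have := (tendsto_rpow_neg_atTop (neg_pos.2 he)).mul_const A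
    simpa using this
  rw [zero_mul] at h1
  obtain ⟨R, h2, h3⟩ := ((h1.eventually (gt_mem_nhds hc)).and (eventually_ge_atTop m)).exists
  exact ⟨R, h3, h2.le⟩

lemma toReal_volume_closedBall_prod (n : ℕ) {R : ℝ} (hR : 0 < R) :
    (volume (Metric.closedBall (0 : Eucl n) R ×ˢ Icc (-1) (1 : ℝ))).toReal
      = R ^ n * (2 * volume.real (Metric.ball (0 : Eucl n) 1)) := by
  rw [Measure.volume_eq_prod, Measure.prod_prod, Measure.addHaar_closedBall _ _ hR.le,
    finrank_euclideanSpace_fin, ENNReal.toReal_mul, ENNReal.toReal_mul,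
    ENNReal.toReal_ofReal (by positivity), Real.volume_Icc, ENNReal.toReal_ofReal (by norm_num),
    measureReal_def]
  ring

/-- There is no solution on a large cylinder, bounded there by a constant multiple of its value at
the centre, when the exponent is below the critical one for stationary supersolutions. -/
lemma exists_not_isSol_of_le (n : ℕ) (hp : 1 < p) (hpn : ((n : ℝ) - 2) * p < n) {Λ : ℝ}
    (hΛ : 0 < Λ) : ∃ ρ ≥ 2, ∀ v : Eucl n → ℝ → ℝ, IsSol p v → v 0 0 = 1 →
    ¬ ∀ y ∈ Metric.ball (0 : Eucl n) (4 * ρ), ∀ t ∈ Icc (-(4 * ρ ^ 2)) (4 * ρ ^ 2), v y t ≤ Λ := by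
  have hγ := exponent_neg hp hpn
  set γ := (n : ℝ) - 2 - 2 / (p - 1) with hγd
  obtain ⟨c, hc, hlow⟩ := exists_le_integral_rpow_mul n hp hΛ
  obtain ⟨C1, hC1, hdt⟩ := exists_abs_integral_mul_dt_le_rpow n hp
  obtain ⟨C, hC, η, hη⟩ := exists_isCutoff n hp
  set A := C * (2 * C) ^ (1 / (p - 1)) * (2 * volume.real (Metric.ball (0 : Eucl n) 1)) with hA
  obtain ⟨R, hR, hRA⟩ := exists_rpow_mul_le hγ (by positivity : 0 < c / 8) A 2
  have hR0 : 0 < R := by linarith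
  set φ : Eucl n × ℝ → ℝ := fun X => η (dil (1 / R) 1 X) with hφ
  have hφs : ContDiff ℝ 2 φ := hη.contDiff.comp (dil (1 / R) 1).contDiff
  have hφ1 : ∀ X ∈ Metric.closedBall (0 : Eucl n) 1 ×ˢ Icc (-(1 / 2)) (1 / 2 : ℝ), φ X = 1 := by
    intro X hX
    apply hη.eq_one
    have h1 : ‖X.1‖ ≤ 1 := mem_closedBall_zero_iff.1 hX.1
    refine ⟨mem_closedBall_zero_iff.2 ?_, ?_⟩
    · rw [dil_apply, norm_smul, Real.norm_of_nonneg (by positivity), one_div_mul_eq_div,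
        div_le_iff₀ hR0]
      linarith
    · rw [dil_apply, one_mul]; exact hX.2
  have hφz : ∀ X ∉ Metric.closedBall (0 : Eucl n) R ×ˢ Icc (-1) (1 : ℝ), φ X = 0 := by
    intro X hX
    apply hη.eq_zero
    intro h
    apply hX
    have h1 : ‖(1 / R) • X.1‖ ≤ 1 := mem_closedBall_zero_iff.1 h.1
    rw [norm_smul, Real.norm_of_nonneg (by positivity), one_div_mul_eq_div,
      div_le_iff₀ hR0] at h1
    have h2 := h.2
    rw [dil_apply, one_mul] at h2
    exact ⟨mem_closedBall_zero_iff.2 (by linarith), h2⟩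
  have hφ0 : ∀ X, 0 ≤ φ X := fun X => hη.nonneg _
  have hslap : ∀ X, |slap φ X| ≤ C * (1 / R) ^ 2 * φ X ^ (1 / p) := by
    intro X
    rw [hφ, slap_dil hη.contDiff, abs_mul, abs_of_nonneg (by positivity)]
    have := mul_le_mul_of_nonneg_left (hη.slap_le (dil (1 / R) 1 X))
      (by positivity : 0 ≤ (1 / R) ^ 2)
    linarith
  obtain ⟨ρ, hρ, hρA⟩ := exists_rpow_mul_le (by linarith : γ / 2 < 0) (by positivity : 0 < c / 8)
    (C1 * Λ + ∫ X, φ X ^ 2) (2 * R)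
  have hρ2 : 2 ≤ ρ := by linarith
  refine ⟨ρ, hρ2, fun v hv h1 hS => ?_⟩
  set L := Metric.closedBall (0 : Eucl n) R ×ˢ Icc (-1) (1 : ℝ) with hL
  have hLc : IsCompact L := (isCompact_closedBall _ _).prod isCompact_Icc
  have h16 : 16 ≤ 4 * ρ ^ 2 := by nlinarith
  have hSL : ∀ X ∈ L, v X.1 X.2 ≤ Λ := fun X hX => by
    have hX2 : -1 ≤ X.2 ∧ X.2 ≤ 1 := hX.2
    exact hS _ (Metric.closedBall_subset_ball (by linarith) hX.1) _ ⟨by linarith, by linarith⟩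
  have hSL' : ∀ X ∈ L, |v X.1 X.2| ≤ Λ := fun X hX => by
    rw [abs_of_pos (hv.pos _ _)]; exact hSL X hX
  have hm := hv.measurable
  have cdt := continuous_dt (hφs.of_le (by norm_num))
  have csl := continuous_slap hφs
  have zdt := dt_eq_zero_of_off hLc.isClosed hφz
  have zsl := slap_eq_zero_of_off hLc.isClosed hφz
  have i1 : Integrable fun X : Eucl n × ℝ => v X.1 X.2 ^ p * φ X :=
    integrable_mul_of_bdd_on (hm.pow_const p) hφs.continuous hLc (S := Λ ^ p)
      (fun X hX => by
        rw [abs_of_pos (Real.rpow_pos_of_pos (hv.pos _ _) _)]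
        exact Real.rpow_le_rpow (hv.pos _ _).le (hSL X hX) (by linarith)) hφz
  have i2 : Integrable fun X : Eucl n × ℝ => v X.1 X.2 * dt φ X :=
    integrable_mul_of_bdd_on hm cdt hLc hSL' zdt
  have i3 : Integrable fun X : Eucl n × ℝ => v X.1 X.2 * slap φ X :=
    integrable_mul_of_bdd_on hm csl hLc hSL' zsl
  have hX := hlow v hv h1 φ hφs.continuous hφ0 hφ1 (fun y hy t ht =>
    hS y (Metric.ball_subset_ball (by linarith) hy) t ⟨by linarith [ht.1], by linarith [ht.2]⟩) i1
  have hw := hv.weak_eq hp (x0 := 0) (R := 4 * ρ) (R' := R) (α := -(4 * ρ ^ 2)) (α' := -1)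
    (β' := 1) (β := 4 * ρ ^ 2) (by linarith) (by linarith) (by linarith) (by norm_num)
    (by linarith) hS hφs hφ0 hφz
  have hd := hdt v hv Λ hΛ.le ρ R hρ2 hρ hS φ hφs hφz
  have hs := hv.integral_mul_abs_le hp (c := C * (1 / R) ^ 2) (by positivity) hLc hφs.continuous
    csl hφ0 hφz zsl hSL hslap
  rw [hL, toReal_volume_closedBall_prod n hR0] at hs
  have es : C * (1 / R) ^ 2 * (2 * (C * (1 / R) ^ 2)) ^ (1 / (p - 1))
      * (R ^ n * (2 * volume.real (Metric.ball (0 : Eucl n) 1))) = R ^ γ * A := by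
    have e1 : 2 * (C * (1 / R) ^ 2) = 2 * C * (1 / R) ^ 2 := by ring
    have e2 : ((1 / R) ^ 2) ^ (1 / (p - 1)) = R ^ (-(2 / (p - 1))) := by
      rw [one_div, inv_pow, ← Real.rpow_natCast R 2, ← Real.rpow_neg hR0.le,
        ← Real.rpow_mul hR0.le]
      congr 1; push_cast; ring
    have e3 : R ^ γ = (1 / R) ^ 2 * R ^ (-(2 / (p - 1))) * R ^ n := by
      rw [one_div, inv_pow, ← Real.rpow_natCast R 2, ← Real.rpow_neg hR0.le,
        ← Real.rpow_natCast R n, ← Real.rpow_add hR0, ← Real.rpow_add hR0]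
      congr 1; push_cast; ring
    rw [e1, Real.mul_rpow (by positivity) (by positivity), e2, e3, hA]
    ring
  rw [es] at hs
  have hexp : ∫ X : Eucl n × ℝ, v X.1 X.2 * (dt φ X + slap φ X)
      = (∫ X : Eucl n × ℝ, v X.1 X.2 * dt φ X) + ∫ X : Eucl n × ℝ, v X.1 X.2 * slap φ X := by
    rw [← integral_add i2 i3]
    simp only [mul_add]
  have hsl : |∫ X : Eucl n × ℝ, v X.1 X.2 * slap φ X|
      ≤ ∫ X : Eucl n × ℝ, v X.1 X.2 * |slap φ X| := by
    refine abs_integral_le_integral_abs.trans (le_of_eq ?_)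
    congr 1; ext X
    rw [abs_mul, abs_of_pos (hv.pos _ _)]
  have a1 := neg_abs_le (∫ X : Eucl n × ℝ, v X.1 X.2 * dt φ X)
  have a2 := neg_abs_le (∫ X : Eucl n × ℝ, v X.1 X.2 * slap φ X)
  rw [hexp] at hw
  linarith

end LiouvilleBounded

section Parabolic

variable {n : ℕ} {p : ℝ}

/-- The parabolic norm on space-time. -/
noncomputable def pnorm (X : Eucl n × ℝ) : ℝ := max ‖X.1‖ √|X.2|

lemma pnorm_nonneg (X : Eucl n × ℝ) : 0 ≤ pnorm X := (norm_nonneg _).trans (le_max_left _ _)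

lemma pnorm_zero : pnorm (0 : Eucl n × ℝ) = 0 := by simp [pnorm]

lemma pnorm_le_iff {X : Eucl n × ℝ} {r : ℝ} (hr : 0 ≤ r) :
    pnorm X ≤ r ↔ X.1 ∈ Metric.closedBall 0 r ∧ X.2 ∈ Icc (-r ^ 2) (r ^ 2) := by
  rw [pnorm, max_le_iff, mem_closedBall_zero_iff, Real.sqrt_le_left hr, abs_le, mem_Icc]

lemma pnorm_add_le (X Y : Eucl n × ℝ) : pnorm (X + Y) ≤ pnorm X + pnorm Y := by
  refine max_le ((norm_add_le _ _).trans (add_le_add (le_max_left _ _) (le_max_left _ _))) ?_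
  have h : √|(X + Y).2| ≤ √|X.2| + √|Y.2| := by
    rw [Real.sqrt_le_left (by positivity), add_sq, Real.sq_sqrt (abs_nonneg _),
      Real.sq_sqrt (abs_nonneg _)]
    have := abs_add_le X.2 Y.2
    have : 0 ≤ 2 * √|X.2| * √|Y.2| := by positivity
    simp only [Prod.snd_add]
    linarith
  exact h.trans (add_le_add (le_max_right _ _) (le_max_right _ _))

lemma pnorm_smul {l : ℝ} (hl : 0 ≤ l) (y : Eucl n) (t : ℝ) :
    pnorm (l • y, l ^ 2 * t) = l * pnorm (y, t) := by
  rw [pnorm, pnorm, mul_max_of_nonneg _ _ hl]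
  simp only
  rw [norm_smul, Real.norm_of_nonneg hl, abs_mul, abs_of_nonneg (sq_nonneg l),
    Real.sqrt_mul (sq_nonneg l), Real.sqrt_sq hl]

/-- Near-maximisation of a bounded function against a power of the distance to the parabolic
unit sphere. -/
lemma exists_near_max_pnorm {f : Eucl n × ℝ → ℝ} (h0 : ∀ X, 0 < f X) {S : ℝ}
    (hS : ∀ X, pnorm X < 1 → f X ≤ S) (k : ℕ) :
    ∃ X, pnorm X < 1 ∧ f 0 ≤ 2 * (f X * (1 - pnorm X) ^ k) ∧
      ∀ Y, pnorm Y ≤ (1 - pnorm X) / 2 → f (X + Y) ≤ 2 ^ (k + 1) * f X := by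
  set g : Eucl n × ℝ → ℝ := fun X => f X * (1 - pnorm X) ^ k with hg
  set A := g '' {X | pnorm X < 1} with hA
  have h00 : (0 : Eucl n × ℝ) ∈ {X : Eucl n × ℝ | pnorm X < 1} := by
    rw [mem_ofPred_eq, pnorm_zero]; exact one_pos
  have hgl : ∀ X, pnorm X < 1 → g X ≤ S := fun X hX => by
    refine (mul_le_of_le_one_right (h0 X).le (pow_le_one₀ (by linarith) ?_)).trans (hS X hX)
    linarith [pnorm_nonneg X]
  have hbdd : BddAbove A := ⟨S, by rintro _ ⟨X, hX, rfl⟩; exact hgl X hX⟩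
  have hg0 : g 0 = f 0 := by simp [hg, pnorm_zero]
  have hG : f 0 ≤ sSup A := hg0 ▸ le_csSup hbdd (mem_image_of_mem g h00)
  have hGpos : 0 < sSup A := (h0 0).trans_le hG
  obtain ⟨_, ⟨X, hX, rfl⟩, hX2⟩ := exists_lt_of_lt_csSup (Set.Nonempty.image g ⟨0, h00⟩)
    (by linarith : sSup A / 2 < sSup A)
  have hX1 : pnorm X < 1 := hX
  refine ⟨X, hX, by linarith, fun Y hY => ?_⟩
  have h1 := pnorm_add_le X Y
  have h2 : g (X + Y) ≤ sSup A :=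
    le_csSup hbdd (mem_image_of_mem g (show pnorm (X + Y) < 1 by linarith))
  have hδ : 0 < ((1 - pnorm X) / 2) ^ k := pow_pos (by linarith) k
  have h3 : f (X + Y) * ((1 - pnorm X) / 2) ^ k ≤ g (X + Y) :=
    mul_le_mul_of_nonneg_left (pow_le_pow_left₀ (by linarith) (by linarith) k) (h0 _).le
  have h4 : f (X + Y) * ((1 - pnorm X) / 2) ^ k
      ≤ 2 ^ (k + 1) * f X * ((1 - pnorm X) / 2) ^ k := by
    refine h3.trans (h2.trans ?_)
    have : 2 ^ (k + 1) * f X * ((1 - pnorm X) / 2) ^ k = 2 * g X := by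
      simp only [hg, div_pow, pow_succ]; field_simp
    linarith
  exact le_of_mul_le_mul_right h4 hδ

lemma setIntegral_ball_rescale (f : Eucl n → ℝ) (x : Eucl n) {l : ℝ} (hl : 0 < l) :
    ∫ y in Metric.ball (0 : Eucl n) 1, f (x + l • y)
      = (l ^ n)⁻¹ * ∫ y in Metric.ball x l, f y := by
  have e : ∀ y, (Metric.ball (0 : Eucl n) 1).indicator (fun y => f (x + l • y)) y
      = (fun z => (Metric.ball x l).indicator f (x + z)) (l • y) := by
    intro y
    simp only [indicator]
    congr 1
    rw [mem_ball_zero_iff, mem_ball_iff_norm, add_sub_cancel_left, norm_smul,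
      Real.norm_of_nonneg hl.le]
    exact propext (by rw [mul_lt_iff_lt_one_right hl])
  rw [← integral_indicator measurableSet_ball, integral_congr_ae (Eventually.of_forall e),
    Measure.integral_comp_smul_of_nonneg volume
      (fun z => (Metric.ball x l).indicator f (x + z)) l (hR := hl.le),
    integral_add_left_eq_self (fun z => (Metric.ball x l).indicator f z) x,
    integral_indicator measurableSet_ball, finrank_euclideanSpace_fin, smul_eq_mul]

lemma rescale_zero {e : ℝ} {u : Eucl n → ℝ → ℝ} {x : Eucl n} {t l : ℝ} :
    rescale e u x t l 0 0 = l ^ e * u x t := by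
  simp [rescale]

lemma setIntegral_rescale (e : ℝ) (u : Eucl n → ℝ → ℝ) (x : Eucl n) (t : ℝ) {l : ℝ} (hl : 0 < l)
    (s : ℝ) : ∫ y in Metric.ball (0 : Eucl n) 1, rescale e u x t l y s
      = l ^ e * ((l ^ n)⁻¹ * ∫ y in Metric.ball x l, u y (t + l ^ 2 * s)) := by
  rw [← setIntegral_ball_rescale (fun y => u y (t + l ^ 2 * s)) x hl, ← integral_const_mul]
  rfl

/-- Scale invariant lower bound of a solution by earlier means. -/
lemma exists_setIntegral_ball_le (n : ℕ) (hp : 1 < p) : ∃ C > 0, ∀ u : Eucl n → ℝ → ℝ, IsSol p u →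
    ∀ x t, ∀ l > 0, ∫ y in Metric.ball x l, u y (t - l ^ 2) ≤ C * l ^ n * u x t := by
  obtain ⟨C, hC, h⟩ := exists_integral_ball_le n
  refine ⟨C, hC, fun u hu x t l hl => ?_⟩
  have h1 := h p _ (hu.rescale hp x t hl)
  rw [setIntegral_rescale _ _ _ _ hl, rescale_zero, mul_neg_one, ← sub_eq_add_neg] at h1
  have hb := Real.rpow_pos_of_pos hl (2 / (p - 1))
  have hn : 0 < l ^ n := by positivity
  have h2 := mul_le_mul_of_nonneg_left h1
    (by positivity : 0 ≤ l ^ n * (l ^ (2 / (p - 1)))⁻¹)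
  field_simp at h2
  linarith

end Parabolic

section Universal

variable {n : ℕ} {p : ℝ}

/-- Universal bound at unit scale. -/
lemma exists_le_of_bounded_unit (n : ℕ) (hp : 1 < p) (hpn : ((n : ℝ) - 2) * p < n) :
    ∃ C > 0, ∀ v : Eucl n → ℝ → ℝ, IsSol p v → ∀ S,
    (∀ X : Eucl n × ℝ, pnorm X < 1 → v X.1 X.2 ≤ S) → v 0 0 ≤ C := by
  have hp1 : 0 < p - 1 := by linarith
  set b := 2 / (p - 1) with hb
  have hb0 : 0 < b := by positivity
  obtain ⟨ρ, hρ, hno⟩ := exists_not_isSol_of_le n hp hpn (Λ := 4 ^ b)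
    (Real.rpow_pos_of_pos (by norm_num) b)
  have hρ0 : 0 < ρ := by linarith
  refine ⟨(16 * ρ) ^ b, Real.rpow_pos_of_pos (by linarith) b, fun v hv S hS => ?_⟩
  have hpow : ∀ {a : ℝ}, 0 < a → (a ^ b⁻¹) ^ b = a := fun ha => by
    rw [← Real.rpow_mul ha.le, inv_mul_cancel₀ hb0.ne', Real.rpow_one]
  obtain ⟨X, hX1, hX2, hX3⟩ := exists_near_max_pnorm (f := fun X : Eucl n × ℝ => v X.1 X.2 ^ b⁻¹)
    (fun X => Real.rpow_pos_of_pos (hv.pos _ _) _) (S := S ^ b⁻¹)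
    (fun X hX => Real.rpow_le_rpow (hv.pos _ _).le (hS X hX) (by positivity)) 1
  simp only [pow_one, Prod.fst_zero, Prod.snd_zero] at hX2 hX3
  set m := v X.1 X.2 ^ b⁻¹ with hm
  have hm0 : 0 < m := Real.rpow_pos_of_pos (hv.pos _ _) _
  have hmb : m ^ b = v X.1 X.2 := hpow (hv.pos _ _)
  have hsmall : m * (1 - pnorm X) < 8 * ρ := by
    by_contra hlarge
    push Not at hlarge
    have hl : 0 < m⁻¹ := inv_pos.2 hm0
    refine hno _ (hv.rescale hp X.1 X.2 hl) ?_ fun y hy t ht => ?_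
    · rw [rescale_zero, ← hb, Real.inv_rpow hm0.le, hmb, inv_mul_cancel₀ (hv.pos _ _).ne']
    · have h1 : pnorm (y, t) ≤ 4 * ρ := by
        rw [pnorm_le_iff (by linarith)]
        refine ⟨Metric.ball_subset_closedBall hy, ?_, ?_⟩
        · have := ht.1
          simp only
          nlinarith [sq_nonneg ρ]
        · have := ht.2
          simp only
          nlinarith [sq_nonneg ρ]
      have h2 : pnorm (m⁻¹ • y, m⁻¹ ^ 2 * t) ≤ (1 - pnorm X) / 2 := by
        rw [pnorm_smul hl.le, inv_mul_le_iff₀ hm0]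
        linarith
      have h3 := hX3 _ h2
      have h4 := Real.rpow_le_rpow (Real.rpow_nonneg (hv.pos _ _).le _) h3 hb0.le
      rw [hpow (hv.pos _ _), Real.mul_rpow (by norm_num) hm0.le, hmb] at h4
      rw [show (2 : ℝ) ^ (1 + 1) = 4 by norm_num] at h4
      simp only [Prod.fst_add, Prod.snd_add] at h4
      rw [rescale, Real.inv_rpow hm0.le, ← hb, hmb, inv_mul_le_iff₀ (hv.pos _ _)]
      linarith
  have h5 : v 0 0 ^ b⁻¹ ≤ 16 * ρ := by linarith
  have h6 := Real.rpow_le_rpow (Real.rpow_nonneg (hv.pos _ _).le _) h5 hb0.le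
  rwa [hpow (hv.pos _ _)] at h6

lemma pnorm_lt_one_mem {x : Eucl n} {t l : ℝ} (hl : 0 < l) {X : Eucl n × ℝ} (hX : pnorm X < 1) :
    x + l • X.1 ∈ Metric.ball x l ∧ t + l ^ 2 * X.2 ∈ Icc (t - l ^ 2) (t + l ^ 2) := by
  have h1 : ‖X.1‖ < 1 := (le_max_left _ _).trans_lt hX
  have h2 := ((pnorm_le_iff zero_le_one).1 hX.le).2
  have h3 : -1 ≤ X.2 := by simpa using h2.1
  have h4 : X.2 ≤ 1 := by simpa using h2.2
  have hl2 : 0 < l ^ 2 := by positivity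
  refine ⟨?_, by nlinarith, by nlinarith⟩
  rw [mem_ball_iff_norm, add_sub_cancel_left, norm_smul, Real.norm_of_nonneg hl.le]
  exact (mul_lt_iff_lt_one_right hl).2 h1

/-- Universal bound for solutions on a parabolic cylinder. -/
lemma exists_rpow_mul_le_of_bounded (n : ℕ) (hp : 1 < p) (hpn : ((n : ℝ) - 2) * p < n) :
    ∃ C > 0, ∀ u : Eucl n → ℝ → ℝ, IsSol p u → ∀ x t, ∀ l > 0, ∀ S,
    (∀ y ∈ Metric.ball x l, ∀ s ∈ Icc (t - l ^ 2) (t + l ^ 2), u y s ≤ S) →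
    l ^ (2 / (p - 1)) * u x t ≤ C := by
  obtain ⟨C, hC, h⟩ := exists_le_of_bounded_unit n hp hpn
  refine ⟨C, hC, fun u hu x t l hl S hS => ?_⟩
  have h1 := h _ (hu.rescale hp x t hl) (l ^ (2 / (p - 1)) * S) fun X hX => by
    obtain ⟨h2, h3⟩ := pnorm_lt_one_mem (x := x) (t := t) hl hX
    exact mul_le_mul_of_nonneg_left (hS _ h2 _ h3) (Real.rpow_pos_of_pos hl _).le
  rwa [rescale_zero] at h1

/-- Pointwise bound by the spatial means at unit scale. -/
lemma exists_le_mul_of_setIntegral_le_unit (n : ℕ) (hp : 1 < p) (hpn : ((n : ℝ) - 2) * p < n) :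
    ∃ C > 0, ∀ v : Eucl n → ℝ → ℝ, IsSol p v → ∀ S μ,
    (∀ X : Eucl n × ℝ, pnorm X < 1 → v X.1 X.2 ≤ S) →
    (∀ s ∈ Icc (-1) (1 : ℝ), ∫ y in Metric.ball (0 : Eucl n) 1, v y s ≤ μ) → v 0 0 ≤ C * μ := by
  obtain ⟨C1, hC1, hU⟩ := exists_rpow_mul_le_of_bounded n hp hpn
  obtain ⟨C2, hC2, hG⟩ := exists_le_of_le_on_cylinder n
  set b := 2 / (p - 1) with hb
  set a : ℝ := 2 ^ (n + 1) with ha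
  have ha0 : 0 < a := by positivity
  set K := (a * C1) ^ (p - 1) with hK
  have hK0 : 0 < K := Real.rpow_pos_of_pos (by positivity) _
  set τ := min 1 (1 / (2 * (C2 * (1 + K) * a))) with hτ
  have hτ0 : 0 < τ := lt_min one_pos (by positivity)
  have hτ1 : τ ≤ 1 := min_le_left _ _
  have hτa : C2 * (1 + K) * τ * a ≤ 1 / 2 := by
    have : τ * (2 * (C2 * (1 + K) * a)) ≤ 1 := by
      rw [← le_div_iff₀ (by positivity)]; exact min_le_right _ _
    linarith
  set D := 2 * C2 * τ ^ (-((n : ℝ) / 2)) with hD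
  have hD0 : 0 < D := mul_pos (by positivity) (Real.rpow_pos_of_pos hτ0 _)
  refine ⟨a * D, by positivity, fun v hv S μ hS hμ => ?_⟩
  obtain ⟨X, hX1, hX2, hX3⟩ := exists_near_max_pnorm (f := fun X : Eucl n × ℝ => v X.1 X.2)
    (fun X => hv.pos _ _) hS n
  simp only [Prod.fst_zero, Prod.snd_zero] at hX2
  set l := (1 - pnorm X) / 2 with hl
  have hl0 : 0 < l := by linarith
  have hlb : 0 < l ^ b := Real.rpow_pos_of_pos hl0 b
  have hln : 0 < l ^ n := by positivity
  have hmax : ∀ Y : Eucl n × ℝ, pnorm Y ≤ 1 →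
      rescale b v X.1 X.2 l Y.1 Y.2 ≤ a * (l ^ b * v X.1 X.2) := by
    intro Y hY
    have := hX3 (l • Y.1, l ^ 2 * Y.2) (by rw [pnorm_smul hl0.le]; exact mul_le_of_le_one_right hl0.le hY)
    rw [rescale]
    calc l ^ b * v (X.1 + l • Y.1) (X.2 + l ^ 2 * Y.2) ≤ l ^ b * (a * v X.1 X.2) := by gcongr; exact this
      _ = _ := by ring
  have hw := hv.rescale hp X.1 X.2 hl0
  rw [← hb] at hw
  have hUX : l ^ b * v X.1 X.2 ≤ C1 := by
    have := hU _ hw 0 0 1 one_pos (a * (l ^ b * v X.1 X.2)) fun y hy s hs => by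
      refine hmax (y, s) ((pnorm_le_iff zero_le_one).2 ⟨Metric.ball_subset_closedBall hy, ?_⟩)
      simpa using hs
    rwa [Real.one_rpow, one_mul, rescale_zero] at this
  have hz0 : 0 < l ^ b * v X.1 X.2 := mul_pos hlb (hv.pos _ _)
  have h1 := hG p _ hp hw (a * (l ^ b * v X.1 X.2)) K
    (fun y hy t ht => hmax (y, t) ((pnorm_le_iff zero_le_one).2
      ⟨Metric.ball_subset_closedBall hy, by simpa using ht.1, by
        have := ht.2
        simp only [one_pow]
        linarith⟩))
    (Real.rpow_le_rpow (by positivity) (by gcongr) (by linarith)) τ ⟨hτ0, hτ1⟩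
  rw [setIntegral_rescale _ _ _ _ hl0, rescale_zero] at h1
  obtain ⟨hx1, hx2⟩ := (pnorm_le_iff zero_le_one).1 hX1.le
  have hμ1 : ∫ y in Metric.ball X.1 l, v y (X.2 + l ^ 2 * -τ) ≤ μ := by
    have hN := (pnorm_le_iff (pnorm_nonneg X)).1 le_rfl
    have hpn0 := pnorm_nonneg X
    have h2 : X.2 + l ^ 2 * -τ ∈ Icc (-1) (1 : ℝ) := by
      have h3 := hN.2.1
      have h4 := hN.2.2
      have hl1 : l ≤ 1 - pnorm X := by linarith
      have hl2 : l ^ 2 ≤ (1 - pnorm X) ^ 2 := pow_le_pow_left₀ hl0.le hl1 2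
      have h6 : l ^ 2 * τ ≤ l ^ 2 := mul_le_of_le_one_right (by positivity) hτ1
      have h7 : 0 ≤ l ^ 2 * τ := by positivity
      constructor <;> nlinarith
    refine le_trans ?_ (hμ _ h2)
    have hc : Continuous fun y => v y (X.2 + l ^ 2 * -τ) := (hv.contDiff_x _).continuous
    refine setIntegral_mono_set ?_ (Eventually.of_forall fun y => (hv.pos _ _).le) ?_
    · exact (hc.continuousOn.integrableOn_compact (isCompact_closedBall 0 1)).mono_set
        Metric.ball_subset_closedBall
    · refine (Metric.ball_subset_ball' ?_).eventuallyLE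
      rw [dist_zero_right]
      have : ‖X.1‖ ≤ pnorm X := le_max_left _ _
      linarith
  have h2 : l ^ b * v X.1 X.2 ≤ D * (l ^ b * ((l ^ n)⁻¹ * μ)) := by
    have h3 : C2 * (1 + K) * τ * (a * (l ^ b * v X.1 X.2)) ≤ 1 / 2 * (l ^ b * v X.1 X.2) := by
      have := mul_le_mul_of_nonneg_right hτa hz0.le
      linarith
    have h4 : D * (l ^ b * ((l ^ n)⁻¹ * ∫ y in Metric.ball X.1 l, v y (X.2 + l ^ 2 * -τ)))
        ≤ D * (l ^ b * ((l ^ n)⁻¹ * μ)) := by gcongr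
    rw [hD] at h4 ⊢
    linarith
  have h3 : v X.1 X.2 * l ^ n ≤ D * μ := by
    have h4 := mul_le_mul_of_nonneg_left h2 (by positivity : 0 ≤ (l ^ b)⁻¹ * l ^ n)
    field_simp at h4
    linarith
  have h4 : 2 * (v X.1 X.2 * (1 - pnorm X) ^ n) = a * (v X.1 X.2 * l ^ n) := by
    rw [hl, ha, div_pow, pow_succ]; field_simp
  calc v 0 0 ≤ a * (v X.1 X.2 * l ^ n) := by rw [← h4]; exact hX2
    _ ≤ a * (D * μ) := by gcongr
    _ = a * D * μ := by ring

/-- Pointwise bound by the spatial means on a parabolic cylinder. -/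
lemma exists_pow_mul_le_of_setIntegral_le (n : ℕ) (hp : 1 < p) (hpn : ((n : ℝ) - 2) * p < n) :
    ∃ C > 0, ∀ u : Eucl n → ℝ → ℝ, IsSol p u → ∀ x t, ∀ l > 0, ∀ S μ,
    (∀ y ∈ Metric.ball x l, ∀ s ∈ Icc (t - l ^ 2) (t + l ^ 2), u y s ≤ S) →
    (∀ s ∈ Icc (t - l ^ 2) (t + l ^ 2), ∫ y in Metric.ball x l, u y s ≤ μ) →
    l ^ n * u x t ≤ C * μ := by
  obtain ⟨C, hC, h⟩ := exists_le_mul_of_setIntegral_le_unit n hp hpn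
  refine ⟨C, hC, fun u hu x t l hl S μ hS hμ => ?_⟩
  have hlb := Real.rpow_pos_of_pos hl (2 / (p - 1))
  have hln : 0 < l ^ n := by positivity
  have h1 := h _ (hu.rescale hp x t hl) (l ^ (2 / (p - 1)) * S)
    (l ^ (2 / (p - 1)) * ((l ^ n)⁻¹ * μ)) (fun X hX => by
      obtain ⟨h2, h3⟩ := pnorm_lt_one_mem (x := x) (t := t) hl hX
      exact mul_le_mul_of_nonneg_left (hS _ h2 _ h3) hlb.le) (fun s hs => by
      rw [setIntegral_rescale _ _ _ _ hl]
      have hl2 : 0 < l ^ 2 := by positivity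
      have := hμ (t + l ^ 2 * s) ⟨by nlinarith [hs.1], by nlinarith [hs.2]⟩
      gcongr)
  rw [rescale_zero] at h1
  have h4 := mul_le_mul_of_nonneg_left h1 (by positivity : 0 ≤ (l ^ (2 / (p - 1)))⁻¹ * l ^ n)
  field_simp at h4
  linarith

end Universal

section LocallyBounded

variable {n : ℕ} {p : ℝ}

lemma exists_forall_le_of_isCompact {E : Type*} [TopologicalSpace E] {f : E → ℝ} {K : Set E}
    (hK : IsCompact K) (h : ∀ X ∈ K, ∃ S, ∀ᶠ Y in 𝓝 X, f Y ≤ S) : ∃ S, ∀ X ∈ K, f X ≤ S := by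
  refine hK.induction_on (p := fun A => ∃ S, ∀ X ∈ A, f X ≤ S) ⟨0, by simp⟩ ?_ ?_ ?_
  · exact fun A B hAB ⟨S, hS⟩ => ⟨S, fun X hX => hS X (hAB hX)⟩
  · rintro A B ⟨S, hS⟩ ⟨T, hT⟩
    refine ⟨max S T, fun X hX => ?_⟩
    rcases hX with hX | hX
    · exact (hS X hX).trans (le_max_left _ _)
    · exact (hT X hX).trans (le_max_right _ _)
  · intro X hX
    obtain ⟨S, hS⟩ := h X hX
    exact ⟨_, mem_nhdsWithin_of_mem_nhds hS, S, fun Y hY => hY⟩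

/-- Solutions are locally bounded in space-time. -/
lemma IsSol.eventually_le {u : Eucl n → ℝ → ℝ} (hu : IsSol p u) (hp : 1 < p)
    (hpn : ((n : ℝ) - 2) * p < n) (X : Eucl n × ℝ) : ∃ S, ∀ᶠ Y in 𝓝 X, u Y.1 Y.2 ≤ S := by
  obtain ⟨C1, hC1, hM⟩ := exists_setIntegral_ball_le n hp
  obtain ⟨C2, hC2, hW⟩ := exists_pow_mul_le_of_setIntegral_le n hp hpn
  set E : Set (Eucl n × ℝ) := {X | ¬ ∃ S, ∀ᶠ Y in 𝓝 X, u Y.1 Y.2 ≤ S} with hE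
  by_contra hX
  have hEc : IsClosed E := by
    rw [← isOpen_compl_iff, isOpen_iff_mem_nhds]
    intro Y hY
    obtain ⟨S, hS⟩ := not_not.1 hY
    filter_upwards [eventually_eventually_nhds.2 hS] with Z hZ
    exact not_not.2 ⟨S, hZ⟩
  have hFc : ∀ N : ℕ, IsClosed {X : Eucl n × ℝ | ∀ s, 1 ≤ |s - X.2| ∨ u X.1 s ≤ N} := by
    intro N
    rw [Set.ofPred_forall]
    refine isClosed_iInter fun s => IsClosed.union ?_ ?_
    · exact isClosed_le continuous_const (continuous_const.sub continuous_snd).abs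
    · exact isClosed_le ((hu.contDiff_x s).continuous.comp continuous_fst) continuous_const
  have hcov : E ⊆ ⋃ N : ℕ, {X : Eucl n × ℝ | ∀ s, 1 ≤ |s - X.2| ∨ u X.1 s ≤ N} := by
    intro Y _
    obtain ⟨B, hB⟩ := (isCompact_Icc (a := Y.2 - 1) (b := Y.2 + 1)).bddAbove_image
      (hu.contDiff_t Y.1).continuous.continuousOn
    obtain ⟨N, hN⟩ := exists_nat_ge B
    refine mem_iUnion.2 ⟨N, fun s => or_iff_not_imp_left.2 fun hs => ?_⟩
    push Not at hs
    rw [abs_lt] at hs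
    exact (hB (mem_image_of_mem _ ⟨by linarith, by linarith⟩)).trans hN
  obtain ⟨X0, hX0, δ, hδ, N, hN⟩ := exists_inter_ball_subset_of_baire hEc ⟨X, hX⟩ hFc hcov
  set r := min (1 / 4) (δ / 4) with hr
  have hr0 : 0 < r := lt_min (by norm_num) (by linarith)
  have hr1 : r ≤ 1 / 4 := min_le_left _ _
  have hr2 : r ≤ δ / 4 := min_le_right _ _
  have hr3 : 4 * r ^ 2 ≤ r := by nlinarith
  set Q := Metric.closedBall X0.1 (2 * r) ×ˢ Icc (X0.2 - 4 * r ^ 2) (X0.2 + 4 * r ^ 2) with hQ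
  have hQc : IsCompact Q := (isCompact_closedBall _ _).prod isCompact_Icc
  set Z := Prod.fst '' (E ∩ Q) with hZ
  have hZc : IsCompact Z := (hQc.inter_left hEc).image continuous_fst
  have hZne : Z.Nonempty := ⟨X0.1, X0, ⟨hX0, Metric.mem_closedBall_self (by linarith),
    by constructor <;> nlinarith⟩, rfl⟩
  have hZN : ∀ z ∈ Z, ∀ s, |s - X0.2| ≤ 1 / 2 → u z s ≤ N := by
    rintro _ ⟨Y, ⟨hYE, hYQ⟩, rfl⟩ s hs
    have h1 : Y ∈ Metric.ball X0 δ := by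
      rw [Metric.mem_ball, Prod.dist_eq, max_lt_iff]
      refine ⟨(Metric.mem_closedBall.1 hYQ.1).trans_lt (by linarith), ?_⟩
      rw [Real.dist_eq, abs_lt]
      exact ⟨by linarith [hYQ.2.1], by linarith [hYQ.2.2]⟩
    rcases hN ⟨hYE, h1⟩ s with h | h
    · exfalso
      rw [abs_le] at hs
      have : |s - Y.2| < 1 := by
        rw [abs_lt]
        exact ⟨by linarith [hYQ.2.1, hYQ.2.2], by linarith [hYQ.2.1, hYQ.2.2]⟩
      linarith
    · exact h
  have hN0 : (0 : ℝ) ≤ N := N.cast_nonneg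
  apply hX0
  refine ⟨max N (C2 * (C1 * 4 ^ n * N)), ?_⟩
  have hnhds : Metric.ball X0.1 r ×ˢ Ioo (X0.2 - r ^ 2) (X0.2 + r ^ 2) ∈ 𝓝 X0 :=
    prod_mem_nhds (Metric.ball_mem_nhds _ hr0)
      (Ioo_mem_nhds (by linarith [pow_pos hr0 2]) (by linarith [pow_pos hr0 2]))
  filter_upwards [hnhds] with Y hY
  have hr4 : r ^ 2 ≤ 1 / 16 := by nlinarith
  have hY1 := hY.2.1
  have hY2 := hY.2.2
  by_cases hYZ : Y.1 ∈ Z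
  · refine (hZN _ hYZ _ ?_).trans (le_max_left _ _)
    rw [abs_le]
    constructor <;> linarith
  refine le_trans ?_ (le_max_right _ _)
  set d := Metric.infDist Y.1 Z with hd
  have hd0 : 0 < d := (hZc.isClosed.notMem_iff_infDist_pos hZne).1 hYZ
  obtain ⟨z, hz, hzd⟩ := hZc.exists_infDist_eq_dist hZne Y.1
  have hX0Z : X0.1 ∈ Z := ⟨X0, ⟨hX0, Metric.mem_closedBall_self (by linarith),
    by constructor <;> nlinarith⟩, rfl⟩
  have hdr : d < r := (Metric.infDist_le_dist_of_mem hX0Z).trans_lt hY.1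
  have hd2 : d ^ 2 ≤ r ^ 2 := pow_le_pow_left₀ hd0.le hdr.le 2
  have e4 : (d / 2) ^ 2 = d ^ 2 / 4 := by ring
  obtain ⟨S, hS⟩ := exists_forall_le_of_isCompact (f := fun X : Eucl n × ℝ => u X.1 X.2)
    (K := Metric.closedBall Y.1 (d / 2) ×ˢ Icc (Y.2 - (d / 2) ^ 2) (Y.2 + (d / 2) ^ 2))
    ((isCompact_closedBall _ _).prod isCompact_Icc) (by
      intro V hV
      by_contra hVE
      have h1 : dist V.1 Y.1 ≤ d / 2 := hV.1
      have h2 := hV.2.1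
      have h3 := hV.2.2
      have h4 : V.1 ∈ Z := by
        refine ⟨V, ⟨hVE, ?_, ?_, ?_⟩, rfl⟩
        · have h5 := dist_triangle V.1 Y.1 X0.1
          have h6 : dist Y.1 X0.1 < r := hY.1
          rw [Metric.mem_closedBall]
          linarith
        · linarith
        · linarith
      have h5 := Metric.infDist_le_dist_of_mem (x := Y.1) h4
      rw [dist_comm] at h5
      linarith)
  have h1 := hW u hu Y.1 Y.2 (d / 2) (by linarith) S (C1 * (2 * d) ^ n * N)
    (fun y hy s hs => hS (y, s) ⟨Metric.ball_subset_closedBall hy, hs⟩) (fun s hs => by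
      have hs1 := hs.1
      have hs2 := hs.2
      have h2 := hM u hu z (s + (2 * d) ^ 2) (2 * d) (by linarith)
      rw [add_sub_cancel_right] at h2
      have h3 : u z (s + (2 * d) ^ 2) ≤ N := by
        have e5 : (2 * d) ^ 2 = 4 * d ^ 2 := by ring
        apply hZN z hz
        rw [e5, abs_le]
        have := sq_nonneg d
        constructor <;> linarith
      have h4 : ∫ y in Metric.ball Y.1 (d / 2), u y s ≤ ∫ y in Metric.ball z (2 * d), u y s := by
        refine setIntegral_mono_set ?_ (Eventually.of_forall fun y => (hu.pos _ _).le) ?_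
        · exact ((hu.contDiff_x s).continuous.continuousOn.integrableOn_compact
            (isCompact_closedBall z (2 * d))).mono_set Metric.ball_subset_closedBall
        · refine (Metric.ball_subset_ball' ?_).eventuallyLE
          rw [← hzd]
          linarith
      refine h4.trans (h2.trans ?_)
      gcongr)
  have hdn : 0 < (d / 2) ^ n := by positivity
  have e5 : C2 * (C1 * (2 * d) ^ n * N) = (d / 2) ^ n * (C2 * (C1 * 4 ^ n * N)) := by
    have : (2 * d) ^ n = (d / 2) ^ n * 4 ^ n := by rw [← mul_pow]; congr 1; ring
    rw [this]; ring
  rw [e5] at h1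
  exact le_of_mul_le_mul_left h1 hdn

lemma not_isSol (n : ℕ) (hp : 1 < p) (hpn : ((n : ℝ) - 2) * p < n) (u : Eucl n → ℝ → ℝ) :
    ¬ IsSol p u := by
  intro hu
  obtain ⟨C, hC, h⟩ := exists_rpow_mul_le_of_bounded n hp hpn
  have hb : 0 < 2 / (p - 1) := div_pos two_pos (by linarith)
  have hlim : Tendsto (fun l : ℝ => l ^ (2 / (p - 1)) * u 0 0) atTop atTop :=
    (tendsto_rpow_atTop hb).atTop_mul_const (hu.pos 0 0)
  obtain ⟨l, hl, hl0⟩ := ((hlim.eventually_gt_atTop C).and (eventually_gt_atTop 0)).exists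
  obtain ⟨S, hS⟩ := exists_forall_le_of_isCompact (f := fun X : Eucl n × ℝ => u X.1 X.2)
    (K := Metric.closedBall 0 l ×ˢ Icc (0 - l ^ 2) (0 + l ^ 2))
    ((isCompact_closedBall _ _).prod isCompact_Icc) (fun X _ => hu.eventually_le hp hpn X)
  have := h u hu 0 0 l hl0 S fun y hy s hs => hS (y, s) ⟨Metric.ball_subset_closedBall hy, hs⟩
  linarith

end LocallyBounded

end

/-- Liouville theorem: for `n ≥ 1`, `p > 1` with `(n-2)p < n`, the equation
`∂ₜ u = Δu + u^p` has no positive classical solution on `ℝⁿ × ℝ`. -/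
theorem no_positive_entire_solution_heat
    (n : ℕ) (hn : 1 ≤ n) (p : ℝ) (hp : 1 < p) (hpn : ((n : ℝ) - 2) * p < n) :
    ¬ ∃ u : EuclideanSpace ℝ (Fin n) × ℝ → ℝ,
        (∀ t, ContDiff ℝ 2 fun x => u (x, t)) ∧
        (∀ x, ContDiff ℝ 1 fun t => u (x, t)) ∧
        (∀ x t, 0 < u (x, t)) ∧
        (∀ x t, deriv (fun s => u (x, s)) t
            = lap (fun y => u (y, t)) x + u (x, t) ^ p) := by
  rintro ⟨u, h1, h2, h3, h4⟩
  exact not_isSol n hp hpn (fun x t => u (x, t)) ⟨h1, h2, h3, fun x t => h4 x t⟩
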